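/- The third homotopy group π₃(SU(3)/SO(3)) of the coset space SU(3)/SO(3), based at the coset of the identity, is isomorphic to the cyclic group ℤ/4ℤ. -/

import Mathlib

open Matrix
open scoped Topology

noncomputable section

/-- The special unitary group `SU(n)`, i.e. the group of unitary `n×n` complex matrices of
determinant one, as a subgroup of the unitary group (so that its topology is the subspace
topology from the `n×n` complex matrices). -/
def SU (n : ℕ) : Subgroup (Matrix.unitaryGroup (Fin n) ℂ) :=
  (Matrix.detMonoidHom.comp (Matrix.unitaryGroup (Fin n) ℂ).subtype).ker

/-- The special orthogonal group `SO(n)`, regarded as the closed subgroup of `SU(n)` consisting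
of the matrices with real entries (i.e. the image of the real matrices under the entrywise
inclusion `ℝ → ℂ`). -/
def SOinSU (n : ℕ) : Subgroup (SU n) where
  carrier := {A | ∃ B : Matrix (Fin n) (Fin n) ℝ,
    ((A : Matrix.unitaryGroup (Fin n) ℂ) : Matrix (Fin n) (Fin n) ℂ) =
      Complex.ofRealHom.mapMatrix B}
  one_mem' := ⟨1, by simp⟩
  mul_mem' := by
    rintro a b ⟨Ba, hBa⟩ ⟨Bb, hBb⟩
    exact ⟨Ba * Bb, by push_cast [hBa, hBb]; rw [_root_.map_mul]⟩
  inv_mem' := by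
    rintro a ⟨B, hB⟩
    refine ⟨Bᵀ, ?_⟩
    have : ((a⁻¹ : SU n) : Matrix.unitaryGroup (Fin n) ℂ) =
        star (a : Matrix.unitaryGroup (Fin n) ℂ) := rfl
    rw [this]
    ext i j
    have := congrArg (fun M => M j i) hB
    simp only [RingHom.mapMatrix_apply, Matrix.map_apply, Complex.ofRealHom_eq_coe] at this ⊢
    simp [Matrix.conjTranspose_apply, this, Complex.conj_ofReal, Matrix.transpose_apply]

section HomotopyToolkit

open scoped unitInterval Topology.Homotopy

variable {N X Y Z : Type} [TopologicalSpace X] [TopologicalSpace Y] [TopologicalSpace Z]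

theorem GenLoop.homotopic_of_map {x : X} {f g : Ω^ N X x} (H : I × (N → I) → X)
    (hH : Continuous H) (h0 : ∀ t, H (0, t) = f t) (h1 : ∀ t, H (1, t) = g t)
    (hb : ∀ s, ∀ t ∈ Cube.boundary N, H (s, t) = x) : GenLoop.Homotopic f g :=
  ⟨{ toFun := H
     continuous_toFun := hH
     map_zero_left := h0
     map_one_left := h1
     prop' := fun s t ht => (hb s t ht).trans (f.2 t ht).symm }⟩

theorem GenLoop.Homotopic.exists_map {x : X} {f g : Ω^ N X x} (h : GenLoop.Homotopic f g) :
    ∃ H : I × (N → I) → X, Continuous H ∧ (∀ t, H (0, t) = f t) ∧ (∀ t, H (1, t) = g t) ∧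
      ∀ s, ∀ t ∈ Cube.boundary N, H (s, t) = x := by
  obtain ⟨H⟩ := h
  exact ⟨H, H.continuous, H.apply_zero, H.apply_one,
    fun s t ht => (H.eq_fst s ht).trans (f.2 t ht)⟩

/-- The class of a generalized loop in the homotopy group. -/
def HomotopyGroup.mk {x : X} (f : Ω^ N X x) : HomotopyGroup N X x :=
  Quotient.mk (GenLoop.Homotopic.setoid N x) f

theorem HomotopyGroup.mk_eq_iff {x : X} {f g : Ω^ N X x} :
    HomotopyGroup.mk f = HomotopyGroup.mk g ↔ GenLoop.Homotopic f g := Quotient.eq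

theorem HomotopyGroup.mk_surjective {x : X} :
    Function.Surjective (HomotopyGroup.mk : Ω^ N X x → HomotopyGroup N X x) :=
  Quotient.mk_surjective

/-- The generalized loop with a given underlying function. -/
def GenLoop.of {x : X} (f : (N → I) → X) (hf : Continuous f)
    (h : ∀ t ∈ Cube.boundary N, f t = x) : Ω^ N X x :=
  ⟨⟨f, hf⟩, h⟩

@[simp] theorem GenLoop.of_apply {x : X} (f : (N → I) → X) (hf h t) :
    GenLoop.of (x := x) f hf h t = f t := rfl

theorem GenLoop.cont {x : X} (f : Ω^ N X x) : Continuous f := f.1.continuous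

theorem GenLoop.bdry {x : X} (f : Ω^ N X x) {t : N → I} (ht : t ∈ Cube.boundary N) : f t = x :=
  f.2 t ht

/-- Postcomposition of a generalized loop with a continuous map. -/
def GenLoop.map (φ : X → Y) (hφ : Continuous φ) {x : X} {y : Y} (h : φ x = y) (f : Ω^ N X x) :
    Ω^ N Y y :=
  GenLoop.of (fun t => φ (f t)) (hφ.comp (GenLoop.cont f))
    (fun t ht => by rw [GenLoop.bdry f ht, h])

@[simp] theorem GenLoop.map_apply (φ : X → Y) (hφ : Continuous φ) {x : X} {y : Y} (h : φ x = y)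
    (f : Ω^ N X x) (t) : GenLoop.map φ hφ h f t = φ (f t) := rfl

theorem GenLoop.Homotopic.map {φ : X → Y} (hφ : Continuous φ) {x : X} {y : Y} (h : φ x = y)
    {f g : Ω^ N X x} (H : GenLoop.Homotopic f g) :
    GenLoop.Homotopic (GenLoop.map φ hφ h f) (GenLoop.map φ hφ h g) := by
  obtain ⟨K, hK, h0, h1, hb⟩ := H.exists_map
  exact GenLoop.homotopic_of_map (fun p => φ (K p)) (hφ.comp hK) (fun t => by simp [h0])
    (fun t => by simp [h1]) (fun s t ht => by rw [hb s t ht, h])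

variable [DecidableEq N]

theorem GenLoop.transAt_apply {x : X} (i : N) (f g : Ω^ N X x) (t : N → I) :
    GenLoop.transAt i f g t = if (t i : ℝ) ≤ 1 / 2
      then f (Function.update t i <| Set.projIcc 0 1 zero_le_one (2 * t i))
      else g (Function.update t i <| Set.projIcc 0 1 zero_le_one (2 * t i - 1)) := rfl

variable [Nonempty N]

theorem HomotopyGroup.mk_mul_mk {x : X} (i : N) (f g : Ω^ N X x) :
    HomotopyGroup.mk f * HomotopyGroup.mk g = HomotopyGroup.mk (GenLoop.transAt i g f) :=
  HomotopyGroup.mul_spec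

/-- The homomorphism of homotopy groups induced by a continuous map. -/
def HomotopyGroup.map (φ : X → Y) (hφ : Continuous φ) {x : X} {y : Y} (h : φ x = y) :
    HomotopyGroup N X x →* HomotopyGroup N Y y :=
  MonoidHom.mk'
    (Quotient.lift (fun f => HomotopyGroup.mk (GenLoop.map φ hφ h f))
      (fun _ _ H => HomotopyGroup.mk_eq_iff.2 (GenLoop.Homotopic.map hφ h H))) (by
    intro a b
    obtain ⟨f, rfl⟩ := HomotopyGroup.mk_surjective a
    obtain ⟨g, rfl⟩ := HomotopyGroup.mk_surjective b
    let i : N := Classical.arbitrary N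
    rw [HomotopyGroup.mk_mul_mk i]
    change HomotopyGroup.mk _ = HomotopyGroup.mk _ * HomotopyGroup.mk _
    rw [HomotopyGroup.mk_mul_mk i]
    congr 1
    ext t
    simp only [GenLoop.map_apply, GenLoop.transAt_apply]
    split_ifs <;> rfl)

@[simp] theorem HomotopyGroup.map_mk (φ : X → Y) (hφ : Continuous φ) {x : X} {y : Y}
    (h : φ x = y) (f : Ω^ N X x) :
    HomotopyGroup.map φ hφ h (HomotopyGroup.mk f) = HomotopyGroup.mk (GenLoop.map φ hφ h f) := rfl

/-- The pointwise product of generalized loops in a topological group. -/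
def GenLoop.pmul {G : Type} [Group G] [TopologicalSpace G] [ContinuousMul G]
    (f g : Ω^ N G 1) : Ω^ N G 1 :=
  GenLoop.of (fun t => f t * g t) ((GenLoop.cont f).mul (GenLoop.cont g))
    (fun t ht => by rw [GenLoop.bdry f ht, GenLoop.bdry g ht, mul_one])

theorem HomotopyGroup.mk_mul_mk_eq_pmul {G : Type} [Group G] [TopologicalSpace G]
    [ContinuousMul G] (f g : Ω^ N G 1) :
    HomotopyGroup.mk f * HomotopyGroup.mk g = HomotopyGroup.mk (GenLoop.pmul f g) := by
  let i : N := Classical.arbitrary N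
  rw [HomotopyGroup.mk_mul_mk i, HomotopyGroup.mk_eq_iff]
  refine GenLoop.homotopic_of_map (fun p =>
      f (Function.update p.2 i (Set.projIcc 0 1 zero_le_one
        ((1 - (p.1 : ℝ)) * (2 * p.2 i - 1) + p.1 * p.2 i))) *
      g (Function.update p.2 i (Set.projIcc 0 1 zero_le_one
        ((1 - (p.1 : ℝ)) * (2 * p.2 i) + p.1 * p.2 i)))) ?_ ?_ ?_ ?_
  · refine Continuous.mul ((GenLoop.cont f).comp ?_) ((GenLoop.cont g).comp ?_)
    all_goals
      refine continuous_snd.update i (continuous_projIcc.comp ?_)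
      fun_prop
  · intro t
    rw [GenLoop.transAt_apply]
    split_ifs with h
    · simp only [Set.Icc.coe_zero, sub_zero, one_mul, zero_mul, add_zero]
      rw [GenLoop.bdry f ⟨i, Or.inl ?_⟩]
      · simp
      · simp only [Function.update_self]
        exact Set.projIcc_of_le_left _ (by simp; linarith)
    · simp only [Set.Icc.coe_zero, sub_zero, one_mul, zero_mul, add_zero]
      rw [GenLoop.bdry g ⟨i, Or.inr ?_⟩]
      · simp
      · simp only [Function.update_self]
        exact Set.projIcc_of_right_le _ (by linarith)
  · intro t
    simp [GenLoop.pmul]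
  · rintro s t ⟨j, hj⟩
    have hs0 := s.2.1
    have hs1 := s.2.2
    have key : ∀ (k : Ω^ N G 1) (u : ℝ), (t i = 0 → u ≤ 0) → (t i = 1 → 1 ≤ u) →
        k (Function.update t i (Set.projIcc 0 1 zero_le_one u)) = 1 := by
      intro k u h0 h1
      apply GenLoop.bdry k
      refine ⟨j, ?_⟩
      by_cases hji : j = i
      · subst hji
        simp only [Function.update_self]
        rcases hj with hj | hj
        · exact Or.inl (Set.projIcc_of_le_left _ (h0 hj))
        · exact Or.inr (Set.projIcc_of_right_le _ (h1 hj))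
      · rwa [Function.update_of_ne hji]
    simp only
    rw [key f, key g, mul_one]
    all_goals
      intro h
      simp only [h, Set.Icc.coe_zero, Set.Icc.coe_one]
      linarith

theorem HomotopyGroup.map_surjective_of {φ : X → Y} (hφ : Continuous φ) {x : X} {y : Y}
    (h : φ x = y)
    (H : ∀ f : Ω^ N Y y, ∃ g : Ω^ N X x, GenLoop.Homotopic (GenLoop.map φ hφ h g) f) :
    Function.Surjective (HomotopyGroup.map (N := N) φ hφ h) := by
  intro b
  obtain ⟨f, rfl⟩ := HomotopyGroup.mk_surjective b
  obtain ⟨g, hg⟩ := H f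
  exact ⟨HomotopyGroup.mk g, by rwa [HomotopyGroup.map_mk, HomotopyGroup.mk_eq_iff]⟩

end HomotopyToolkit

section Approximation

open scoped unitInterval ContDiff

variable {ι : Type} [Fintype ι]

/-- Restriction of a function on `ℝ^ι` to the unit cube. -/
abbrev cubeCoe (t : ι → I) : ι → ℝ := fun i => (t i : ℝ)

/-- The algebra of restrictions of smooth functions to the unit cube. -/
def smoothOnCube (ι : Type) [Fintype ι] : Subalgebra ℝ C(ι → I, ℝ) where
  carrier := {g | ∃ P : (ι → ℝ) → ℝ, ContDiff ℝ ∞ P ∧ ∀ t, g t = P (cubeCoe t)}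
  mul_mem' := by
    rintro a b ⟨P, hP, hP'⟩ ⟨Q, hQ, hQ'⟩
    exact ⟨_, hP.mul hQ, fun t => by simp [hP', hQ']⟩
  add_mem' := by
    rintro a b ⟨P, hP, hP'⟩ ⟨Q, hQ, hQ'⟩
    exact ⟨_, hP.add hQ, fun t => by simp [hP', hQ']⟩
  algebraMap_mem' := fun r => ⟨fun _ => r, contDiff_const, fun t => by simp⟩

theorem smoothOnCube_dense (f : C(ι → I, ℝ)) {ε : ℝ} (hε : 0 < ε) :
    ∃ P : (ι → ℝ) → ℝ, ContDiff ℝ ∞ P ∧ ∀ t, |P (cubeCoe t) - f t| < ε := by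
  have h := ContinuousMap.subalgebra_topologicalClosure_eq_top_of_separatesPoints
    (smoothOnCube ι) (by
      intro x y hxy
      obtain ⟨i, hi⟩ := Function.ne_iff.1 hxy
      refine ⟨fun t => (t i : ℝ), ⟨⟨fun t => (t i : ℝ), by fun_prop⟩,
        ⟨fun t => t i, contDiff_apply ℝ ℝ i, fun t => rfl⟩, rfl⟩, ?_⟩
      simpa [Subtype.ext_iff] using hi)
  have hf : f ∈ (smoothOnCube ι).topologicalClosure := by rw [h]; trivial
  obtain ⟨g, ⟨P, hP, hP'⟩, hg⟩ := Metric.mem_closure_iff.1 hf ε hε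
  refine ⟨P, hP, fun t => ?_⟩
  rw [← hP', abs_sub_comm, ← Real.dist_eq]
  exact (ContinuousMap.dist_apply_le_dist t).trans_lt hg

theorem exists_contDiff_real_approx (S : Finset ι) (f : C(ι → I, ℝ))
    (hb : ∀ t, ∀ i ∈ S, (t i = 0 ∨ t i = 1) → f t = 0) {ε : ℝ} (hε : 0 < ε) :
    ∃ P : (ι → ℝ) → ℝ, ContDiff ℝ ∞ P ∧ (∀ t, ∀ i ∈ S, (t i = 0 ∨ t i = 1) → P t = 0) ∧
      ∀ t, |P (cubeCoe t) - f t| < ε := by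
  let W : (ι → ℝ) → ℝ := fun t => ∏ i ∈ S, t i * (1 - t i)
  have hW : ContDiff ℝ ∞ W := by
    refine contDiff_prod fun i _ => ?_
    exact (contDiff_apply ℝ ℝ i).mul (contDiff_const.sub (contDiff_apply ℝ ℝ i))
  have hW1 : ∀ t : ι → I, |W (cubeCoe t)| ≤ 1 := by
    intro t
    simp only [W, Finset.abs_prod]
    refine Finset.prod_le_one (fun i _ => abs_nonneg _) fun i _ => ?_
    have h0 := (t i).2.1
    have h1 := (t i).2.2
    rw [abs_of_nonneg (mul_nonneg h0 (by linarith))]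
    nlinarith
  let w : C(ι → I, ℝ) := ⟨fun t => W (cubeCoe t), hW.continuous.comp (by fun_prop)⟩
  have hf : f ∈ (Ideal.span {w}).closure := by
    rw [← ContinuousMap.idealOfSet_ofIdeal_eq_closure, ContinuousMap.mem_idealOfSet]
    intro t ht
    have hwt : w t = 0 := by
      by_contra hne
      exact ht (ContinuousMap.mem_setOfIdeal.2 ⟨w, Ideal.mem_span_singleton_self w, hne⟩)
    obtain ⟨i, hi, h⟩ := Finset.prod_eq_zero_iff.1 (show W (cubeCoe t) = 0 from hwt)
    refine hb t i hi ?_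
    rcases mul_eq_zero.1 h with h | h
    · exact Or.inl (Subtype.ext h)
    · exact Or.inr (Subtype.ext (by simp only [Set.Icc.coe_one]; linarith))
  obtain ⟨g, hg, hfg⟩ := Metric.mem_closure_iff.1
    (show f ∈ closure (Ideal.span {w} : Set C(ι → I, ℝ)) from hf) (ε / 2) (half_pos hε)
  obtain ⟨k, rfl⟩ := Ideal.mem_span_singleton'.1 hg
  obtain ⟨P, hP, hPk⟩ := smoothOnCube_dense k (half_pos hε)
  refine ⟨fun t => P t * W t, hP.mul hW, ?_, fun t => ?_⟩
  · intro t i hi h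
    have : W t = 0 := Finset.prod_eq_zero hi (by rcases h with h | h <;> simp [h])
    simp [this]
  · have h1 : |(k * w) t - f t| < ε / 2 := by
      rw [← Real.dist_eq, dist_comm]
      exact (ContinuousMap.dist_apply_le_dist t).trans_lt hfg
    have h2 : |P (cubeCoe t) * W (cubeCoe t) - (k * w) t| < ε / 2 := by
      have : P (cubeCoe t) * W (cubeCoe t) - (k * w) t
          = (P (cubeCoe t) - k t) * W (cubeCoe t) := by
        simp [w]; ring
      rw [this, abs_mul]
      exact (mul_le_of_le_one_right (abs_nonneg _) (hW1 t)).trans_lt (hPk t)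
    calc _ = |(P (cubeCoe t) * W (cubeCoe t) - (k * w) t) + ((k * w) t - f t)| := by ring_nf
      _ ≤ _ := abs_add_le _ _
      _ < ε := by linarith

theorem exists_contDiff_approx {E : Type} [NormedAddCommGroup E] [NormedSpace ℝ E]
    [FiniteDimensional ℝ E] (S : Finset ι) (f : (ι → I) → E) (hf : Continuous f) (x₀ : E)
    (hb : ∀ t, ∀ i ∈ S, (t i = 0 ∨ t i = 1) → f t = x₀) {ε : ℝ} (hε : 0 < ε) :
    ∃ P : (ι → ℝ) → E, ContDiff ℝ ∞ P ∧ (∀ t, ∀ i ∈ S, (t i = 0 ∨ t i = 1) → P t = x₀) ∧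
      ∀ t, ‖P (cubeCoe t) - f t‖ < ε := by
  let b := Module.finBasis ℝ E
  have hC : 0 < 1 + ∑ j, ‖b j‖ := by positivity
  have hcoord : ∀ j, Continuous fun t => b.repr (f t - x₀) j := fun j =>
    (LinearMap.continuous_of_finiteDimensional (b.coord j)).comp (hf.sub continuous_const)
  have := fun j => exists_contDiff_real_approx S ⟨fun t => b.repr (f t - x₀) j, hcoord j⟩
    (fun t i hi h => by simp [hb t i hi h]) (div_pos hε hC)
  choose P hP hPb hPf using this
  refine ⟨fun t => x₀ + ∑ j, P j t • b j, ?_, ?_, ?_⟩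
  · exact contDiff_const.add (ContDiff.sum fun j _ => (hP j).smul contDiff_const)
  · intro t i hi h
    simp [hPb _ t i hi h]
  · intro t
    have h1 : x₀ + ∑ j, P j (cubeCoe t) • b j - f t
        = ∑ j, (P j (cubeCoe t) - b.repr (f t - x₀) j) • b j := by
      simp only [sub_smul, Finset.sum_sub_distrib]
      rw [b.sum_repr]
      abel
    rw [h1]
    calc _ ≤ ∑ j, ‖(P j (cubeCoe t) - b.repr (f t - x₀) j) • b j‖ := norm_sum_le _ _
      _ ≤ ∑ j, ε / (1 + ∑ j, ‖b j‖) * ‖b j‖ := by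
        refine Finset.sum_le_sum fun j _ => ?_
        rw [norm_smul]
        exact mul_le_mul_of_nonneg_right (hPf j t).le (norm_nonneg _)
      _ = ε * ((∑ j, ‖b j‖) / (1 + ∑ j, ‖b j‖)) := by rw [← Finset.mul_sum]; ring
      _ < ε := by
        refine mul_lt_of_lt_one_right hε ?_
        rw [div_lt_one hC]
        linarith

end Approximation

section HomotopyLifting

open scoped unitInterval Topology.Homotopy

/-- A local section around `x₀` of the orbit map `g ↦ g • x₀`, defined on a ball for an invariant
continuous function `d`. -/
structure LocalSection (G X : Type) [Group G] [TopologicalSpace G] [TopologicalSpace X]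
    [MulAction G X] (x₀ : X) where
  /-- the invariant distance function -/
  d : X → X → ℝ
  continuous_d : Continuous fun p : X × X => d p.1 p.2
  d_self : ∀ x, d x x = 0
  d_smul : ∀ (g : G) (x y : X), d (g • x) (g • y) = d x y
  /-- the radius of the ball -/
  ε : ℝ
  ε_pos : 0 < ε
  /-- the section -/
  sec : X → G
  continuousOn_sec : ContinuousOn sec {x | d x₀ x < ε}
  sec_smul : ∀ x, d x₀ x < ε → sec x • x₀ = x
  sec_base : sec x₀ = 1

variable {G X : Type} [Group G] [TopologicalSpace G] [IsTopologicalGroup G]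
  [TopologicalSpace X] [MulAction G X] [ContinuousSMul G X] {x₀ : X}

theorem LocalSection.exists_lift (L : LocalSection G X x₀) {Y : Type} [TopologicalSpace Y]
    [CompactSpace Y] (f : Y × I → X) (hf : Continuous f) (g₀ : Y → G) (hg₀ : Continuous g₀)
    (h₀ : ∀ y, g₀ y • x₀ = f (y, 0)) :
    ∃ F : Y × I → G, Continuous F ∧ (∀ y, F (y, 0) = g₀ y) ∧ (∀ p, F p • x₀ = f p) ∧
      ∀ y, (∀ t, f (y, t) = f (y, 0)) → ∀ t, F (y, t) = g₀ y := by
  obtain ⟨δ, hδ, hδf⟩ : ∃ δ > 0, ∀ y, ∀ s t : I, |(s : ℝ) - t| < δ →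
      L.d (f (y, s)) (f (y, t)) < L.ε := by
    let e : Y × I × I → ℝ := fun p => L.d (f (p.1, p.2.1)) (f (p.1, p.2.2))
    have he : Continuous e := L.continuous_d.comp
      ((hf.comp (by fun_prop)).prodMk (hf.comp (by fun_prop)))
    have hK : IsCompact {p | L.ε ≤ e p} := (isClosed_le continuous_const he).isCompact
    have hm : Continuous fun p : Y × I × I => |(p.2.1 : ℝ) - p.2.2| := by fun_prop
    by_cases hne : {p | L.ε ≤ e p}.Nonempty
    · obtain ⟨p, hp, hmin⟩ := hK.exists_isMinOn hne hm.continuousOn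
      refine ⟨|(p.2.1 : ℝ) - p.2.2|, ?_, fun y s t hst => ?_⟩
      · rw [gt_iff_lt, abs_pos, sub_ne_zero]
        intro h
        have h' : p.2.1 = p.2.2 := Subtype.ext h
        have h2 : L.ε ≤ e p := hp
        simp only [e, h', L.d_self] at h2
        exact absurd L.ε_pos (not_lt.2 h2)
      · by_contra hcon
        exact absurd hst (not_lt.2 (hmin (show (y, s, t) ∈ {p | L.ε ≤ e p} from not_lt.1 hcon)))
    · refine ⟨1, one_pos, fun y s t _ => ?_⟩
      by_contra hcon
      exact hne ⟨(y, s, t), not_lt.1 hcon⟩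
  let c : ℕ → I := fun k => Set.projIcc 0 1 zero_le_one (k * (δ / 2))
  have hc0 : c 0 = 0 := by simp [c]
  have hcs : ∀ k, |(c k : ℝ) - c (k + 1)| < δ := by
    intro k
    simp only [c, Set.coe_projIcc]
    have h1 := abs_max_sub_max_le_max (0 : ℝ) (min 1 (k * (δ / 2))) 0
      (min 1 ((k + 1 : ℕ) * (δ / 2)))
    have h2 := abs_min_sub_min_le_max (1 : ℝ) (k * (δ / 2)) 1 ((k + 1 : ℕ) * (δ / 2))
    have h3 : |(k * (δ / 2) : ℝ) - (k + 1 : ℕ) * (δ / 2)| = δ / 2 := by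
      rw [show (k * (δ / 2) : ℝ) - (k + 1 : ℕ) * (δ / 2) = -(δ / 2) by push_cast; ring, abs_neg,
        abs_of_pos (half_pos hδ)]
    have h4 : (0 : ℝ) ≤ δ / 2 := (half_pos hδ).le
    simp only [sub_self, abs_zero, h3, max_eq_right h4] at h1 h2
    have h5 := h1.trans (max_le h4 h2)
    linarith
  have key : ∀ k : ℕ, ∃ F : Y × I → G, Continuous F ∧ (∀ y, F (y, 0) = g₀ y) ∧
      (∀ p : Y × I, F p • x₀ = f (p.1, min p.2 (c k))) ∧
      ∀ y, (∀ t, f (y, t) = f (y, 0)) → ∀ t, F (y, t) = g₀ y := by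
    intro k
    induction k with
    | zero =>
      refine ⟨fun p => g₀ p.1, hg₀.comp continuous_fst, fun _ => rfl, fun p => ?_, fun _ _ _ => rfl⟩
      rw [hc0, h₀, min_eq_right unitInterval.nonneg']
    | succ k ih =>
      obtain ⟨F, hF, hF0, hFx, hFc⟩ := ih
      have hd : ∀ p : Y × I, L.d x₀ ((F p)⁻¹ • f (p.1, min p.2 (c (k + 1)))) < L.ε := by
        intro p
        rw [← L.d_smul (F p), smul_inv_smul, hFx]
        apply hδf
        have := abs_min_sub_min_le_max (p.2 : ℝ) (c k) p.2 (c (k + 1))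
        simp only [sub_self, abs_zero] at this
        have h2 := this.trans_lt (max_lt hδ (hcs k))
        have hmono : ∀ a b : I, ((min a b : I) : ℝ) = min (a : ℝ) b := fun a b =>
          (Subtype.mono_coe _).map_min
        rwa [hmono, hmono]
      refine ⟨fun p => F p * L.sec ((F p)⁻¹ • f (p.1, min p.2 (c (k + 1)))), ?_, ?_, ?_, ?_⟩
      · refine hF.mul (L.continuousOn_sec.comp_continuous ?_ hd)
        exact hF.inv.smul (hf.comp (by fun_prop))
      · intro y
        have : (F (y, 0))⁻¹ • f (y, min (0 : I) (c (k + 1))) = x₀ := by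
          rw [inv_smul_eq_iff, hFx, min_eq_left unitInterval.nonneg',
            min_eq_left unitInterval.nonneg']
        simp only
        rw [this, L.sec_base, mul_one, hF0]
      · intro p
        rw [mul_smul, L.sec_smul _ (hd p), smul_inv_smul]
      · intro y hy t
        have : (F (y, t))⁻¹ • f (y, min t (c (k + 1))) = x₀ := by
          rw [inv_smul_eq_iff, hFx, hy (min t (c (k + 1))), hy (min t (c k))]
        simp only
        rw [this, L.sec_base, mul_one, hFc y hy t]
  obtain ⟨n, hn⟩ := exists_nat_ge (1 / (δ / 2))
  obtain ⟨F, hF, hF0, hFx, hFc⟩ := key n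
  refine ⟨F, hF, hF0, fun p => ?_, hFc⟩
  have hcn : c n = 1 := by
    apply Set.projIcc_of_right_le
    rwa [div_le_iff₀ (half_pos hδ)] at hn
  rw [hFx, hcn, min_eq_left unitInterval.le_one']

theorem continuous_orbitMap (x₀ : X) : Continuous fun g : G => g • x₀ :=
  continuous_id.smul continuous_const

/-- If loops in the stabilizer contract, then loops in the orbit space lift, one dimension up. -/
theorem LocalSection.map_orbit_surjective (L : LocalSection G X x₀) {n : ℕ}
    (hn : ∀ h : Ω^ (Fin n) (MulAction.stabilizer G x₀) 1, GenLoop.Homotopic h GenLoop.const) :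
    Function.Surjective (HomotopyGroup.map (N := Fin (n + 1)) (fun g : G => g • x₀)
      (continuous_orbitMap x₀) (one_smul G x₀)) := by
  refine HomotopyGroup.map_surjective_of _ _ fun f => ?_
  have hcons : Continuous fun p : (Fin n → I) × I => (Fin.cons p.2 p.1 : Fin (n + 1) → I) := by
    refine continuous_pi fun i => ?_
    induction i using Fin.cases with
    | zero => simpa using continuous_snd
    | succ j => simp only [Fin.cons_succ]; fun_prop
  have hb0 : ∀ y : Fin n → I, f (Fin.cons 0 y) = x₀ := fun y =>
    GenLoop.bdry f ⟨0, Or.inl (Fin.cons_zero _ _)⟩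
  have hb1 : ∀ y : Fin n → I, f (Fin.cons 1 y) = x₀ := fun y =>
    GenLoop.bdry f ⟨0, Or.inr (Fin.cons_zero _ _)⟩
  have hby : ∀ y ∈ Cube.boundary (Fin n), ∀ t : I, f (Fin.cons t y) = x₀ := fun y ⟨i, hi⟩ t =>
    GenLoop.bdry f ⟨i.succ, by simpa using hi⟩
  obtain ⟨F, hF, hF0, hFx, hFc⟩ := L.exists_lift (fun p => f (Fin.cons p.2 p.1))
    ((GenLoop.cont f).comp hcons) (fun _ => 1) continuous_const
    (fun y => by simp only [one_smul, hb0])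
  have hFb : ∀ y ∈ Cube.boundary (Fin n), ∀ t, F (y, t) = 1 := fun y hy =>
    hFc y fun t => (hby y hy t).trans (hby y hy 0).symm
  obtain ⟨K, hK, hK0, hK1, hKb⟩ := (hn (GenLoop.of
    (fun y => ⟨F (y, 1), MulAction.mem_stabilizer_iff.2 ((hFx _).trans (hb1 y))⟩)
    ((hF.comp (by fun_prop)).subtype_mk _)
    (fun y hy => Subtype.ext (hFb y hy 1)))).exists_map
  refine ⟨GenLoop.of (fun t => F (Fin.tail t, t 0) * ((K (unitInterval.symm (t 0), Fin.tail t) :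
    MulAction.stabilizer G x₀) : G)⁻¹) ?_ ?_, ?_⟩
  · have ht : Continuous fun t : Fin (n + 1) → I => Fin.tail t :=
      continuous_pi fun i => continuous_apply i.succ
    exact (hF.comp (ht.prodMk (continuous_apply 0))).mul (continuous_subtype_val.comp (hK.comp
      ((unitInterval.continuous_symm.comp (continuous_apply 0)).prodMk ht))).inv
  · rintro t ⟨i, hi⟩
    induction i using Fin.cases with
    | zero =>
      rcases hi with hi | hi
      · rw [hi, unitInterval.symm_zero, hK1, hF0]
        simp
      · rw [hi, unitInterval.symm_one, hK0]
        simp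
    | succ j =>
      have hj : Fin.tail t ∈ Cube.boundary (Fin n) := ⟨j, hi⟩
      rw [hFb _ hj, hKb _ _ hj]
      simp
  · rw [show GenLoop.map _ _ _ _ = f from ?_]
    ext t
    have h1 : ((K (unitInterval.symm (t 0), Fin.tail t) : MulAction.stabilizer G x₀) : G)⁻¹ • x₀
        = x₀ := by
      rw [inv_smul_eq_iff]
      exact (MulAction.mem_stabilizer_iff.1 (K _).2).symm
    simp only [GenLoop.map_apply, GenLoop.of_apply, mul_smul, h1, hFx, Fin.cons_self_tail]

/-- Exactness at the homotopy group of the total space. -/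
theorem LocalSection.exists_stabilizer_loop (L : LocalSection G X x₀) {N : Type}
    (f : Ω^ N G 1)
    (hf : GenLoop.Homotopic (GenLoop.map (fun g : G => g • x₀) (continuous_orbitMap x₀)
      (one_smul G x₀) f) GenLoop.const) :
    ∃ h : Ω^ N (MulAction.stabilizer G x₀) 1, GenLoop.Homotopic
      (GenLoop.map (Subtype.val : MulAction.stabilizer G x₀ → G) continuous_subtype_val rfl h)
      f := by
  obtain ⟨K, hK, hK0, hK1, hKb⟩ := hf.exists_map
  obtain ⟨F, hF, hF0, hFx, hFc⟩ := L.exists_lift (fun p : (N → I) × I => K (p.2, p.1))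
    (hK.comp (by fun_prop)) f (GenLoop.cont f) (fun y => by simp only [hK0]; rfl)
  have hFb : ∀ y ∈ Cube.boundary N, ∀ t, F (y, t) = 1 := fun y hy t =>
    (hFc y (fun t => (hKb t y hy).trans (hKb 0 y hy).symm) t).trans (GenLoop.bdry f hy)
  refine ⟨GenLoop.of (fun y => ⟨F (y, 1), MulAction.mem_stabilizer_iff.2
    ((hFx _).trans (hK1 y))⟩) ((hF.comp (by fun_prop)).subtype_mk _)
    (fun y hy => Subtype.ext (hFb y hy 1)), ?_⟩
  refine GenLoop.Homotopic.symm (GenLoop.homotopic_of_map (fun p => F (p.2, p.1))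
    (hF.comp (by fun_prop)) hF0 (fun t => rfl) (fun s t ht => hFb t ht s))

end HomotopyLifting

section SphereLoops

open scoped unitInterval Topology.Homotopy ContDiff
open Module

/-- Loops lying in the source of a chart onto a vector space are homotopic. -/
theorem GenLoop.homotopic_of_chart {N X V : Type} [TopologicalSpace X] [NormedAddCommGroup V]
    [NormedSpace ℝ V] (φ : OpenPartialHomeomorph X V) (hφ : φ.target = Set.univ) {x₀ : X}
    (f g : Ω^ N X x₀) (hf : ∀ t, f t ∈ φ.source) (hg : ∀ t, g t ∈ φ.source) :
    GenLoop.Homotopic f g := by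
  have hs : Continuous φ.symm := by
    rw [← continuousOn_univ, ← hφ]
    exact φ.continuousOn_symm
  have hφf := φ.continuousOn.comp_continuous (GenLoop.cont f) hf
  have hφg := φ.continuousOn.comp_continuous (GenLoop.cont g) hg
  refine GenLoop.homotopic_of_map (fun p => φ.symm ((1 - (p.1 : ℝ)) • φ (f p.2) +
    (p.1 : ℝ) • φ (g p.2))) (hs.comp ?_) (fun t => ?_) (fun t => ?_) (fun s t ht => ?_)
  · exact Continuous.add (Continuous.smul (by fun_prop) (hφf.comp continuous_snd))
      (Continuous.smul (by fun_prop) (hφg.comp continuous_snd))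
  · simp [φ.left_inv (hf t)]
  · simp [φ.left_inv (hg t)]
  · have h1 := hf t
    simp only [GenLoop.bdry f ht] at h1
    simp only [GenLoop.bdry f ht, GenLoop.bdry g ht, ← add_smul, sub_add_cancel, one_smul,
      φ.left_inv h1]

variable {N E : Type} [NormedAddCommGroup E] [InnerProductSpace ℝ E]

/-- Radial projection of a nonzero vector to the unit sphere. -/
def unitVector (v : E) (hv : v ≠ 0) : Metric.sphere (0 : E) 1 :=
  ⟨‖v‖⁻¹ • v, by simp [norm_smul, hv]⟩

theorem continuous_unitVector {Y : Type} [TopologicalSpace Y] {P : Y → E} (hP : Continuous P)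
    (h : ∀ y, P y ≠ 0) : Continuous fun y => unitVector (P y) (h y) :=
  (Continuous.smul (hP.norm.inv₀ fun y => norm_ne_zero_iff.2 (h y)) hP).subtype_mk _

theorem unitVector_coe (x : Metric.sphere (0 : E) 1) (h : (x : E) ≠ 0) :
    unitVector (x : E) h = x := by
  ext
  simp [unitVector]

theorem sphere_coe_ne_zero (x : Metric.sphere (0 : E) 1) : (x : E) ≠ 0 := by
  rw [← norm_ne_zero_iff, norm_eq_of_mem_sphere]
  exact one_ne_zero

variable {x₀ : Metric.sphere (0 : E) 1}

/-- The loop in the sphere obtained by radial projection. -/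
def GenLoop.normalize (P : (N → I) → E) (hP : Continuous P) (hne : ∀ t, P t ≠ 0)
    (hb : ∀ t ∈ Cube.boundary N, P t = x₀) : Ω^ N (Metric.sphere (0 : E) 1) x₀ :=
  GenLoop.of (fun t => unitVector (P t) (hne t)) (continuous_unitVector hP hne)
    (fun t ht => by
      simp only [hb t ht]
      exact unitVector_coe _ _)

theorem GenLoop.normalize_homotopic {P Q : (N → I) → E} (hP : Continuous P)
    (hPne : ∀ t, P t ≠ 0) (hPb : ∀ t ∈ Cube.boundary N, P t = x₀) (hQ : Continuous Q)
    (hQne : ∀ t, Q t ≠ 0) (hQb : ∀ t ∈ Cube.boundary N, Q t = x₀)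
    (H : ∀ t, ∀ s : I, (1 - (s : ℝ)) • P t + (s : ℝ) • Q t ≠ 0) :
    GenLoop.Homotopic (GenLoop.normalize P hP hPne hPb) (GenLoop.normalize Q hQ hQne hQb) := by
  refine GenLoop.homotopic_of_map (fun p => unitVector _ (H p.2 p.1))
    (continuous_unitVector (by fun_prop) _) (fun t => ?_) (fun t => ?_) (fun s t ht => ?_)
  · simp [GenLoop.normalize]
  · simp [GenLoop.normalize]
  · simp only [hPb t ht, hQb t ht, ← add_smul, sub_add_cancel, one_smul]
    exact unitVector_coe _ _

theorem GenLoop.normalize_coe (f : Ω^ N (Metric.sphere (0 : E) 1) x₀) :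
    GenLoop.normalize (fun t => (f t : E)) (continuous_subtype_val.comp (GenLoop.cont f))
      (fun t => sphere_coe_ne_zero _) (fun t ht => by rw [GenLoop.bdry f ht]) = f := by
  ext t
  exact congrArg Subtype.val (unitVector_coe (f t) (sphere_coe_ne_zero _))

variable [FiniteDimensional ℝ E]

/-- Every loop in a sphere is homotopic to the radial projection of a smooth map. -/
theorem GenLoop.exists_smooth [Fintype N] (f : Ω^ N (Metric.sphere (0 : E) 1) x₀) :
    ∃ (P : (N → ℝ) → E) (hP : ContDiff ℝ ∞ P) (hne : ∀ t, P (cubeCoe t) ≠ 0)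
      (hb : ∀ t ∈ Cube.boundary N, P (cubeCoe t) = x₀),
      GenLoop.Homotopic f (GenLoop.normalize (fun t => P (cubeCoe t))
        (hP.continuous.comp (by fun_prop)) hne hb) := by
  obtain ⟨P, hP, hPb, hPε⟩ := exists_contDiff_approx Finset.univ (fun t => (f t : E))
    (continuous_subtype_val.comp (GenLoop.cont f)) (x₀ : E)
    (fun t i _ hi => by rw [GenLoop.bdry f ⟨i, hi⟩]) one_pos
  have key : ∀ t, ∀ s : I, (1 - (s : ℝ)) • (f t : E) + (s : ℝ) • P (cubeCoe t) ≠ 0 := by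
    intro t s h
    have h1 : (f t : E) = -((s : ℝ) • (P (cubeCoe t) - f t)) := by
      rw [eq_neg_iff_add_eq_zero]
      refine Eq.trans ?_ h
      rw [smul_sub, sub_smul, one_smul]
      abel
    have h2 := norm_eq_of_mem_sphere (f t)
    rw [h1, norm_neg, norm_smul, Real.norm_of_nonneg s.2.1] at h2
    have := mul_le_of_le_one_left (norm_nonneg (P (cubeCoe t) - (f t : E))) s.2.2
    linarith [hPε t]
  have hne : ∀ t, P (cubeCoe t) ≠ 0 := fun t => by simpa using key t 1
  have hb : ∀ t ∈ Cube.boundary N, P (cubeCoe t) = x₀ := fun t ⟨i, hi⟩ =>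
    hPb _ i (Finset.mem_univ i) (hi.imp (by simp +contextual) (by simp +contextual))
  refine ⟨P, hP, hne, hb, ?_⟩
  conv_lhs => rw [← GenLoop.normalize_coe f]
  exact GenLoop.normalize_homotopic _ _ _ _ _ _ key

/-- Spheres are highly connected. -/
theorem GenLoop.homotopic_const_of_card_lt [Fintype N] [Nonempty N]
    (h : Fintype.card N + 1 < finrank ℝ E)
    (f : Ω^ N (Metric.sphere (0 : E) 1) x₀) : GenLoop.Homotopic f GenLoop.const := by
  obtain ⟨P, hP, hne, hb, hf⟩ := GenLoop.exists_smooth f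
  refine hf.trans ?_
  have hdense := ContDiff.dense_compl_range_of_finrank_lt_finrank
    (f := fun p : (N → ℝ) × ℝ => p.2 • P p.1)
    ((contDiff_snd.smul (hP.comp contDiff_fst)).of_le (by exact_mod_cast le_top))
    (by simpa using h)
  obtain ⟨a, ha⟩ := hdense.nonempty
  have ha' : ∀ t r, r • P t ≠ a := fun t r hr => ha ⟨(t, r), hr⟩
  have ha0 : a ≠ 0 := fun h0 => ha' 0 0 (by simp [h0])
  have hv : ‖‖a‖⁻¹ • a‖ = 1 := by simp [norm_smul, ha0]
  have hmem : ∀ t, GenLoop.normalize (fun t => P (cubeCoe t)) (hP.continuous.comp (by fun_prop))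
      hne hb t ∈ (stereographic hv).source := by
    intro t
    rw [stereographic_source, Set.mem_compl_singleton_iff]
    intro heq
    have h1 : ‖P (cubeCoe t)‖⁻¹ • P (cubeCoe t) = ‖a‖⁻¹ • a := congrArg Subtype.val heq
    apply ha' (cubeCoe t) (‖a‖ * ‖P (cubeCoe t)‖⁻¹)
    rw [mul_smul, h1, smul_inv_smul₀ (norm_ne_zero_iff.2 ha0)]
  refine GenLoop.homotopic_of_chart (stereographic hv) (stereographic_target hv) _ _ hmem ?_
  intro t
  have := hmem 0
  rwa [GenLoop.bdry _ ⟨Classical.arbitrary N, Or.inl rfl⟩] at this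

end SphereLoops

section Suspension

open scoped unitInterval Topology.Homotopy
open Module

variable {X Y V : Type} [TopologicalSpace X] [TopologicalSpace Y] {x₀ : X} {y₀ : Y} {n : ℕ}

/-- The loop obtained by sweeping a loop `h` along a family `e` of closed paths. -/
def GenLoop.sweep (e : I × Y → X) (he : Continuous e) (h0 : ∀ y, e (0, y) = x₀)
    (h1 : ∀ y, e (1, y) = x₀) (hb : ∀ t, e (t, y₀) = x₀) (h : Ω^ (Fin n) Y y₀) :
    Ω^ (Fin (n + 1)) X x₀ :=
  GenLoop.of (fun t => e (t 0, h (Fin.tail t)))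
    (he.comp ((continuous_apply 0).prodMk ((GenLoop.cont h).comp
      (continuous_pi fun i => continuous_apply i.succ)))) (by
    rintro t ⟨i, hi⟩
    induction i using Fin.cases with
    | zero => rcases hi with hi | hi <;> simp only [hi, h0, h1]
    | succ j => rw [GenLoop.bdry h ⟨j, hi⟩, hb])

/-- Sweeping along a family of closed paths, as a homomorphism of homotopy groups. -/
def HomotopyGroup.sweep (e : I × Y → X) (he : Continuous e) (h0 : ∀ y, e (0, y) = x₀)
    (h1 : ∀ y, e (1, y) = x₀) (hb : ∀ t, e (t, y₀) = x₀) :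
    HomotopyGroup (Fin (n + 1)) Y y₀ →* HomotopyGroup (Fin (n + 2)) X x₀ :=
  MonoidHom.mk'
    (Quotient.lift (fun h => HomotopyGroup.mk (GenLoop.sweep e he h0 h1 hb h)) (by
      intro f g H
      obtain ⟨K, hK, hK0, hK1, hKb⟩ := GenLoop.Homotopic.exists_map H
      have ht : Continuous fun t : Fin (n + 2) → I => Fin.tail t :=
        continuous_pi fun i => continuous_apply i.succ
      refine HomotopyGroup.mk_eq_iff.2 (GenLoop.homotopic_of_map
        (fun p => e (p.2 0, K (p.1, Fin.tail p.2))) (he.comp (Continuous.prodMk (by fun_prop)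
          (hK.comp (continuous_fst.prodMk (ht.comp continuous_snd)))))
        (fun t => by rw [hK0]; rfl) (fun t => by rw [hK1]; rfl) ?_)
      rintro s t ⟨i, hi⟩
      induction i using Fin.cases with
      | zero => rcases hi with hi | hi <;> simp only [hi, h0, h1]
      | succ j => rw [hKb _ _ ⟨j, hi⟩, hb])) (by
    intro a b
    obtain ⟨f, rfl⟩ := HomotopyGroup.mk_surjective a
    obtain ⟨g, rfl⟩ := HomotopyGroup.mk_surjective b
    rw [HomotopyGroup.mk_mul_mk 0]
    change HomotopyGroup.mk _ = HomotopyGroup.mk _ * HomotopyGroup.mk _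
    rw [HomotopyGroup.mk_mul_mk (Fin.succ 0)]
    congr 1
    ext t
    simp only [GenLoop.transAt_apply, GenLoop.sweep, GenLoop.of_apply]
    have hu : ∀ c, Fin.tail (Function.update t (Fin.succ 0) c) =
        Function.update (Fin.tail t) 0 c := fun c => Fin.tail_update_succ t 0 c
    have h0 : ∀ c, Function.update t (Fin.succ 0) c 0 = t 0 := fun c =>
      Function.update_of_ne (Fin.succ_ne_zero 0).symm _ _
    simp only [hu, h0]
    change e (t 0, if ((t (Fin.succ 0) : I) : ℝ) ≤ 1 / 2 then _ else _) = _
    split_ifs <;> rfl)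

theorem HomotopyGroup.sweep_mk (e : I × Y → X) (he : Continuous e) (h0 : ∀ y, e (0, y) = x₀)
    (h1 : ∀ y, e (1, y) = x₀) (hb : ∀ t, e (t, y₀) = x₀) (h : Ω^ (Fin (n + 1)) Y y₀) :
    HomotopyGroup.sweep e he h0 h1 hb (HomotopyGroup.mk h) =
      HomotopyGroup.mk (GenLoop.sweep e he h0 h1 hb h) := rfl

end Suspension

section Meridians

open scoped unitInterval Topology.Homotopy
open Module

theorem OpenPartialHomeomorph.continuous_symm_of_target {X V : Type} [TopologicalSpace X]
    [TopologicalSpace V] (φ : OpenPartialHomeomorph X V) (hφ : φ.target = Set.univ) :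
    Continuous φ.symm := by
  rw [← continuousOn_univ, ← hφ]
  exact φ.continuousOn_symm

/-- The first half of the standard traversal of the unit interval. -/
def firstHalf (t : I) : ℝ := min (2 * (t : ℝ)) 1

/-- The second half of the standard traversal of the unit interval. -/
def secondHalf (t : I) : ℝ := max (2 * (t : ℝ) - 1) 0

@[fun_prop] theorem continuous_firstHalf : Continuous firstHalf := by
  unfold firstHalf; fun_prop

@[fun_prop] theorem continuous_secondHalf : Continuous secondHalf := by
  unfold secondHalf; fun_prop

theorem firstHalf_mem (t : I) : 0 ≤ firstHalf t ∧ firstHalf t ≤ 1 :=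
  ⟨le_min (by linarith [t.2.1]) zero_le_one, min_le_right _ _⟩

theorem secondHalf_mem (t : I) : 0 ≤ secondHalf t ∧ secondHalf t ≤ 1 :=
  ⟨le_max_right _ _, max_le (by linarith [t.2.2]) zero_le_one⟩

theorem firstHalf_of_ge {t : I} (h : 1 / 2 ≤ (t : ℝ)) : firstHalf t = 1 :=
  min_eq_right (by linarith)

theorem secondHalf_of_le {t : I} (h : (t : ℝ) ≤ 1 / 2) : secondHalf t = 0 :=
  max_eq_right (by linarith)

theorem firstHalf_zero : firstHalf 0 = 0 := by simp [firstHalf]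

theorem secondHalf_one : secondHalf 1 = 1 := by norm_num [secondHalf]

variable {X V W : Type} [TopologicalSpace X] [NormedAddCommGroup V] [NormedSpace ℝ V]
  [NormedAddCommGroup W] [NormedSpace ℝ W]
  (φ : OpenPartialHomeomorph X V) (ψ : OpenPartialHomeomorph X W) (x₀ : X)

/-- The closed path through `y` running straight from `x₀` to `y` in one chart, and back in
another one. -/
def meridian (p : I × {y : X // y ∈ φ.source ∧ y ∈ ψ.source}) : X :=
  if (p.1 : ℝ) ≤ 1 / 2
  then φ.symm ((1 - firstHalf p.1) • φ x₀ + firstHalf p.1 • φ p.2)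
  else ψ.symm ((1 - secondHalf p.1) • ψ p.2 + secondHalf p.1 • ψ x₀)

variable {φ ψ x₀}

theorem continuous_meridian (hφ : φ.target = Set.univ) (hψ : ψ.target = Set.univ) :
    Continuous (meridian φ ψ x₀) := by
  have h1 : Continuous fun y : {y : X // y ∈ φ.source ∧ y ∈ ψ.source} => φ y :=
    φ.continuousOn.comp_continuous continuous_subtype_val fun y => y.2.1
  have h2 : Continuous fun y : {y : X // y ∈ φ.source ∧ y ∈ ψ.source} => ψ y :=
    ψ.continuousOn.comp_continuous continuous_subtype_val fun y => y.2.2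
  refine Continuous.if_le ?_ ?_ (by fun_prop) (by fun_prop) ?_
  · exact (φ.continuous_symm_of_target hφ).comp ((Continuous.smul (by fun_prop)
      continuous_const).add (Continuous.smul (by fun_prop) (h1.comp continuous_snd)))
  · exact (ψ.continuous_symm_of_target hψ).comp ((Continuous.smul (by fun_prop)
      (h2.comp continuous_snd)).add (Continuous.smul (by fun_prop) continuous_const))
  · intro p hp
    rw [firstHalf_of_ge hp.ge, secondHalf_of_le hp.le]
    simp [φ.left_inv p.2.2.1, ψ.left_inv p.2.2.2]

theorem meridian_zero (h : x₀ ∈ φ.source) (y) : meridian φ ψ x₀ (0, y) = x₀ := by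
  simp [meridian, firstHalf_zero, φ.left_inv h]

theorem meridian_one (h : x₀ ∈ ψ.source) (y) : meridian φ ψ x₀ (1, y) = x₀ := by
  norm_num [meridian, secondHalf_one, ψ.left_inv h]

theorem meridian_base (h : x₀ ∈ φ.source ∧ x₀ ∈ ψ.source) (t) :
    meridian φ ψ x₀ (t, ⟨x₀, h⟩) = x₀ := by
  simp only [meridian, ← add_smul, sub_add_cancel, one_smul, φ.left_inv h.1, ψ.left_inv h.2,
    ite_self]

theorem GenLoop.homotopic_sweep_meridian (hφ : φ.target = Set.univ) (hψ : ψ.target = Set.univ)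
    (h : x₀ ∈ φ.source ∧ x₀ ∈ ψ.source) {n : ℕ} (f : Ω^ (Fin (n + 1)) X x₀)
    (c : (Fin n → I) → I) (hc : Continuous c)
    (h1 : ∀ x, ∀ t ≤ c x, f (Fin.cons t x) ∈ φ.source)
    (h2 : ∀ x, ∀ t, c x ≤ t → f (Fin.cons t x) ∈ ψ.source) :
    ∃ g : Ω^ (Fin n) {y : X // y ∈ φ.source ∧ y ∈ ψ.source} ⟨x₀, h⟩,
      GenLoop.Homotopic f (GenLoop.sweep (meridian φ ψ x₀) (continuous_meridian hφ hψ)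
        (meridian_zero h.1) (meridian_one h.2) (meridian_base h) g) := by
  have hcons : Continuous fun p : I × (Fin n → I) => (Fin.cons p.1 p.2 : Fin (n + 1) → I) := by
    refine continuous_pi fun i => ?_
    induction i using Fin.cases with
    | zero => simpa using continuous_fst
    | succ j => simp only [Fin.cons_succ]; fun_prop
  have hf : Continuous fun p : I × (Fin n → I) => f (Fin.cons p.1 p.2) :=
    (GenLoop.cont f).comp hcons
  have ht : Continuous fun t : Fin (n + 1) → I => Fin.tail t :=
    continuous_pi fun i => continuous_apply i.succ
  have hfb : ∀ x ∈ Cube.boundary (Fin n), ∀ t, f (Fin.cons t x) = x₀ := fun x ⟨i, hi⟩ t =>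
    GenLoop.bdry f ⟨i.succ, by simpa using hi⟩
  have hf0 : ∀ x, f (Fin.cons 0 x) = x₀ := fun x => GenLoop.bdry f ⟨0, by simp⟩
  have hf1 : ∀ x, f (Fin.cons 1 x) = x₀ := fun x => GenLoop.bdry f ⟨0, by simp⟩
  let g : Ω^ (Fin n) {y : X // y ∈ φ.source ∧ y ∈ ψ.source} ⟨x₀, h⟩ :=
    GenLoop.of (fun x => ⟨f (Fin.cons (c x) x), h1 x _ le_rfl, h2 x _ le_rfl⟩)
      ((hf.comp (hc.prodMk continuous_id)).subtype_mk _)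
      (fun x hx => Subtype.ext (hfb x hx _))
  let pr : ℝ → I := Set.projIcc 0 1 zero_le_one
  have hpr : Continuous pr := continuous_projIcc
  have hpr' : ∀ t : I, pr t = t := fun t => Set.projIcc_val _ t
  have hpr0 : pr 0 = 0 := hpr' 0
  have hpr1 : pr 1 = 1 := hpr' 1
  let A : I × (Fin n → I) → I := fun p => pr (firstHalf p.1 * c p.2)
  let B : I × (Fin n → I) → I := fun p => pr (c p.2 + secondHalf p.1 * (1 - c p.2))
  have hA : ∀ p, f (Fin.cons (A p) p.2) ∈ φ.source := fun p => by
    refine h1 _ _ ?_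
    rw [← hpr' (c p.2)]
    exact Set.monotone_projIcc _ (mul_le_of_le_one_left (c p.2).2.1 (firstHalf_mem p.1).2)
  have hB : ∀ p, f (Fin.cons (B p) p.2) ∈ ψ.source := fun p => by
    refine h2 _ _ ?_
    nth_rewrite 1 [← hpr' (c p.2)]
    exact Set.monotone_projIcc _ (le_add_of_nonneg_right
      (mul_nonneg (secondHalf_mem p.1).1 (by linarith [(c p.2).2.2])))
  have hAc : Continuous fun p => φ (f (Fin.cons (A p) p.2)) :=
    φ.continuousOn.comp_continuous (hf.comp (Continuous.prodMk (hpr.comp (by fun_prop))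
      continuous_snd)) hA
  have hBc : Continuous fun p => ψ (f (Fin.cons (B p) p.2)) :=
    ψ.continuousOn.comp_continuous (hf.comp (Continuous.prodMk (hpr.comp (by fun_prop))
      continuous_snd)) hB
  have hgφ : Continuous fun x => φ (g x) :=
    φ.continuousOn.comp_continuous (continuous_subtype_val.comp (GenLoop.cont g))
      fun x => (g x).2.1
  have hgψ : Continuous fun x => ψ (g x) :=
    ψ.continuousOn.comp_continuous (continuous_subtype_val.comp (GenLoop.cont g))
      fun x => (g x).2.2
  let C : I × (Fin n → I) → I := fun p =>
    pr (firstHalf p.1 * c p.2 + secondHalf p.1 * (1 - c p.2))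
  have hC : Continuous C := hpr.comp (by fun_prop)
  have hC0 : ∀ x, C (0, x) = 0 := fun x => by
    simp only [C, firstHalf_zero, secondHalf_of_le (t := 0) (by norm_num), zero_mul, add_zero,
      hpr0]
  have hC1 : ∀ x, C (1, x) = 1 := fun x => by
    simp only [C, secondHalf_one, firstHalf_of_ge (t := 1) (by norm_num), one_mul,
      add_sub_cancel, hpr1]
  have hfC : Continuous fun t : Fin (n + 1) → I =>
      f (Fin.cons (C (t 0, Fin.tail t)) (Fin.tail t)) :=
    hf.comp ((hC.comp ((continuous_apply 0).prodMk ht)).prodMk ht)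
  let f' : Ω^ (Fin (n + 1)) X x₀ := GenLoop.of _ hfC (by
    rintro t ⟨i, hi⟩
    induction i using Fin.cases with
    | zero => rcases hi with hi | hi <;> simp only [hi, hC0, hC1, hf0, hf1]
    | succ j => exact hfb _ ⟨j, hi⟩ _)
  refine ⟨g, GenLoop.Homotopic.trans (g := f') ?_ ?_⟩
  · refine GenLoop.homotopic_of_map (fun p => f (Fin.cons
      (pr ((1 - (p.1 : ℝ)) * p.2 0 + p.1 * C (p.2 0, Fin.tail p.2))) (Fin.tail p.2)))
      (hf.comp (Continuous.prodMk (hpr.comp ?_) (ht.comp continuous_snd)))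
      (fun t => ?_) (fun t => ?_) ?_
    · have : Continuous fun p : I × (Fin (n + 1) → I) => C (p.2 0, Fin.tail p.2) :=
        hC.comp (Continuous.prodMk (by fun_prop) (ht.comp continuous_snd))
      fun_prop
    · simp [hpr', Fin.cons_self_tail]
    · simp [hpr', f']
    · rintro s t ⟨i, hi⟩
      induction i using Fin.cases with
      | zero =>
        rcases hi with hi | hi
        · simp only [hi, hC0]; simp [hpr0, hf0]
        · simp only [hi, hC1]; simp [hpr1, hf1]
      | succ j => exact hfb _ ⟨j, hi⟩ _
  · refine GenLoop.homotopic_of_map (fun p => if (p.2 0 : ℝ) ≤ 1 / 2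
      then φ.symm ((1 - (p.1 : ℝ)) • φ (f (Fin.cons (A (p.2 0, Fin.tail p.2)) (Fin.tail p.2))) +
        (p.1 : ℝ) • ((1 - firstHalf (p.2 0)) • φ x₀ + firstHalf (p.2 0) • φ (g (Fin.tail p.2))))
      else ψ.symm ((1 - (p.1 : ℝ)) • ψ (f (Fin.cons (B (p.2 0, Fin.tail p.2)) (Fin.tail p.2))) +
        (p.1 : ℝ) • ((1 - secondHalf (p.2 0)) • ψ (g (Fin.tail p.2)) + secondHalf (p.2 0) • ψ x₀)))
      ?_ ?_ ?_ ?_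
    · have e1 : Continuous fun p : I × (Fin (n + 1) → I) => (p.2 0, Fin.tail p.2) :=
        Continuous.prodMk (by fun_prop) (ht.comp continuous_snd)
      have e2 := hAc.comp e1
      have e3 := hBc.comp e1
      have e4 := hgφ.comp (ht.comp (continuous_snd (X := I)))
      have e5 := hgψ.comp (ht.comp (continuous_snd (X := I)))
      simp only [Function.comp_def] at e2 e3 e4 e5
      refine Continuous.if_le ?_ ?_ (by fun_prop) (by fun_prop) ?_
      · exact (φ.continuous_symm_of_target hφ).comp ((Continuous.smul (by fun_prop) e2).add
          (Continuous.smul (by fun_prop) ((Continuous.smul (by fun_prop) continuous_const).add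
          (Continuous.smul (by fun_prop) e4))))
      · exact (ψ.continuous_symm_of_target hψ).comp ((Continuous.smul (by fun_prop) e3).add
          (Continuous.smul (by fun_prop) ((Continuous.smul (by fun_prop) e5).add
          (Continuous.smul (by fun_prop) continuous_const))))
      · intro p hp
        have a1 : f (Fin.cons (A (p.2 0, Fin.tail p.2)) (Fin.tail p.2)) = g (Fin.tail p.2) := by
          simp only [A, firstHalf_of_ge hp.ge, one_mul, hpr']; rfl
        have a2 : f (Fin.cons (B (p.2 0, Fin.tail p.2)) (Fin.tail p.2)) = g (Fin.tail p.2) := by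
          simp only [B, secondHalf_of_le hp.le, zero_mul, add_zero, hpr']; rfl
        rw [firstHalf_of_ge hp.ge, secondHalf_of_le hp.le, a1, a2]
        simp only [sub_self, sub_zero, zero_smul, one_smul, zero_add, add_zero, ← add_smul,
          sub_add_cancel, φ.left_inv (g (Fin.tail p.2)).2.1, ψ.left_inv (g (Fin.tail p.2)).2.2]
    · intro t
      simp only [Set.Icc.coe_zero, sub_zero, one_smul, zero_smul, add_zero, φ.left_inv (hA _),
        ψ.left_inv (hB _)]
      split_ifs with h12
      · change f _ = f _
        simp only [A, C, secondHalf_of_le h12, zero_mul, add_zero]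
      · change f _ = f _
        simp only [B, C, firstHalf_of_ge (not_le.1 h12).le, one_mul]
    · intro t
      simp only [Set.Icc.coe_one, sub_self, zero_smul, one_smul, zero_add]
      rfl
    · rintro s t ⟨i, hi⟩
      induction i using Fin.cases with
      | zero =>
        rcases hi with hi | hi
        · simp [hi, A, firstHalf_zero, hpr0, hf0, ← add_smul, φ.left_inv h.1]
        · have : ¬ ((1 : ℝ) ≤ 2⁻¹) := by norm_num
          simp [hi, B, secondHalf_one, hpr1, hf1, ← add_smul, ψ.left_inv h.2, this]
      | succ j =>
        have hx : Fin.tail t ∈ Cube.boundary (Fin n) := ⟨j, hi⟩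
        have hg : ((g (Fin.tail t) : _) : X) = x₀ := hfb _ hx _
        simp only [hfb _ hx, hg, ← add_smul, sub_add_cancel, one_smul, φ.left_inv h.1,
          ψ.left_inv h.2, ite_self]

end Meridians

section GeneralPosition

open scoped unitInterval Topology.Homotopy ContDiff RealInnerProductSpace
open Module

variable {E : Type} [NormedAddCommGroup E] [InnerProductSpace ℝ E] [FiniteDimensional ℝ E]

/-- A small linear perturbation of the identity moving `a` and `b` by prescribed vectors. -/
theorem exists_linearEquiv_near_id {a b p q : E} (ha : ‖a‖ = 1) (hb : ‖b‖ = 1)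
    (hab : ⟪a, b⟫ = 0) (hp : ‖p‖ < 1 / 4) (hq : ‖q‖ < 1 / 4) :
    ∃ L : E ≃ₗ[ℝ] E, L a = a + p ∧ L b = b + q ∧ (∀ v, ⟪a, v⟫ = 0 → ⟪b, v⟫ = 0 → L v = v) ∧
      ∀ v, ‖L v - v‖ ≤ ‖v‖ / 2 := by
  let T : E →ₗ[ℝ] E := LinearMap.id + (innerₗ E a).smulRight p + (innerₗ E b).smulRight q
  have hT : ∀ v, T v = v + ⟪a, v⟫ • p + ⟪b, v⟫ • q := fun v => rfl
  have hle : ∀ v, ‖T v - v‖ ≤ ‖v‖ / 2 := fun v => by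
    rw [hT, add_assoc, add_sub_cancel_left]
    have h1 := abs_real_inner_le_norm a v
    have h2 := abs_real_inner_le_norm b v
    rw [ha, one_mul] at h1
    rw [hb, one_mul] at h2
    calc ‖⟪a, v⟫ • p + ⟪b, v⟫ • q‖ ≤ ‖⟪a, v⟫ • p‖ + ‖⟪b, v⟫ • q‖ := norm_add_le _ _
      _ = |⟪a, v⟫| * ‖p‖ + |⟪b, v⟫| * ‖q‖ := by simp [norm_smul]
      _ ≤ ‖v‖ * (1 / 4) + ‖v‖ * (1 / 4) := by gcongr
      _ = ‖v‖ / 2 := by ring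
  have hinj : Function.Injective T := by
    rw [← LinearMap.ker_eq_bot, LinearMap.ker_eq_bot']
    intro v hv
    have := hle v
    rw [hv, zero_sub, norm_neg] at this
    exact norm_le_zero_iff.1 (by linarith [norm_nonneg v])
  have hab' : ⟪b, a⟫ = 0 := by rw [real_inner_comm]; exact hab
  refine ⟨LinearEquiv.ofInjectiveEndo T hinj, ?_, ?_, fun v hv hv' => ?_, hle⟩
  · simp [hT, ha, hab']
  · simp [hT, hb, hab]
  · simp [hT, hv, hv']

theorem GenLoop.exists_general_position {n : ℕ} (hE : finrank ℝ E = n + 3)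
    {x₀ : Metric.sphere (0 : E) 1} {a b : E} (ha : ‖a‖ = 1) (hb : ‖b‖ = 1) (hab : ⟪a, b⟫ = 0)
    (hax : ⟪a, (x₀ : E)⟫ = 0) (hbx : ⟪b, (x₀ : E)⟫ = 0)
    (f : Ω^ (Fin (n + 2)) (Metric.sphere (0 : E) 1) x₀) :
    ∃ g : Ω^ (Fin (n + 2)) (Metric.sphere (0 : E) 1) x₀, GenLoop.Homotopic f g ∧
      ∀ x : Fin (n + 1) → I, ∀ t t' : I, (g (Fin.cons t x) : E) = a →
        (g (Fin.cons t' x) : E) ≠ b := by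
  obtain ⟨P, hP, hne, hPb, hf⟩ := GenLoop.exists_smooth f
  let Φ : (Fin (n + 1) → ℝ) × (ℝ × ℝ) × ℝ × ℝ → E × E := fun z =>
    (z.2.2.1 • P (Fin.cons z.2.1.1 z.1), z.2.2.2 • P (Fin.cons z.2.1.2 z.1))
  have hcons : ContDiff ℝ ∞ fun p : ℝ × (Fin (n + 1) → ℝ) =>
      (Fin.cons p.1 p.2 : Fin (n + 2) → ℝ) := by
    refine contDiff_pi.2 fun i => ?_
    induction i using Fin.cases with
    | zero => simpa using contDiff_fst
    | succ j => simp only [Fin.cons_succ]; fun_prop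
  have hΦ : ContDiff ℝ ∞ Φ := by
    have h1 : ContDiff ℝ ∞ fun z : (Fin (n + 1) → ℝ) × (ℝ × ℝ) × ℝ × ℝ =>
        P (Fin.cons z.2.1.1 z.1) := hP.comp (hcons.comp
      (show ContDiff ℝ ∞ fun z : (Fin (n + 1) → ℝ) × (ℝ × ℝ) × ℝ × ℝ => (z.2.1.1, z.1) by
        fun_prop))
    have h2 : ContDiff ℝ ∞ fun z : (Fin (n + 1) → ℝ) × (ℝ × ℝ) × ℝ × ℝ =>
        P (Fin.cons z.2.1.2 z.1) := hP.comp (hcons.comp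
      (show ContDiff ℝ ∞ fun z : (Fin (n + 1) → ℝ) × (ℝ × ℝ) × ℝ × ℝ => (z.2.1.2, z.1) by
        fun_prop))
    fun_prop
  have hdense := ContDiff.dense_compl_range_of_finrank_lt_finrank
    (hΦ.of_le (by exact_mod_cast le_top)) (by simp [hE]; omega)
  obtain ⟨⟨a', b'⟩, hmem, hdist⟩ := hdense.exists_dist_lt (a, b) (show (0 : ℝ) < 1 / 4 by norm_num)
  rw [Prod.dist_eq, max_lt_iff, dist_eq_norm, dist_eq_norm, norm_sub_rev, norm_sub_rev b] at hdist
  obtain ⟨L, hLa, hLb, hLx, hL⟩ := exists_linearEquiv_near_id ha hb hab hdist.1 hdist.2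
  simp only [add_sub_cancel] at hLa hLb
  have hLs : ∀ v, L.symm v ≠ 0 ↔ v ≠ 0 := fun v => by simp
  have hLc : Continuous L.symm := L.symm.toLinearMap.continuous_of_finiteDimensional
  refine ⟨GenLoop.normalize (fun t => L.symm (P (cubeCoe t)))
    (hLc.comp (hP.continuous.comp (by fun_prop))) (fun t => (hLs _).2 (hne t)) (fun t ht => ?_),
    hf.trans (GenLoop.normalize_homotopic _ _ _ _ _ _ fun t s h => ?_), fun x t t' h1 h2 => ?_⟩
  · rw [hPb t ht, LinearEquiv.symm_apply_eq, hLx _ hax hbx]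
  · have h1 := (hLs _).2 (hne t)
    obtain ⟨w, hw⟩ := L.surjective (P (cubeCoe t))
    rw [← hw, L.symm_apply_apply] at h h1
    have h3 : w = -((1 - (s : ℝ)) • (L w - w)) := by
      rw [eq_neg_iff_add_eq_zero]
      refine Eq.trans ?_ h
      rw [smul_sub, sub_smul _ _ w, one_smul]
      abel
    have h4 : ‖w‖ ≤ ‖w‖ / 2 := by
      calc ‖w‖ = ‖(1 - (s : ℝ)) • (L w - w)‖ := by nth_rewrite 1 [h3]; rw [norm_neg]
        _ = (1 - (s : ℝ)) * ‖L w - w‖ := by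
          rw [norm_smul, Real.norm_of_nonneg (by linarith [s.2.2])]
        _ ≤ 1 * ‖L w - w‖ := by gcongr; linarith [s.2.1]
        _ ≤ ‖w‖ / 2 := by rw [one_mul]; exact hL w
    exact h1 (norm_le_zero_iff.1 (by linarith [norm_nonneg w]))
  · have key : ∀ (t : I) (c : E), (GenLoop.normalize (fun t => L.symm (P (cubeCoe t)))
        (hLc.comp (hP.continuous.comp (by fun_prop))) (fun t => (hLs _).2 (hne t))
        (fun t ht => by rw [hPb t ht, LinearEquiv.symm_apply_eq, hLx _ hax hbx])
        (Fin.cons t x) : E) = c →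
        ‖L.symm (P (Fin.cons (t : ℝ) (cubeCoe x)))‖⁻¹ • P (Fin.cons (t : ℝ) (cubeCoe x)) = L c := by
      intro t c h
      have hco : cubeCoe (Fin.cons t x : Fin (n + 2) → I) = Fin.cons (t : ℝ) (cubeCoe x) := by
        ext i
        induction i using Fin.cases <;> simp [cubeCoe]
      rw [← h, ← hco]
      change _ = L (‖_‖⁻¹ • _)
      rw [_root_.map_smul, L.apply_symm_apply]
    refine hmem ⟨(cubeCoe x, ((t : ℝ), (t' : ℝ)),
      (‖L.symm (P (Fin.cons (t : ℝ) (cubeCoe x)))‖⁻¹,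
        ‖L.symm (P (Fin.cons (t' : ℝ) (cubeCoe x)))‖⁻¹)), Prod.ext ?_ ?_⟩
    · exact (key t a h1).trans hLa
    · exact (key t' b h2).trans hLb

end GeneralPosition

section CyclicSpheres

open scoped unitInterval Topology.Homotopy RealInnerProductSpace
open Module

variable {E : Type} [NormedAddCommGroup E] [InnerProductSpace ℝ E] [FiniteDimensional ℝ E]

omit [FiniteDimensional ℝ E] in
theorem mem_stereographic_source {a : E} (ha : ‖a‖ = 1) (x : Metric.sphere (0 : E) 1) :
    x ∈ (stereographic ha).source ↔ (x : E) ≠ a := by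
  rw [stereographic_source, Set.mem_compl_singleton_iff, ne_eq, Subtype.ext_iff]

theorem HomotopyGroup.sweep_meridian_surjective {n : ℕ} (hE : finrank ℝ E = n + 3)
    {x₀ : Metric.sphere (0 : E) 1} {a b : E} (ha : ‖a‖ = 1) (hb : ‖b‖ = 1) (hab : ⟪a, b⟫ = 0)
    (hax : ⟪a, (x₀ : E)⟫ = 0) (hbx : ⟪b, (x₀ : E)⟫ = 0)
    (h : x₀ ∈ (stereographic hb).source ∧ x₀ ∈ (stereographic ha).source) :
    Function.Surjective (HomotopyGroup.sweep (n := n)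
      (meridian (stereographic hb) (stereographic ha) x₀)
      (continuous_meridian (stereographic_target hb) (stereographic_target ha))
      (meridian_zero h.1) (meridian_one h.2) (meridian_base h)) := by
  intro z
  obtain ⟨f, rfl⟩ := HomotopyGroup.mk_surjective z
  obtain ⟨g, hfg, hg⟩ := GenLoop.exists_general_position hE ha hb hab hax hbx f
  have hxa : (x₀ : E) ≠ a := (mem_stereographic_source ha x₀).1 h.2
  have hxb : (x₀ : E) ≠ b := (mem_stereographic_source hb x₀).1 h.1
  have hcons : Continuous fun p : I × (Fin (n + 1) → I) => (Fin.cons p.1 p.2 : Fin (n + 2) → I) := by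
    refine continuous_pi fun i => ?_
    induction i using Fin.cases with
    | zero => simpa using continuous_fst
    | succ j => simp only [Fin.cons_succ]; fun_prop
  have hgc : Continuous fun p : I × (Fin (n + 1) → I) => (g (Fin.cons p.1 p.2) : E) :=
    continuous_subtype_val.comp ((GenLoop.cont g).comp hcons)
  have hcl : ∀ c : E, IsClosed (Prod.snd '' {p : I × (Fin (n + 1) → I) |
      (g (Fin.cons p.1 p.2) : E) = c}) := fun c =>
    ((isClosed_eq hgc continuous_const).isCompact.image continuous_snd).isClosed
  obtain ⟨τ, hτa, hτb, hτ⟩ := exists_continuous_zero_one_of_isClosed (hcl a) (hcl b) (by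
    rw [Set.disjoint_left]
    rintro _ ⟨⟨t, x⟩, h1, rfl⟩ ⟨⟨t', x'⟩, h2, h3⟩
    simp only at h3
    subst h3
    exact hg x' t t' h1 h2)
  have hc : Continuous fun x => unitInterval.symm (⟨τ x, hτ x⟩ : I) :=
    unitInterval.continuous_symm.comp (τ.continuous.subtype_mk _)
  have hg0 : ∀ x, g (Fin.cons 0 x) = x₀ := fun x => GenLoop.bdry g ⟨0, by simp⟩
  have hg1 : ∀ x, g (Fin.cons 1 x) = x₀ := fun x => GenLoop.bdry g ⟨0, by simp⟩
  obtain ⟨k, hk⟩ := GenLoop.homotopic_sweep_meridian (stereographic_target hb)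
    (stereographic_target ha) h g _ hc (fun x t ht => by
      rw [mem_stereographic_source]
      intro heq
      have h1 : τ x = 1 := hτb ⟨(t, x), heq, rfl⟩
      have h2 : t = 0 := by
        apply le_antisymm (ht.trans (le_of_eq (Subtype.ext ?_))) unitInterval.nonneg'
        simp [h1]
      rw [h2, hg0] at heq
      exact hxb heq) (fun x t ht => by
      rw [mem_stereographic_source]
      intro heq
      have h1 : τ x = 0 := hτa ⟨(t, x), heq, rfl⟩
      have h2 : t = 1 := by
        apply le_antisymm unitInterval.le_one' ((le_of_eq (Subtype.ext ?_)).trans ht)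
        simp [h1]
      rw [h2, hg1] at heq
      exact hxa heq)
  refine ⟨HomotopyGroup.mk k, ?_⟩
  rw [HomotopyGroup.sweep_mk, HomotopyGroup.mk_eq_iff]
  exact (hfg.trans hk).symm

/-- The complement of a point in the source of a chart carries a sphere inducing surjections on
homotopy groups. -/
theorem exists_sphere_map_surjective {X V : Type} [TopologicalSpace X] [T1Space X]
    [NormedAddCommGroup V] [InnerProductSpace ℝ V] (φ : OpenPartialHomeomorph X V)
    (hφ : φ.target = Set.univ) {p x₀ : X} (hp : p ∈ φ.source) (hx : x₀ ∈ φ.source) (hne : x₀ ≠ p)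
    {T : Set X} (hT : T = {p}ᶜ) (hx' : x₀ ∈ φ.source ∧ x₀ ∈ T) (n : ℕ) :
    ∃ (u₀ : Metric.sphere (0 : V) 1) (Θ : Metric.sphere (0 : V) 1 →
        {y : X // y ∈ φ.source ∧ y ∈ T}) (hΘ : Continuous Θ) (h : Θ u₀ = ⟨x₀, hx'⟩),
      Function.Surjective (HomotopyGroup.map (N := Fin (n + 1)) Θ hΘ h) := by
  have hne' : φ x₀ - φ p ≠ 0 := sub_ne_zero.2 fun h => hne (φ.injOn hx hp h)
  set r : ℝ := ‖φ x₀ - φ p‖ with hr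
  have hr0 : r ≠ 0 := norm_ne_zero_iff.2 hne'
  have hrpos : 0 < r := norm_pos_iff.2 hne'
  have hmem : ∀ w : V, w ≠ 0 → φ.symm (φ p + w) ∈ φ.source ∧ φ.symm (φ p + w) ∈ T := by
    intro w hw
    have hw' : φ p + w ∈ φ.target := by rw [hφ]; trivial
    refine ⟨φ.map_target hw', ?_⟩
    rw [hT, Set.mem_compl_singleton_iff]
    intro h
    have := φ.right_inv hw'
    rw [h] at this
    exact hw (by simpa using this.symm)
  have hru : ∀ u : Metric.sphere (0 : V) 1, r • (u : V) ≠ 0 := fun u =>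
    smul_ne_zero hr0 (sphere_coe_ne_zero u)
  let Θ : Metric.sphere (0 : V) 1 → {y : X // y ∈ φ.source ∧ y ∈ T} := fun u =>
    ⟨φ.symm (φ p + r • (u : V)), hmem _ (hru u)⟩
  have hs := φ.continuous_symm_of_target hφ
  have hΘ : Continuous Θ := (hs.comp (by fun_prop)).subtype_mk _
  have hΘ0 : Θ (unitVector _ hne') = ⟨x₀, hx'⟩ := by
    apply Subtype.ext
    simp only [Θ, unitVector, ← hr, smul_inv_smul₀ hr0, add_sub_cancel, φ.left_inv hx]
  refine ⟨unitVector _ hne', Θ, hΘ, hΘ0, HomotopyGroup.map_surjective_of hΘ hΘ0 fun f => ?_⟩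
  have hfc : Continuous fun t => φ (f t) :=
    φ.continuousOn.comp_continuous (continuous_subtype_val.comp (GenLoop.cont f))
      fun t => (f t).2.1
  let P : (Fin (n + 1) → I) → V := fun t => r⁻¹ • (φ (f t) - φ p)
  have hP : Continuous P := (hfc.sub continuous_const).const_smul _
  have hPne : ∀ t, P t ≠ 0 := fun t => by
    refine smul_ne_zero (inv_ne_zero hr0) (sub_ne_zero.2 fun h => ?_)
    have h1 := φ.injOn (f t).2.1 hp h
    exact hT.subset (f t).2.2 h1
  have hPb : ∀ t ∈ Cube.boundary (Fin (n + 1)), P t = unitVector _ hne' := fun t ht => by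
    simp only [P, GenLoop.bdry f ht]
    rfl
  have hpos : ∀ (s : I) t, 0 < (1 - (s : ℝ)) * (r * ‖P t‖⁻¹) + s * r := by
    intro s t
    have h1 : 0 < r * ‖P t‖⁻¹ := mul_pos hrpos (inv_pos.2 (norm_pos_iff.2 (hPne t)))
    rcases eq_or_lt_of_le s.2.1 with h | h
    · rw [← h]; simpa using h1
    · exact add_pos_of_nonneg_of_pos (mul_nonneg (by linarith [s.2.2]) h1.le) (mul_pos h hrpos)
  refine ⟨GenLoop.normalize P hP hPne hPb, GenLoop.homotopic_of_map (fun q =>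
    ⟨φ.symm (φ p + ((1 - (q.1 : ℝ)) * (r * ‖P q.2‖⁻¹) + q.1 * r) • P q.2),
      hmem _ (smul_ne_zero (hpos q.1 q.2).ne' (hPne q.2))⟩)
    ((hs.comp ?_).subtype_mk _) (fun t => ?_) (fun t => ?_) (fun s t ht => ?_)⟩
  · have : Continuous fun q : I × (Fin (n + 1) → I) => ‖P q.2‖⁻¹ :=
      (hP.comp continuous_snd).norm.inv₀ fun q => norm_ne_zero_iff.2 (hPne q.2)
    fun_prop
  · apply Subtype.ext
    simp only [Θ, GenLoop.normalize, unitVector,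
      Set.Icc.coe_zero, sub_zero, one_mul, zero_mul, add_zero, mul_smul]
    rfl
  · apply Subtype.ext
    simp only [Set.Icc.coe_one, sub_self, zero_mul, zero_add, one_mul, P, smul_inv_smul₀ hr0,
      add_sub_cancel, φ.left_inv (f t).2.1]
  · apply Subtype.ext
    have h1 : ‖P t‖ = 1 := by
      rw [hPb t ht]
      exact norm_eq_of_mem_sphere _
    have h2 : (1 - (s : ℝ)) * (r * ‖P t‖⁻¹) + s * r = r := by
      rw [h1]
      ring
    simp only [h2]
    simp only [P, smul_inv_smul₀ hr0, add_sub_cancel, φ.left_inv (f t).2.1]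
    rw [GenLoop.bdry f ht]

open Circle in
/-- The loop winding `k` times around the circle. -/
def windingLoop (k : ℤ) : Ω^ (Fin 1) Circle 1 :=
  GenLoop.of (fun t => Circle.exp (k * (2 * Real.pi) * t 0)) (by fun_prop) (by
    rintro t ⟨i, hi⟩
    obtain rfl := Subsingleton.elim i 0
    rw [Circle.exp_eq_one]
    rcases hi with hi | hi
    · exact ⟨0, by simp [hi]⟩
    · exact ⟨k, by simp [hi]⟩)

theorem isCyclic_pi_one_circle : IsCyclic (HomotopyGroup (Fin 1) Circle 1) := by
  let w : Multiplicative ℤ →* HomotopyGroup (Fin 1) Circle 1 := MonoidHom.mk'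
    (fun k => HomotopyGroup.mk (windingLoop k.toAdd)) (by
      intro a b
      rw [HomotopyGroup.mk_mul_mk_eq_pmul]
      congr 1
      ext t
      simp only [windingLoop, GenLoop.pmul, GenLoop.of_apply, toAdd_mul, ← Circle.exp_add]
      congr 2
      push_cast
      ring)
  refine isCyclic_of_surjective w fun z => ?_
  obtain ⟨f, rfl⟩ := HomotopyGroup.mk_surjective z
  let γ : C(I, Circle) := ⟨fun s => f fun _ => s, (GenLoop.cont f).comp (by fun_prop)⟩
  have hγ0 : γ 0 = Circle.exp 0 := by
    rw [Circle.exp_zero]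
    exact GenLoop.bdry f ⟨0, Or.inl rfl⟩
  let F := Circle.isCoveringMap_exp.liftPath γ 0 hγ0
  have hF : ∀ s, Circle.exp (F s) = γ s := fun s =>
    congrFun (Circle.isCoveringMap_exp.liftPath_lifts γ 0 hγ0) s
  have hF0 : F 0 = 0 := Circle.isCoveringMap_exp.liftPath_zero γ 0 hγ0
  obtain ⟨k, hk⟩ : ∃ k : ℤ, F 1 = k * (2 * Real.pi) := by
    rw [← Circle.exp_eq_one, hF]
    exact GenLoop.bdry f ⟨0, Or.inr rfl⟩
  refine ⟨Multiplicative.ofAdd k, ?_⟩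
  refine HomotopyGroup.mk_eq_iff.2 (GenLoop.homotopic_of_map (fun p => Circle.exp
    ((1 - (p.1 : ℝ)) * (k * (2 * Real.pi) * p.2 0) + p.1 * F (p.2 0))) (by fun_prop)
    (fun t => ?_) (fun t => ?_) ?_)
  · simp [windingLoop]
  · simp only [Set.Icc.coe_one, sub_self, zero_mul, zero_add, one_mul, hF]
    change f _ = f _
    congr 1
    ext i
    rw [Subsingleton.elim i 0]
  · rintro s t ⟨i, hi⟩
    obtain rfl := Subsingleton.elim i 0
    rw [Circle.exp_eq_one]
    rcases hi with hi | hi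
    · exact ⟨0, by simp [hi, hF0]⟩
    · exact ⟨k, by simp only [hi, hk, Set.Icc.coe_one]; ring⟩

theorem isCyclic_homotopyGroup_sphere_of_finrank_two (hE : finrank ℝ E = 2)
    (x₀ : Metric.sphere (0 : E) 1) :
    IsCyclic (HomotopyGroup (Fin 1) (Metric.sphere (0 : E) 1) x₀) := by
  have := isCyclic_pi_one_circle
  let e : ℂ ≃ₗᵢ[ℝ] E := Complex.orthonormalBasisOneI.equiv
    ((stdOrthonormalBasis ℝ E).reindex (finCongr hE)) (Equiv.refl _)
  have hm : ∀ x : Metric.sphere (0 : E) 1, e.symm x ∈ Submonoid.unitSphere ℂ := fun x =>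
    mem_sphere_zero_iff_norm.2 (by rw [e.symm.norm_map]; exact norm_eq_of_mem_sphere _)
  let c : Metric.sphere (0 : E) 1 → Circle := fun x => ⟨e.symm x, hm x⟩
  have hc : Continuous c := (e.symm.continuous.comp continuous_subtype_val).subtype_mk _
  have hec : ∀ x, e (c x : ℂ) = x := fun x => e.apply_symm_apply _
  let Θ : Circle → Metric.sphere (0 : E) 1 := fun w => ⟨e ((c x₀ * w : Circle) : ℂ), by
    rw [mem_sphere_zero_iff_norm, e.norm_map, Circle.norm_coe]⟩
  have hΘ : Continuous Θ := (e.continuous.comp (by fun_prop)).subtype_mk _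
  have h : Θ 1 = x₀ := by
    apply Subtype.ext
    simp only [Θ, mul_one, hec]
  refine isCyclic_of_surjective (HomotopyGroup.map (N := Fin 1) Θ hΘ h)
    (HomotopyGroup.map_surjective_of hΘ h fun f => ?_)
  refine ⟨GenLoop.of (fun t => (c x₀)⁻¹ * c (f t)) ?_ ?_, ?_⟩
  · exact continuous_const.mul (hc.comp (GenLoop.cont f))
  · intro t ht
    rw [inv_mul_eq_one, GenLoop.bdry f ht]
  · rw [show GenLoop.map _ _ _ _ = f from ?_]
    ext t
    simp only [Θ, GenLoop.map_apply, GenLoop.of_apply, mul_inv_cancel_left, hec]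

theorem isCyclic_homotopyGroup_sphere (n : ℕ) : ∀ {E : Type} [NormedAddCommGroup E]
    [InnerProductSpace ℝ E] [FiniteDimensional ℝ E], finrank ℝ E = n + 2 →
    ∀ x₀ : Metric.sphere (0 : E) 1,
      IsCyclic (HomotopyGroup (Fin (n + 1)) (Metric.sphere (0 : E) 1) x₀) := by
  induction n with
  | zero => exact fun hE x₀ => isCyclic_homotopyGroup_sphere_of_finrank_two hE x₀
  | succ n ih =>
    intro E _ _ _ hE x₀
    obtain ⟨v, hv⟩ := Orthonormal.exists_orthonormalBasis_extension_of_card_eq (𝕜 := ℝ)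
      (ι := Fin (n + 3)) (by rw [hE, Fintype.card_fin]) (v := fun _ => (x₀ : E)) (s := {0}) (by
        rw [orthonormal_iff_ite]
        intro i j
        rw [if_pos (Subsingleton.elim i j)]
        simp)
    have hv0 : v 0 = x₀ := hv 0 rfl
    have ha := v.norm_eq_one 1
    have hb := v.norm_eq_one 2
    have h12 : (1 : Fin (n + 3)) ≠ 2 := by
      simp [Fin.ext_iff, Nat.mod_eq_of_lt (show 2 < n + 3 by omega)]
    have h10 : (1 : Fin (n + 3)) ≠ 0 := by simp
    have h20 : (2 : Fin (n + 3)) ≠ 0 := by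
      simp [Fin.ext_iff, Nat.mod_eq_of_lt (show 2 < n + 3 by omega)]
    have hinj := v.orthonormal.linearIndependent.injective
    have hax : x₀ ∈ (stereographic ha).source := by
      rw [mem_stereographic_source, ← hv0]
      exact hinj.ne h10.symm
    have hbx : x₀ ∈ (stereographic hb).source := by
      rw [mem_stereographic_source, ← hv0]
      exact hinj.ne h20.symm
    have hab : (⟨v 1, by simp [ha]⟩ : Metric.sphere (0 : E) 1) ∈ (stereographic hb).source := by
      rw [mem_stereographic_source]
      exact hinj.ne h12
    have : Fact (finrank ℝ E = n + 2 + 1) := ⟨hE⟩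
    obtain ⟨u₀, Θ, hΘ, hΘ0, hsurj⟩ := exists_sphere_map_surjective (stereographic hb)
      (stereographic_target hb) hab hbx (by
        rw [ne_eq, Subtype.ext_iff, ← hv0]
        exact hinj.ne h10.symm) (stereographic_source ha) ⟨hbx, hax⟩ n
    have := ih (Submodule.finrank_orthogonal_span_singleton (n := n + 2) (v := v 2)
      (by rw [← norm_ne_zero_iff, hb]; exact one_ne_zero)) u₀
    have hY := isCyclic_of_surjective _ hsurj
    exact isCyclic_of_surjective _ (HomotopyGroup.sweep_meridian_surjective hE ha hb
      (v.orthonormal.2 h12) (by rw [← hv0]; exact v.orthonormal.2 h10)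
      (by rw [← hv0]; exact v.orthonormal.2 h20) ⟨hbx, hax⟩)

end CyclicSpheres

section PartialDerivatives

open scoped ContDiff

variable {ι E F : Type} [Fintype ι] [DecidableEq ι] [NormedAddCommGroup E] [NormedSpace ℝ E]
  [NormedAddCommGroup F] [NormedSpace ℝ F]

/-- The `i`-th partial derivative. -/
def pderivAt (i : ι) (f : (ι → ℝ) → E) (t : ι → ℝ) : E := fderiv ℝ f t (Pi.single i 1)

theorem ContDiffAt.pderivAt {f : (ι → ℝ) → E} {t : ι → ℝ} (hf : ContDiffAt ℝ ∞ f t) (i : ι) :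
    ContDiffAt ℝ ∞ (pderivAt i f) t :=
  (hf.fderiv_right (m := ∞) le_rfl).clm_apply contDiffAt_const

theorem pderivAt_comm {f : (ι → ℝ) → E} {t : ι → ℝ} (hf : ContDiffAt ℝ ∞ f t) (i j : ι) :
    pderivAt i (pderivAt j f) t = pderivAt j (pderivAt i f) t := by
  have hd : DifferentiableAt ℝ (fderiv ℝ f) t :=
    (hf.fderiv_right (m := ∞) le_rfl).differentiableAt (by simp)
  have key : ∀ i j : ι, pderivAt i (pderivAt j f) t =
      fderiv ℝ (fderiv ℝ f) t (Pi.single i 1) (Pi.single j 1) := by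
    intro i j
    change fderiv ℝ (fun s => fderiv ℝ f s (Pi.single j 1)) t (Pi.single i 1) = _
    rw [fderiv_clm_apply hd (differentiableAt_const _)]
    simp
  rw [key, key]
  exact (hf.isSymmSndFDerivAt (by simp; exact WithTop.coe_le_coe.2 (le_top : (2 : ℕ∞) ≤ ⊤))).eq _ _

theorem pderivAt_clm (τ : E →L[ℝ] F) {f : (ι → ℝ) → E} {t : ι → ℝ} (hf : DifferentiableAt ℝ f t)
    (i : ι) : pderivAt i (fun s => τ (f s)) t = τ (pderivAt i f t) := by
  simp only [pderivAt]
  have h : HasFDerivAt (fun s => τ (f s)) _ t := τ.hasFDerivAt.comp t hf.hasFDerivAt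
  rw [h.fderiv]
  rfl

theorem pderivAt_sub {f g : (ι → ℝ) → E} {t : ι → ℝ} (hf : DifferentiableAt ℝ f t)
    (hg : DifferentiableAt ℝ g t) (i : ι) :
    pderivAt i (fun s => f s - g s) t = pderivAt i f t - pderivAt i g t := by
  simp only [pderivAt]
  rw [fderiv_fun_sub hf hg]
  rfl

theorem pderivAt_neg (f : (ι → ℝ) → E) (t : ι → ℝ) (i : ι) :
    pderivAt i (fun s => - f s) t = - pderivAt i f t := by
  simp only [pderivAt, fderiv_fun_neg]
  rfl

theorem hasDerivAt_pderivAt {f : (ι → ℝ) → E} {t : ι → ℝ} (hf : DifferentiableAt ℝ f t) (i : ι) :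
    HasDerivAt (fun r : ℝ => f (t + r • Pi.single i (1 : ℝ))) (pderivAt i f t) 0 := by
  let p : ℝ → ι → ℝ := fun r => t + r • Pi.single i 1
  have hp : HasDerivAt p (Pi.single i 1) 0 := by
    simpa only [id, one_smul] using
      ((hasDerivAt_id (0 : ℝ)).smul_const (Pi.single i (1 : ℝ) : ι → ℝ)).const_add t
  have hp0 : p 0 = t := by simp [p]
  exact HasFDerivAt.comp_hasDerivAt (0 : ℝ) (f := p) (by rw [hp0]; exact hf.hasFDerivAt) hp

/-- Tangential derivatives vanish along a face on which a function is constant. -/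
theorem pderivAt_eq_zero_of_face {f : (ι → ℝ) → E} {t : ι → ℝ} {i j : ι} (hij : i ≠ j) {x : E}
    (hf : DifferentiableAt ℝ f t) (h : ∀ s, s j = t j → f s = x) : pderivAt i f t = 0 := by
  have h1 := hasDerivAt_pderivAt hf i
  have h2 : (fun r : ℝ => f (t + r • Pi.single i (1 : ℝ))) = fun _ => x :=
    funext fun r => h _ (by simp [hij.symm])
  rw [h2] at h1
  exact h1.unique (hasDerivAt_const _ _)

theorem contDiff_finCons {n : ℕ} (r : ℝ) :
    ContDiff ℝ ∞ fun t : Fin n → ℝ => (Fin.cons r t : Fin (n + 1) → ℝ) := by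
  refine contDiff_pi.2 fun i => ?_
  induction i using Fin.cases with
  | zero => simpa using contDiff_const
  | succ j => simpa using contDiff_apply ℝ ℝ j

theorem pderivAt_finCons {n : ℕ} {f : (Fin (n + 1) → ℝ) → E} {r : ℝ} {t : Fin n → ℝ}
    (hf : DifferentiableAt ℝ f (Fin.cons r t)) (i : Fin n) :
    pderivAt i (fun s => f (Fin.cons r s)) t = pderivAt i.succ f (Fin.cons r t) := by
  have h1 := hasDerivAt_pderivAt (f := fun s : Fin n → ℝ => f (Fin.cons r s)) (t := t)
    (DifferentiableAt.comp t hf ((contDiff_finCons r).differentiable (by simp) t)) i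
  have h2 := hasDerivAt_pderivAt hf i.succ
  refine h1.unique ?_
  convert h2 using 3 with u
  ext j
  induction j using Fin.cases with
  | zero => simp
  | succ j => simp [Pi.single_apply, Fin.succ_inj]

variable {A : Type} [NormedRing A] [NormedAlgebra ℝ A]

theorem pderivAt_mul {f g : (ι → ℝ) → A} {t : ι → ℝ} (hf : DifferentiableAt ℝ f t)
    (hg : DifferentiableAt ℝ g t) (i : ι) :
    pderivAt i (fun s => f s * g s) t = pderivAt i f t * g t + f t * pderivAt i g t := by
  simp only [pderivAt]
  rw [fderiv_fun_mul' hf hg]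
  simp [add_comm]

theorem pderivAt_ringInverse [CompleteSpace A] {f : (ι → ℝ) → A} {t : ι → ℝ}
    (hf : DifferentiableAt ℝ f t) (hu : IsUnit (f t)) (i : ι) :
    pderivAt i (fun s => Ring.inverse (f s)) t =
      - (Ring.inverse (f t) * pderivAt i f t * Ring.inverse (f t)) := by
  obtain ⟨u, hu⟩ := hu
  have h1 := hasFDerivAt_ringInverse (𝕜 := ℝ) u
  rw [hu] at h1
  simp only [pderivAt]
  have h : HasFDerivAt (fun s => Ring.inverse (f s)) _ t := h1.comp t hf.hasFDerivAt
  rw [h.fderiv, ← hu]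
  simp

omit [DecidableEq ι] in
theorem ContDiffAt.ringInverse [CompleteSpace A] {f : (ι → ℝ) → A} {t : ι → ℝ}
    (hf : ContDiffAt ℝ ∞ f t) (hu : IsUnit (f t)) :
    ContDiffAt ℝ ∞ (fun s => Ring.inverse (f s)) t := by
  obtain ⟨u, hu⟩ := hu
  have h1 := contDiffAt_ringInverse ℝ u (n := ∞)
  rw [hu] at h1
  exact h1.comp t hf

/-- The divergence theorem on the unit cube. -/
theorem integral_sum_pderivAt {n : ℕ} (V : Fin (n + 1) → (Fin (n + 1) → ℝ) → ℝ)
    (hV : ∀ i, ∀ t ∈ Set.Icc (0 : Fin (n + 1) → ℝ) 1, ContDiffAt ℝ ∞ (V i) t) :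
    ∫ t in Set.Icc (0 : Fin (n + 1) → ℝ) 1, ∑ i, pderivAt i (V i) t =
      ∑ i, ((∫ t in Set.Icc (0 : Fin n → ℝ) 1, V i (i.insertNth 1 t)) -
        ∫ t in Set.Icc (0 : Fin n → ℝ) 1, V i (i.insertNth 0 t)) := by
  have h := MeasureTheory.integral_divergence_of_hasFDerivAt_off_countable'
    (0 : Fin (n + 1) → ℝ) 1 zero_le_one V (fun i => fderiv ℝ (V i)) ∅ Set.countable_empty
    (fun i t ht => (hV i t ht).continuousAt.continuousWithinAt)
    (fun t ht i => ((hV i t ⟨fun j => ?_, fun j => ?_⟩).differentiableAt (by simp)).hasFDerivAt) ?_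
  · exact h
  · exact (ht.1 j (Set.mem_univ _)).1.le
  · exact (ht.1 j (Set.mem_univ _)).2.le
  · refine ContinuousOn.integrableOn_compact isCompact_Icc
      (continuousOn_finsetSum _ fun i _ t ht => ?_)
    exact ((hV i t ht).pderivAt i).continuousAt.continuousWithinAt

end PartialDerivatives

section MaurerCartan

open scoped ContDiff

variable {A : Type} [NormedRing A] [NormedAlgebra ℝ A] (τ : A →L[ℝ] ℝ)

/-- The trilinear form `τ (x [y, z])`. -/
def traceTriple (x y z : A) : ℝ := τ (x * (y * z - z * y))

variable {τ} (hτ : ∀ x y, τ (x * y) = τ (y * x))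

include hτ

theorem trace_rotate_three (x y z : A) : τ (x * (y * z)) = τ (y * (z * x)) := by
  rw [hτ, mul_assoc]

theorem trace_rotate_four (x y z w : A) : τ (x * (y * (z * w))) = τ (y * (z * (w * x))) := by
  rw [hτ]
  simp only [mul_assoc]

theorem traceTriple_closed (a : Fin 4 → A) (b : Fin 4 → Fin 4 → A)
    (hb : ∀ i j, b i j = b j i) (d : Fin 4 → Fin 4 → A) (hd : ∀ i j, d i j = b i j - a i * a j) :
    (traceTriple τ (d 0 1) (a 2) (a 3) + traceTriple τ (a 1) (d 0 2) (a 3) +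
      traceTriple τ (a 1) (a 2) (d 0 3)) -
    (traceTriple τ (d 1 0) (a 2) (a 3) + traceTriple τ (a 0) (d 1 2) (a 3) +
      traceTriple τ (a 0) (a 2) (d 1 3)) -
    (traceTriple τ (d 2 0) (a 3) (a 1) + traceTriple τ (a 0) (d 2 3) (a 1) +
      traceTriple τ (a 0) (a 3) (d 2 1)) -
    (traceTriple τ (d 3 0) (a 1) (a 2) + traceTriple τ (a 0) (d 3 1) (a 2) +
      traceTriple τ (a 0) (a 1) (d 3 2)) = 0 := by
  have c3 := trace_rotate_three hτ
  have c3b : ∀ x y z : A, τ (x * (y * z)) = τ (z * (x * y)) := fun x y z => by rw [c3 z]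
  have c4 := trace_rotate_four hτ
  have c4b : ∀ x y z w : A, τ (x * (y * (z * w))) = τ (z * (w * (x * y))) := fun x y z w => by
    rw [c4, c4]
  have c4c : ∀ x y z w : A, τ (x * (y * (z * w))) = τ (w * (x * (y * z))) := fun x y z w => by
    rw [c4 w]
  simp only [traceTriple, hd, hb 1 0, hb 2 0, hb 3 0, hb 2 1, hb 3 1, hb 3 2, mul_sub, sub_mul,
    map_sub, mul_assoc]
  simp only [c3b (a 0) (a 1) (b 2 3),
    c3b (a 0) (a 2) (b 1 3),
    c3b (a 0) (a 3) (b 1 2),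
    c3 (a 0) (b 1 2) (a 3),
    c3 (a 0) (b 1 3) (a 2),
    c3 (a 0) (b 2 3) (a 1),
    c4 (a 1) (a 0) (a 2) (a 3),
    c4 (a 1) (a 0) (a 3) (a 2),
    c4b (a 1) (a 2) (a 0) (a 3),
    c3b (a 1) (a 2) (b 0 3),
    c4b (a 1) (a 3) (a 0) (a 2),
    c3b (a 1) (a 3) (b 0 2),
    c3 (a 1) (b 0 2) (a 3),
    c3 (a 1) (b 0 3) (a 2),
    c4 (a 2) (a 0) (a 1) (a 3),
    c4 (a 2) (a 0) (a 3) (a 1),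
    c4 (a 3) (a 0) (a 1) (a 2),
    c4 (a 3) (a 0) (a 2) (a 1)]
  ring

/-- The cross terms in the trace form of a product. -/
theorem traceTriple_add (a β : Fin 3 → A) (c : Fin 3 → Fin 3 → A) (hc : ∀ i j, c i j = c j i)
    (b : Fin 3 → Fin 3 → A) (hb : ∀ i j, b i j = b j i)
    (d e : Fin 3 → Fin 3 → A) (hd : ∀ i j, d i j = b i j - a i * a j)
    (he : ∀ i j, e i j = c i j - β j * β i) :
    traceTriple τ (a 0 + β 0) (a 1 + β 1) (a 2 + β 2) =
      traceTriple τ (a 0) (a 1) (a 2) + traceTriple τ (β 0) (β 1) (β 2) -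
      ((τ (d 0 1 * β 2) + τ (a 1 * e 0 2) - (τ (d 0 2 * β 1) + τ (a 2 * e 0 1))) +
      (τ (d 1 2 * β 0) + τ (a 2 * e 1 0) - (τ (d 1 0 * β 2) + τ (a 0 * e 1 2))) +
      (τ (d 2 0 * β 1) + τ (a 0 * e 2 1) - (τ (d 2 1 * β 0) + τ (a 1 * e 2 0)))) := by
  have c3 := trace_rotate_three hτ
  simp only [traceTriple, hd, he, hb 1 0, hb 2 0, hb 2 1, hc 1 0, hc 2 0, hc 2 1, mul_sub, sub_mul,
    mul_add, add_mul, map_sub, map_add, mul_assoc]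
  have c3b : ∀ x y z : A, τ (x * (y * z)) = τ (z * (x * y)) := fun x y z => by rw [c3 z]
  simp only [c3 (a 1) (a 0) (β 2),
    c3 (a 1) (β 0) (β 2),
    c3b (a 1) (a 2) (β 0),
    c3b (a 1) (β 2) (β 0),
    c3 (a 2) (a 0) (β 1),
    c3 (a 2) (β 0) (β 1),
    c3b (a 2) (a 1) (β 0),
    c3b (a 2) (β 1) (β 0)]
  ring

end MaurerCartan

section TraceIntegral

open scoped ContDiff

variable {A : Type} [NormedRing A] [NormedAlgebra ℝ A]

section

variable {ι : Type} [Fintype ι] [DecidableEq ι]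

/-- The components of the Maurer–Cartan form `F⁻¹ dF`. -/
def maurerCartan (F : (ι → ℝ) → A) (i : ι) (t : ι → ℝ) : A :=
  Ring.inverse (F t) * pderivAt i F t

theorem maurerCartan_eq_zero_of_face {F : (ι → ℝ) → A} {t : ι → ℝ} {i j : ι} (hij : i ≠ j) {x : A}
    (hF : DifferentiableAt ℝ F t) (h : ∀ s, s j = t j → F s = x) : maurerCartan F i t = 0 := by
  rw [maurerCartan, pderivAt_eq_zero_of_face hij hF h, mul_zero]

variable [CompleteSpace A] {F : (ι → ℝ) → A} {t : ι → ℝ}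

theorem contDiffAt_maurerCartan (hF : ContDiffAt ℝ ∞ F t) (hu : IsUnit (F t)) (i : ι) :
    ContDiffAt ℝ ∞ (maurerCartan F i) t :=
  (hF.ringInverse hu).mul (hF.pderivAt i)

theorem pderivAt_maurerCartan (hF : ContDiffAt ℝ ∞ F t) (hu : IsUnit (F t)) (i j : ι) :
    pderivAt i (maurerCartan F j) t = Ring.inverse (F t) * pderivAt i (pderivAt j F) t -
      maurerCartan F i t * maurerCartan F j t := by
  have hd : DifferentiableAt ℝ F t := hF.differentiableAt (by simp)
  change pderivAt i (fun s => Ring.inverse (F s) * pderivAt j F s) t = _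
  rw [pderivAt_mul ((hF.ringInverse hu).differentiableAt (by simp))
    ((hF.pderivAt j).differentiableAt (by simp)), pderivAt_ringInverse hd hu]
  simp only [maurerCartan, mul_assoc, neg_mul]
  abel

omit [DecidableEq ι] [CompleteSpace A] in
theorem contDiffAt_traceTriple (τ : A →L[ℝ] ℝ) {a b c : (ι → ℝ) → A} (ha : ContDiffAt ℝ ∞ a t)
    (hb : ContDiffAt ℝ ∞ b t) (hc : ContDiffAt ℝ ∞ c t) :
    ContDiffAt ℝ ∞ (fun s => traceTriple τ (a s) (b s) (c s)) t :=
  τ.contDiff.contDiffAt.comp t (ha.mul ((hb.mul hc).sub (hc.mul hb)))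

omit [CompleteSpace A] in
theorem pderivAt_traceTriple (τ : A →L[ℝ] ℝ) {a b c : (ι → ℝ) → A} (ha : ContDiffAt ℝ ∞ a t)
    (hb : ContDiffAt ℝ ∞ b t) (hc : ContDiffAt ℝ ∞ c t) (i : ι) :
    pderivAt i (fun s => traceTriple τ (a s) (b s) (c s)) t =
      traceTriple τ (pderivAt i a t) (b t) (c t) + traceTriple τ (a t) (pderivAt i b t) (c t) +
        traceTriple τ (a t) (b t) (pderivAt i c t) := by
  have ha' : DifferentiableAt ℝ a t := ha.differentiableAt (by simp)
  have hb' : DifferentiableAt ℝ b t := hb.differentiableAt (by simp)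
  have hc' : DifferentiableAt ℝ c t := hc.differentiableAt (by simp)
  change pderivAt i (fun s => τ (a s * (b s * c s - c s * b s))) t = _
  rw [pderivAt_clm τ (ha'.fun_mul ((hb'.fun_mul hc').fun_sub (hc'.fun_mul hb'))),
    pderivAt_mul ha' ((hb'.fun_mul hc').fun_sub (hc'.fun_mul hb')),
    pderivAt_sub (hb'.fun_mul hc') (hc'.fun_mul hb'), pderivAt_mul hb' hc', pderivAt_mul hc' hb']
  simp only [traceTriple, ← map_add]
  congr 1
  noncomm_ring

end

/-- The integral of the invariant three-form `τ (a ∧ a ∧ a)`, `a = F⁻¹ dF`, over the unit cube. -/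
def traceIntegral (τ : A →L[ℝ] ℝ) (F : (Fin 3 → ℝ) → A) : ℝ :=
  ∫ t in Set.Icc (0 : Fin 3 → ℝ) 1,
    traceTriple τ (maurerCartan F 0 t) (maurerCartan F 1 t) (maurerCartan F 2 t)

@[simp] theorem traceTriple_zero_left (τ : A →L[ℝ] ℝ) (x y : A) : traceTriple τ 0 x y = 0 := by
  simp [traceTriple]

@[simp] theorem traceTriple_zero_mid (τ : A →L[ℝ] ℝ) (x y : A) : traceTriple τ x 0 y = 0 := by
  simp [traceTriple]

variable [CompleteSpace A]

/-- Invariance under smooth homotopies. -/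
theorem traceIntegral_eq_of_homotopy {τ : A →L[ℝ] ℝ} (hτ : ∀ x y, τ (x * y) = τ (y * x))
    {G : (Fin 4 → ℝ) → A} (hG : ContDiff ℝ ∞ G)
    (hu : ∀ t ∈ Set.Icc (0 : Fin 4 → ℝ) 1, IsUnit (G t))
    (hb : ∀ t i, i ≠ 0 → (t i = 0 ∨ t i = 1) → G t = 1) :
    traceIntegral τ (fun t => G (Fin.cons 0 t)) = traceIntegral τ (fun t => G (Fin.cons 1 t)) := by
  have hd : Differentiable ℝ G := hG.differentiable (by simp)
  let T : Fin 4 → Fin 4 → Fin 4 → (Fin 4 → ℝ) → ℝ := fun i j k t =>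
    traceTriple τ (maurerCartan G i t) (maurerCartan G j t) (maurerCartan G k t)
  have hT : ∀ i j k, ∀ t ∈ Set.Icc (0 : Fin 4 → ℝ) 1, ContDiffAt ℝ ∞ (T i j k) t :=
    fun i j k t ht => contDiffAt_traceTriple τ (contDiffAt_maurerCartan hG.contDiffAt (hu t ht) i)
      (contDiffAt_maurerCartan hG.contDiffAt (hu t ht) j)
      (contDiffAt_maurerCartan hG.contDiffAt (hu t ht) k)
  let V : Fin 4 → (Fin 4 → ℝ) → ℝ := ![T 1 2 3, fun t => - T 0 2 3 t, fun t => - T 0 3 1 t,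
    fun t => - T 0 1 2 t]
  have hdiv := integral_sum_pderivAt V (fun i t ht => by
    fin_cases i
    exacts [hT _ _ _ t ht, (hT _ _ _ t ht).neg, (hT _ _ _ t ht).neg, (hT _ _ _ t ht).neg])
  have hzero : ∀ t ∈ Set.Icc (0 : Fin 4 → ℝ) 1, ∑ i, pderivAt i (V i) t = 0 := by
    intro t ht
    have hc := fun i => contDiffAt_maurerCartan hG.contDiffAt (hu t ht) i
    rw [Fin.sum_univ_four]
    change pderivAt 0 (T 1 2 3) t + pderivAt 1 (fun t => - T 0 2 3 t) t +
      pderivAt 2 (fun t => - T 0 3 1 t) t + pderivAt 3 (fun t => - T 0 1 2 t) t = 0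
    simp only [pderivAt_neg, ← sub_eq_add_neg]
    simp only [T]
    rw [pderivAt_traceTriple τ (hc 1) (hc 2) (hc 3), pderivAt_traceTriple τ (hc 0) (hc 2) (hc 3),
      pderivAt_traceTriple τ (hc 0) (hc 3) (hc 1), pderivAt_traceTriple τ (hc 0) (hc 1) (hc 2)]
    exact traceTriple_closed hτ (fun i => maurerCartan G i t)
      (fun i j => Ring.inverse (G t) * pderivAt i (pderivAt j G) t)
      (fun i j => by rw [pderivAt_comm hG.contDiffAt])
      (fun i j => pderivAt i (maurerCartan G j) t)
      (fun i j => pderivAt_maurerCartan hG.contDiffAt (hu t ht) i j)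
  rw [MeasureTheory.setIntegral_congr_fun measurableSet_Icc hzero, MeasureTheory.integral_zero,
    Fin.sum_univ_four] at hdiv
  have hface : ∀ i : Fin 4, i ≠ 0 → ∀ r : ℝ, r = 0 ∨ r = 1 →
      ∫ t in Set.Icc (0 : Fin 3 → ℝ) 1, V i (i.insertNth r t) = 0 := by
    intro i hi r hr
    refine MeasureTheory.integral_eq_zero_of_ae (Filter.Eventually.of_forall fun t => ?_)
    have hmc : ∀ j, j ≠ i → maurerCartan G j (i.insertNth r t) = 0 := fun j hj =>
      maurerCartan_eq_zero_of_face hj (hd _) (x := 1) fun s hs => hb s i hi (by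
        rw [hs, Fin.insertNth_apply_same]; exact hr)
    have h0 := hmc 0 hi.symm
    fin_cases i
    · exact absurd rfl hi
    all_goals simp only [Fin.mk_one, Fin.reduceFinMk] at h0; simp [V, T, h0]
  rw [hface 1 (by decide) 1 (.inr rfl), hface 1 (by decide) 0 (.inl rfl),
    hface 2 (by decide) 1 (.inr rfl), hface 2 (by decide) 0 (.inl rfl),
    hface 3 (by decide) 1 (.inr rfl), hface 3 (by decide) 0 (.inl rfl)] at hdiv
  have hslice : ∀ r : ℝ, traceIntegral τ (fun t => G (Fin.cons r t)) =
      ∫ t in Set.Icc (0 : Fin 3 → ℝ) 1, V 0 ((0 : Fin 4).insertNth r t) := by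
    intro r
    simp only [traceIntegral, maurerCartan, pderivAt_finCons (hd _), Fin.insertNth_zero]
    rfl
  rw [hslice, hslice]
  linarith

omit [NormedAlgebra ℝ A] [CompleteSpace A] in
theorem inverse_mul_of_isUnit {x y : A} (hx : IsUnit x) (hy : IsUnit y) :
    Ring.inverse (x * y) = Ring.inverse y * Ring.inverse x := by
  obtain ⟨u, rfl⟩ := hx
  obtain ⟨v, rfl⟩ := hy
  rw [← Units.val_mul, Ring.inverse_unit, Ring.inverse_unit, Ring.inverse_unit,
    _root_.mul_inv_rev, Units.val_mul]

omit [CompleteSpace A] in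
theorem traceTriple_conj {τ : A →L[ℝ] ℝ} (hτ : ∀ x y, τ (x * y) = τ (y * x)) {u v : A}
    (h : u * v = 1) (x y z : A) :
    traceTriple τ (v * x * u) (v * y * u) (v * z * u) = traceTriple τ x y z := by
  have key : ∀ p q : A, (v * p * u) * (v * q * u) = v * (p * q) * u := fun p q => by
    rw [show (v * p * u) * (v * q * u) = v * p * (u * v) * q * u by noncomm_ring, h]
    noncomm_ring
  rw [traceTriple, traceTriple, key, key, ← sub_mul, ← mul_sub, key, mul_assoc, hτ, mul_assoc, h,
    mul_one]

/-- Additivity under pointwise multiplication. -/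
theorem traceIntegral_mul {τ : A →L[ℝ] ℝ} (hτ : ∀ x y, τ (x * y) = τ (y * x))
    {F G : (Fin 3 → ℝ) → A} (hF : ContDiff ℝ ∞ F) (hG : ContDiff ℝ ∞ G)
    (hFu : ∀ t ∈ Set.Icc (0 : Fin 3 → ℝ) 1, IsUnit (F t))
    (hGu : ∀ t ∈ Set.Icc (0 : Fin 3 → ℝ) 1, IsUnit (G t))
    (hFb : ∀ t i, (t i = 0 ∨ t i = 1) → F t = 1) :
    traceIntegral τ (fun t => F t * G t) = traceIntegral τ F + traceIntegral τ G := by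
  have hFd : Differentiable ℝ F := hF.differentiable (by simp)
  have hGd : Differentiable ℝ G := hG.differentiable (by simp)
  let a := maurerCartan F
  let β : Fin 3 → (Fin 3 → ℝ) → A := fun i t => pderivAt i G t * Ring.inverse (G t)
  have ha : ∀ i, ∀ t ∈ Set.Icc (0 : Fin 3 → ℝ) 1, ContDiffAt ℝ ∞ (a i) t := fun i t ht =>
    contDiffAt_maurerCartan hF.contDiffAt (hFu t ht) i
  have hβ : ∀ i, ∀ t ∈ Set.Icc (0 : Fin 3 → ℝ) 1, ContDiffAt ℝ ∞ (β i) t := fun i t ht =>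
    (hG.contDiffAt.pderivAt i).mul (hG.contDiffAt.ringInverse (hGu t ht))
  let p : Fin 3 → Fin 3 → (Fin 3 → ℝ) → ℝ := fun i j t => τ (a i t * β j t)
  have hp : ∀ i j, ∀ t ∈ Set.Icc (0 : Fin 3 → ℝ) 1, ContDiffAt ℝ ∞ (p i j) t := fun i j t ht =>
    τ.contDiff.contDiffAt.comp t ((ha i t ht).mul (hβ j t ht))
  let U : Fin 3 → (Fin 3 → ℝ) → ℝ := ![fun t => p 1 2 t - p 2 1 t, fun t => p 2 0 t - p 0 2 t,
    fun t => p 0 1 t - p 1 0 t]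
  have hU : ∀ i, ∀ t ∈ Set.Icc (0 : Fin 3 → ℝ) 1, ContDiffAt ℝ ∞ (U i) t := fun i t ht => by
    fin_cases i
    exacts [(hp _ _ t ht).sub (hp _ _ t ht), (hp _ _ t ht).sub (hp _ _ t ht),
      (hp _ _ t ht).sub (hp _ _ t ht)]
  have hdiv := integral_sum_pderivAt U hU
  have hface : ∀ i : Fin 3, ∀ r : ℝ, r = 0 ∨ r = 1 →
      ∫ t in Set.Icc (0 : Fin 2 → ℝ) 1, U i (i.insertNth r t) = 0 := by
    intro i r hr
    refine MeasureTheory.integral_eq_zero_of_ae (Filter.Eventually.of_forall fun t => ?_)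
    have hmc : ∀ j, j ≠ i → a j (i.insertNth r t) = 0 := fun j hj =>
      maurerCartan_eq_zero_of_face hj (hFd _) (x := 1) fun s hs => hFb s i (by
        rw [hs, Fin.insertNth_apply_same]; exact hr)
    have h0 := hmc 0
    have h1 := hmc 1
    have h2 := hmc 2
    change U i (i.insertNth r t : Fin 3 → ℝ) = 0
    generalize (i.insertNth r t : Fin 3 → ℝ) = z at h0 h1 h2 ⊢
    fin_cases i <;> simp only [Fin.mk_one, Fin.reduceFinMk, Fin.zero_eta] at h0 h1 h2 <;>
      simp [U, p, h0, h1, h2]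
  have hdiv0 : ∫ t in Set.Icc (0 : Fin 3 → ℝ) 1, ∑ i, pderivAt i (U i) t = 0 := by
    rw [hdiv]
    refine Finset.sum_eq_zero fun i _ => ?_
    rw [hface i 1 (.inr rfl), hface i 0 (.inl rfl), sub_zero]
  have hpoint : ∀ t ∈ Set.Icc (0 : Fin 3 → ℝ) 1,
      traceTriple τ (maurerCartan (fun t => F t * G t) 0 t) (maurerCartan (fun t => F t * G t) 1 t)
        (maurerCartan (fun t => F t * G t) 2 t) =
      traceTriple τ (maurerCartan F 0 t) (maurerCartan F 1 t) (maurerCartan F 2 t) +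
      traceTriple τ (maurerCartan G 0 t) (maurerCartan G 1 t) (maurerCartan G 2 t) -
      ∑ i, pderivAt i (U i) t := by
    intro t ht
    have hG1 : G t * Ring.inverse (G t) = 1 := Ring.mul_inverse_cancel _ (hGu t ht)
    have hF1 : Ring.inverse (F t) * F t = 1 := Ring.inverse_mul_cancel _ (hFu t ht)
    have hG2 : Ring.inverse (G t) * G t = 1 := Ring.inverse_mul_cancel _ (hGu t ht)
    have hFG : ∀ i, maurerCartan (fun t => F t * G t) i t =
        Ring.inverse (G t) * (a i t + β i t) * G t := by
      intro i
      rw [maurerCartan, inverse_mul_of_isUnit (hFu t ht) (hGu t ht), pderivAt_mul (hFd t) (hGd t)]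
      have e1 : Ring.inverse (G t) * Ring.inverse (F t) * (F t * pderivAt i G t) =
          Ring.inverse (G t) * pderivAt i G t := by
        rw [mul_assoc, ← mul_assoc _ (F t), hF1, one_mul]
      have e2 : Ring.inverse (G t) * (β i t) * G t = Ring.inverse (G t) * pderivAt i G t := by
        simp only [β, mul_assoc, hG2, mul_one]
      rw [mul_add, e1, mul_add, add_mul, e2]
      simp only [a, maurerCartan, mul_assoc]
    have hGc : ∀ i, maurerCartan G i t = Ring.inverse (G t) * β i t * G t := by
      intro i
      simp only [maurerCartan, β, mul_assoc, hG2, mul_one]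
    rw [hFG, hFG, hFG, hGc, hGc, hGc, traceTriple_conj hτ hG1, traceTriple_conj hτ hG1]
    have hpd : ∀ i j k, pderivAt i (p j k) t =
        τ (pderivAt i (a j) t * β k t) + τ (a j t * pderivAt i (β k) t) := by
      intro i j k
      have h1 := (ha j t ht).differentiableAt (by simp)
      have h2 := (hβ k t ht).differentiableAt (by simp)
      rw [← map_add, ← pderivAt_mul h1 h2]
      exact pderivAt_clm τ (h1.fun_mul h2) i
    have hps : ∀ i j k j' k', pderivAt i (fun t => p j k t - p j' k' t) t =
        pderivAt i (p j k) t - pderivAt i (p j' k') t := fun i j k j' k' =>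
      pderivAt_sub ((hp _ _ t ht).differentiableAt (by simp))
        ((hp _ _ t ht).differentiableAt (by simp)) i
    rw [traceTriple_add hτ (fun i => a i t) (fun i => β i t)
      (fun i j => pderivAt i (pderivAt j G) t * Ring.inverse (G t))
      (fun i j => by rw [pderivAt_comm hG.contDiffAt])
      (fun i j => Ring.inverse (F t) * pderivAt i (pderivAt j F) t)
      (fun i j => by rw [pderivAt_comm hF.contDiffAt])
      (fun i j => pderivAt i (a j) t) (fun i j => pderivAt i (β j) t)
      (fun i j => pderivAt_maurerCartan hF.contDiffAt (hFu t ht) i j) (fun i j => ?_)]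
    · rw [Fin.sum_univ_three]
      change _ = _ - (pderivAt 0 (fun t => p 1 2 t - p 2 1 t) t +
        pderivAt 1 (fun t => p 2 0 t - p 0 2 t) t + pderivAt 2 (fun t => p 0 1 t - p 1 0 t) t)
      simp only [hps, hpd]
      rfl
    · simp only [β]
      rw [pderivAt_mul ((hG.contDiffAt.pderivAt j).differentiableAt (by simp))
        ((hG.contDiffAt.ringInverse (hGu t ht)).differentiableAt (by simp)),
        pderivAt_ringInverse (hGd t) (hGu t ht)]
      simp only [mul_assoc, mul_neg, sub_eq_add_neg]
  have hint : ∀ H : (Fin 3 → ℝ) → A, ContDiff ℝ ∞ H →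
      (∀ t ∈ Set.Icc (0 : Fin 3 → ℝ) 1, IsUnit (H t)) →
      MeasureTheory.IntegrableOn (fun t => traceTriple τ (maurerCartan H 0 t)
        (maurerCartan H 1 t) (maurerCartan H 2 t)) (Set.Icc (0 : Fin 3 → ℝ) 1) :=
    fun H hH hHu => ContinuousOn.integrableOn_compact isCompact_Icc fun t ht =>
      (contDiffAt_traceTriple τ (contDiffAt_maurerCartan hH.contDiffAt (hHu t ht) 0)
        (contDiffAt_maurerCartan hH.contDiffAt (hHu t ht) 1)
        (contDiffAt_maurerCartan hH.contDiffAt (hHu t ht)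
          2)).continuousAt.continuousWithinAt
  have hintU : MeasureTheory.IntegrableOn (fun t => ∑ i, pderivAt i (U i) t)
      (Set.Icc (0 : Fin 3 → ℝ) 1) :=
    ContinuousOn.integrableOn_compact isCompact_Icc (continuousOn_finsetSum _ fun i _ t ht =>
      ((hU i t ht).pderivAt i).continuousAt.continuousWithinAt)
  have hadd := MeasureTheory.integral_add (hint F hF hFu) (hint G hG hGu)
  have hsub := MeasureTheory.integral_sub ((hint F hF hFu).add (hint G hG hGu)) hintU
  rw [hdiv0, sub_zero] at hsub
  rw [traceIntegral, MeasureTheory.setIntegral_congr_fun measurableSet_Icc hpoint]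
  refine hsub.trans (Eq.trans ?_ hadd)
  rfl

end TraceIntegral

section TraceInvariant

open scoped ContDiff unitInterval Topology.Homotopy

variable {A : Type} [NormedRing A] [NormedAlgebra ℝ A]

/-- A smooth loop in the units of `A`, defined on a neighbourhood of the cube. -/
structure SmoothLoop (A : Type) [NormedRing A] [NormedAlgebra ℝ A] where
  /-- the underlying function -/
  toFun : (Fin 3 → ℝ) → A
  smooth : ContDiff ℝ ∞ toFun
  isUnit : ∀ t ∈ Set.Icc (0 : Fin 3 → ℝ) 1, IsUnit (toFun t)
  boundary : ∀ t i, (t i = 0 ∨ t i = 1) → toFun t = 1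

theorem cubeCoe_mem {ι : Type} (t : ι → I) : cubeCoe t ∈ Set.Icc (0 : ι → ℝ) 1 :=
  ⟨fun i => (t i).2.1, fun i => (t i).2.2⟩

theorem exists_cubeCoe {ι : Type} {t : ι → ℝ} (ht : t ∈ Set.Icc (0 : ι → ℝ) 1) :
    ∃ s : ι → I, cubeCoe s = t := ⟨fun i => ⟨t i, ht.1 i, ht.2 i⟩, rfl⟩

theorem continuous_cubeCoe {ι : Type} : Continuous (cubeCoe : (ι → I) → ι → ℝ) :=
  continuous_pi fun i => continuous_subtype_val.comp (continuous_apply i)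

variable [CompleteSpace A]

omit [NormedAlgebra ℝ A] in
theorem continuous_units_iff {Y : Type} [TopologicalSpace Y] {f : Y → Aˣ} :
    Continuous f ↔ Continuous fun y => (f y : A) :=
  Units.isOpenEmbedding_val.isInducing.continuous_iff

omit [NormedAlgebra ℝ A] in
theorem exists_isUnit_radius {Y : Type} [TopologicalSpace Y] [CompactSpace Y] {f : Y → Aˣ}
    (hf : Continuous f) : ∃ ε > 0, ∀ y (a : A), ‖a - f y‖ < ε → IsUnit a := by
  have hc : Continuous fun y => ‖((f y)⁻¹ : Aˣ).val‖ :=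
    (Units.continuous_val.comp (continuous_inv.comp hf)).norm
  obtain ⟨C, hC⟩ := isCompact_univ.exists_bound_of_continuousOn hc.continuousOn
  refine ⟨(|C| + 1)⁻¹, by positivity, fun y a ha => ?_⟩
  rcases subsingleton_or_nontrivial A with h | h
  · exact isUnit_of_subsingleton a
  refine ⟨(f y).ofNearby a (ha.trans_le ?_), rfl⟩
  have h1 := hC y trivial
  rw [norm_norm] at h1
  have h2 : 0 < ‖((f y)⁻¹ : Aˣ).val‖ := Units.norm_pos _
  exact inv_anti₀ h2 (h1.trans ((le_abs_self C).trans (by linarith)))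

/-- The generalized loop of a smooth loop. -/
def SmoothLoop.toGenLoop (F : SmoothLoop A) : Ω^ (Fin 3) Aˣ 1 :=
  GenLoop.of (fun t => (F.isUnit _ (cubeCoe_mem t)).unit)
    (continuous_units_iff.2 (F.smooth.continuous.comp continuous_cubeCoe))
    (by
      rintro t ⟨i, hi⟩
      refine Units.ext (F.boundary _ i ?_)
      rcases hi with hi | hi <;> simp [cubeCoe, hi])

theorem SmoothLoop.toGenLoop_coe (F : SmoothLoop A) (t : Fin 3 → I) :
    (F.toGenLoop t : A) = F.toFun (cubeCoe t) := rfl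

theorem SmoothLoop.exists_homotopic [FiniteDimensional ℝ A] (f : Ω^ (Fin 3) Aˣ 1) :
    ∃ F : SmoothLoop A, GenLoop.Homotopic F.toGenLoop f := by
  obtain ⟨ε, hε, hu⟩ := exists_isUnit_radius (GenLoop.cont f)
  obtain ⟨P, hP, hPb, hPf⟩ := exists_contDiff_approx Finset.univ (fun t => (f t : A))
    (continuous_units_iff.1 (GenLoop.cont f)) 1
    (fun t i _ h => by rw [GenLoop.bdry f ⟨i, h⟩, Units.val_one]) hε
  let F : SmoothLoop A := ⟨P, hP, fun t ht => by
    obtain ⟨s, rfl⟩ := exists_cubeCoe ht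
    exact hu s _ (hPf s), fun t i h => hPb t i (Finset.mem_univ i) h⟩
  have hH : ∀ p : I × (Fin 3 → I), IsUnit ((1 - (p.1 : ℝ)) • P (cubeCoe p.2) +
      (p.1 : ℝ) • (f p.2 : A)) := fun p => by
    refine hu p.2 _ (lt_of_le_of_lt ?_ (hPf p.2))
    rw [show (1 - (p.1 : ℝ)) • P (cubeCoe p.2) + (p.1 : ℝ) • (f p.2 : A) - f p.2 =
      (1 - (p.1 : ℝ)) • (P (cubeCoe p.2) - f p.2) by module, norm_smul, Real.norm_eq_abs,
      abs_of_nonneg (by linarith [p.1.2.2])]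
    exact mul_le_of_le_one_left (norm_nonneg _) (by linarith [p.1.2.1])
  refine ⟨F, GenLoop.homotopic_of_map (fun p => (hH p).unit) (continuous_units_iff.2 ?_)
    (fun t => ?_) (fun t => ?_) ?_⟩
  · have h1 := continuous_units_iff.1 (GenLoop.cont f)
    have h2 := hP.continuous.comp (continuous_cubeCoe (ι := Fin 3))
    exact ((continuous_const.sub (by fun_prop)).smul (h2.comp continuous_snd)).add
      (Continuous.smul (by fun_prop) (h1.comp continuous_snd))
  · apply Units.ext
    simp [SmoothLoop.toGenLoop_coe, F]
  · apply Units.ext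
    simp
  · intro s t ht
    have h1 := congrArg Units.val (GenLoop.bdry F.toGenLoop ht)
    rw [SmoothLoop.toGenLoop_coe] at h1
    apply Units.ext
    simp only [IsUnit.unit_spec, GenLoop.bdry f ht]
    change (1 - (s : ℝ)) • F.toFun _ + _ = _
    rw [h1]
    simp only [Units.val_one]
    module

theorem contDiff_finTail {n : ℕ} : ContDiff ℝ ∞ fun t : Fin (n + 1) → ℝ => Fin.tail t :=
  contDiff_pi.2 fun i => contDiff_apply ℝ ℝ i.succ

theorem traceIntegral_eq_of_segment {τ : A →L[ℝ] ℝ} (hτ : ∀ x y, τ (x * y) = τ (y * x))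
    {F G : (Fin 3 → ℝ) → A} (hF : ContDiff ℝ ∞ F) (hG : ContDiff ℝ ∞ G)
    (hFb : ∀ t i, (t i = 0 ∨ t i = 1) → F t = 1) (hGb : ∀ t i, (t i = 0 ∨ t i = 1) → G t = 1)
    (hu : ∀ t ∈ Set.Icc (0 : Fin 3 → ℝ) 1, ∀ s ∈ Set.Icc (0 : ℝ) 1,
      IsUnit ((1 - s) • F t + s • G t)) : traceIntegral τ F = traceIntegral τ G := by
  have h := traceIntegral_eq_of_homotopy hτ
    (G := fun t => (1 - t 0) • F (Fin.tail t) + t 0 • G (Fin.tail t))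
    (((contDiff_const.sub (contDiff_apply ℝ ℝ 0)).smul (hF.comp contDiff_finTail)).add
      ((contDiff_apply ℝ ℝ 0).smul (hG.comp contDiff_finTail)))
    (fun t ht => hu _ ⟨fun i => ht.1 i.succ, fun i => ht.2 i.succ⟩ _ ⟨ht.1 0, ht.2 0⟩)
    (fun t i hi h => by
      obtain ⟨j, rfl⟩ := Fin.exists_succ_eq.2 hi
      rw [hFb _ j h, hGb _ j h]
      module)
  simpa using h

theorem SmoothLoop.traceIntegral_eq [FiniteDimensional ℝ A] {τ : A →L[ℝ] ℝ}
    (hτ : ∀ x y, τ (x * y) = τ (y * x)) {F G : SmoothLoop A}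
    (h : GenLoop.Homotopic F.toGenLoop G.toGenLoop) :
    traceIntegral τ F.toFun = traceIntegral τ G.toFun := by
  obtain ⟨K, hK, hK0, hK1, hKb⟩ := h.exists_map
  obtain ⟨ε, hε, hu⟩ := exists_isUnit_radius hK
  have hc : Continuous fun t : Fin 4 → I => K (t 0, Fin.tail t) :=
    hK.comp ((continuous_apply 0).prodMk (continuous_pi fun i => continuous_apply i.succ))
  obtain ⟨P, hP, hPb, hPf⟩ := exists_contDiff_approx {1, 2, 3}
    (fun t : Fin 4 → I => (K (t 0, Fin.tail t) : A)) (continuous_units_iff.1 hc) 1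
    (fun t i hi h => by
      have hi0 : i ≠ 0 := by rintro rfl; simp at hi
      obtain ⟨j, rfl⟩ := Fin.exists_succ_eq.2 hi0
      rw [hKb _ _ ⟨j, h⟩, Units.val_one]) hε
  have hPb' : ∀ t i, i ≠ 0 → (t i = 0 ∨ t i = 1) → P t = 1 := fun t i hi h =>
    hPb t i (by fin_cases i <;> simp_all) h
  have hPu : ∀ t ∈ Set.Icc (0 : Fin 4 → ℝ) 1, IsUnit (P t) := fun t ht => by
    obtain ⟨s, rfl⟩ := exists_cubeCoe ht
    exact hu _ _ (hPf s)
  have hends : ∀ (r : I) (E : SmoothLoop A), (∀ t, K (r, t) = E.toGenLoop t) →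
      traceIntegral τ E.toFun = traceIntegral τ fun t => P (Fin.cons (r : ℝ) t) := by
    intro r E hE
    refine traceIntegral_eq_of_segment hτ E.smooth (hP.comp (contDiff_finCons _)) E.boundary
      (fun t i h => hPb' _ i.succ (Fin.succ_ne_zero i) (by simpa using h)) fun t ht s hs => ?_
    obtain ⟨t, rfl⟩ := exists_cubeCoe ht
    refine hu (r, t) _ (lt_of_le_of_lt ?_ (hPf (Fin.cons r t)))
    have e1 : cubeCoe (Fin.cons r t : Fin 4 → I) = Fin.cons (r : ℝ) (cubeCoe t) := by
      ext i
      induction i using Fin.cases <;> rfl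
    rw [e1, Fin.cons_zero, Fin.tail_cons, hE, SmoothLoop.toGenLoop_coe,
      show (1 - s) • E.toFun (cubeCoe t) + s • P (Fin.cons (r : ℝ) (cubeCoe t)) -
        E.toFun (cubeCoe t) = s • (P (Fin.cons (r : ℝ) (cubeCoe t)) - E.toFun (cubeCoe t)) by
        module, norm_smul, Real.norm_eq_abs, abs_of_nonneg hs.1]
    exact mul_le_of_le_one_left (norm_nonneg _) hs.2
  rw [hends 0 F hK0, hends 1 G hK1]
  exact traceIntegral_eq_of_homotopy hτ hP hPu hPb'

/-- The pointwise product of smooth loops. -/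
def SmoothLoop.mul (F G : SmoothLoop A) : SmoothLoop A where
  toFun t := F.toFun t * G.toFun t
  smooth := F.smooth.mul G.smooth
  isUnit t ht := (F.isUnit t ht).mul (G.isUnit t ht)
  boundary t i h := by rw [F.boundary t i h, G.boundary t i h, mul_one]

theorem SmoothLoop.exists_mk_eq [FiniteDimensional ℝ A] (z : HomotopyGroup (Fin 3) Aˣ 1) :
    ∃ F : SmoothLoop A, HomotopyGroup.mk F.toGenLoop = z := by
  obtain ⟨f, rfl⟩ := HomotopyGroup.mk_surjective z
  obtain ⟨F, hF⟩ := SmoothLoop.exists_homotopic f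
  exact ⟨F, HomotopyGroup.mk_eq_iff.2 hF⟩

variable [FiniteDimensional ℝ A]

/-- The homomorphism from the third homotopy group of `Aˣ` given by integrating the invariant
three-form. -/
def traceInvariant (τ : A →L[ℝ] ℝ) (hτ : ∀ x y, τ (x * y) = τ (y * x)) :
    HomotopyGroup (Fin 3) Aˣ 1 →* Multiplicative ℝ :=
  MonoidHom.mk' (fun z => Multiplicative.ofAdd
    (traceIntegral τ (SmoothLoop.exists_mk_eq z).choose.toFun)) fun x y => by
    have hx := (SmoothLoop.exists_mk_eq x).choose_spec
    have hy := (SmoothLoop.exists_mk_eq y).choose_spec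
    have hxy := (SmoothLoop.exists_mk_eq (x * y)).choose_spec
    set F := (SmoothLoop.exists_mk_eq x).choose
    set G := (SmoothLoop.exists_mk_eq y).choose
    set H := (SmoothLoop.exists_mk_eq (x * y)).choose
    rw [← ofAdd_add, ← traceIntegral_mul hτ F.smooth G.smooth F.isUnit G.isUnit F.boundary]
    congr 1
    refine SmoothLoop.traceIntegral_eq (G := F.mul G) hτ (HomotopyGroup.mk_eq_iff.1 ?_)
    rw [hxy, ← hx, ← hy, HomotopyGroup.mk_mul_mk_eq_pmul]
    congr 1
    ext t
    rfl

theorem traceInvariant_mk (τ : A →L[ℝ] ℝ) (hτ : ∀ x y, τ (x * y) = τ (y * x))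
    (F : SmoothLoop A) : traceInvariant τ hτ (HomotopyGroup.mk F.toGenLoop) =
      Multiplicative.ofAdd (traceIntegral τ F.toFun) :=
  congrArg Multiplicative.ofAdd (SmoothLoop.traceIntegral_eq hτ
    (HomotopyGroup.mk_eq_iff.1 (SmoothLoop.exists_mk_eq _).choose_spec))

end TraceInvariant

section MonoidHomTrace

open scoped ContDiff unitInterval Topology.Homotopy

variable {A B : Type} [NormedRing A] [NormedAlgebra ℝ A] [NormedRing B] [NormedAlgebra ℝ B]

theorem maurerCartan_map {ι : Type} [Fintype ι] [DecidableEq ι] (φ : B →* A)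
    (hφ : ContDiff ℝ ∞ φ) {F : (ι → ℝ) → B} {t : ι → ℝ} (hF : DifferentiableAt ℝ F t)
    (hu : IsUnit (F t)) (i : ι) :
    maurerCartan (fun s => φ (F s)) i t = fderiv ℝ φ 1 (maurerCartan F i t) := by
  obtain ⟨u, hu⟩ := hu
  have hd : Differentiable ℝ φ := hφ.differentiable (by simp)
  have h0 := hasDerivAt_pderivAt hF i
  have h1 : HasDerivAt (fun r : ℝ => φ (u⁻¹.val * F (t + r • Pi.single i (1 : ℝ))))
      (fderiv ℝ φ 1 (u⁻¹.val * pderivAt i F t)) 0 := by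
    refine HasFDerivAt.comp_hasDerivAt (0 : ℝ) ?_ (h0.const_mul u⁻¹.val)
    simpa [← hu] using (hd 1).hasFDerivAt
  have h2 := hasDerivAt_pderivAt (f := fun s => φ (F s)) ((hd _).comp t hF) i
  have h3 := h2.const_mul (φ u⁻¹.val)
  simp only [← map_mul] at h3
  rw [maurerCartan, maurerCartan, ← hu, Ring.inverse_unit, ← h3.unique h1, ← Units.coe_map,
    Ring.inverse_unit, ← map_inv, Units.coe_map]

/-- The image of a smooth loop under a smooth homomorphism. -/
def SmoothLoop.map (φ : B →* A) (hφ : ContDiff ℝ ∞ φ) (F : SmoothLoop B) : SmoothLoop A where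
  toFun t := φ (F.toFun t)
  smooth := hφ.comp F.smooth
  isUnit t ht := (F.isUnit t ht).map φ
  boundary t i h := by rw [F.boundary t i h, map_one]

theorem SmoothLoop.map_toGenLoop [CompleteSpace A] [CompleteSpace B] (φ : B →* A)
    (hφ : ContDiff ℝ ∞ φ) (F : SmoothLoop B) :
    GenLoop.map (Units.map φ) (Continuous.units_map φ hφ.continuous) (map_one _) F.toGenLoop =
      (F.map φ hφ).toGenLoop := by
  ext t
  rfl

theorem SmoothLoop.traceIntegral_map (τ : A →L[ℝ] ℝ) (φ : B →* A) (hφ : ContDiff ℝ ∞ φ)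
    (F : SmoothLoop B) : traceIntegral τ (F.map φ hφ).toFun =
      ∫ t in Set.Icc (0 : Fin 3 → ℝ) 1, traceTriple τ (fderiv ℝ φ 1 (maurerCartan F.toFun 0 t))
        (fderiv ℝ φ 1 (maurerCartan F.toFun 1 t)) (fderiv ℝ φ 1 (maurerCartan F.toFun 2 t)) :=
  MeasureTheory.setIntegral_congr_fun measurableSet_Icc fun t ht => by
    have h := maurerCartan_map φ hφ (F.smooth.differentiable (by simp) t) (F.isUnit t ht)
    change traceTriple τ (maurerCartan (fun s => φ (F.toFun s)) 0 t) _ _ = _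
    rw [h]
    congr 1 <;> exact h _

theorem fderiv_one_eq_of_quadratic {φ : B → A} (hφ : ContDiff ℝ ∞ φ) {p : B} {a b : A}
    (h : ∀ r : ℝ, φ (1 + r • p) = 1 + r • a + r ^ 2 • b) : fderiv ℝ φ 1 p = a := by
  have hl : HasDerivAt (fun r : ℝ => 1 + r • p) p 0 := by
    simpa using ((hasDerivAt_id (0 : ℝ)).smul_const p).const_add 1
  have h1 : HasDerivAt (fun r : ℝ => φ (1 + r • p)) (fderiv ℝ φ 1 p) 0 := by
    refine HasFDerivAt.comp_hasDerivAt (0 : ℝ) ?_ hl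
    simpa using (hφ.differentiable (by simp) 1).hasFDerivAt
  have h2 : HasDerivAt (fun r : ℝ => 1 + r • a + r ^ 2 • b) a 0 := by
    have h3 := (((hasDerivAt_id (0 : ℝ)).smul_const a).const_add 1).fun_add
      ((hasDerivAt_pow 2 (0 : ℝ)).smul_const b)
    simpa using h3
  simp only [h] at h1
  exact h1.unique h2

end MonoidHomTrace

section QuaternionMatrices

open scoped ContDiff Quaternion Matrix.Norms.L2Operator

/-- The real part of the trace. -/
def reTrace : Matrix (Fin 3) (Fin 3) ℂ →L[ℝ] ℝ :=
  LinearMap.toContinuousLinearMap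
    (Complex.reLm ∘ₗ (Matrix.traceLinearMap (Fin 3) ℝ ℂ))

theorem reTrace_apply (x : Matrix (Fin 3) (Fin 3) ℂ) : reTrace x = x.trace.re := rfl

theorem reTrace_mul_comm (x y : Matrix (Fin 3) (Fin 3) ℂ) : reTrace (x * y) = reTrace (y * x) := by
  rw [reTrace_apply, reTrace_apply, Matrix.trace_mul_comm]

theorem contDiff_matrix {E : Type} [NormedAddCommGroup E] [NormedSpace ℝ E]
    {f : E → Matrix (Fin 3) (Fin 3) ℂ} :
    ContDiff ℝ ∞ f ↔ ∀ i j, ContDiff ℝ ∞ fun x => f x i j := by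
  let e : Matrix (Fin 3) (Fin 3) ℂ ≃L[ℝ] (Fin 3 → Fin 3 → ℂ) :=
    LinearEquiv.toContinuousLinearEquiv (Matrix.ofLinearEquiv ℝ).symm
  rw [← e.comp_contDiff_iff, contDiff_pi]
  simp only [contDiff_pi]
  rfl

theorem contDiff_quaternion_coord :
    ContDiff ℝ ∞ (fun q : ℍ[ℝ] => q.re) ∧ ContDiff ℝ ∞ (fun q : ℍ[ℝ] => q.imI) ∧
      ContDiff ℝ ∞ (fun q : ℍ[ℝ] => q.imJ) ∧ ContDiff ℝ ∞ (fun q : ℍ[ℝ] => q.imK) := by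
  have h : ∀ i : Fin 4, ContDiff ℝ ∞ fun q : ℍ[ℝ] => Quaternion.linearIsometryEquivTuple q i :=
    contDiff_euclidean.1 Quaternion.linearIsometryEquivTuple.contDiff
  exact ⟨h 0, h 1, h 2, h 3⟩

theorem ContDiff.complexMk {E : Type} [NormedAddCommGroup E] [NormedSpace ℝ E] {f g : E → ℝ}
    (hf : ContDiff ℝ ∞ f) (hg : ContDiff ℝ ∞ g) : ContDiff ℝ ∞ fun x => (⟨f x, g x⟩ : ℂ) :=
  Complex.equivRealProdCLM.symm.contDiff.comp (hf.prodMk hg)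

/-- The embedding `1 ⊕ SU(2)`, extended to all quaternions. -/
def quaternionBlock : ℍ[ℝ] →* Matrix (Fin 3) (Fin 3) ℂ where
  toFun q := !![1, 0, 0; 0, ⟨q.re, q.imI⟩, ⟨q.imJ, q.imK⟩; 0, ⟨-q.imJ, q.imK⟩, ⟨q.re, -q.imI⟩]
  map_one' := by
    ext i j
    fin_cases i <;> fin_cases j <;> simp [Complex.ext_iff]
  map_mul' p q := by
    ext i j
    fin_cases i <;> fin_cases j <;>
      simp [Complex.ext_iff, Matrix.mul_apply, Fin.sum_univ_three] <;> constructor <;> ring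

/-- The real matrix of `x ↦ q x q̄` on purely imaginary quaternions. -/
def quaternionRotationReal : ℍ[ℝ] →* Matrix (Fin 3) (Fin 3) ℝ where
  toFun q := !![q.re ^ 2 + q.imI ^ 2 - q.imJ ^ 2 - q.imK ^ 2,
      2 * (q.imI * q.imJ - q.re * q.imK), 2 * (q.imI * q.imK + q.re * q.imJ);
    2 * (q.imI * q.imJ + q.re * q.imK), q.re ^ 2 - q.imI ^ 2 + q.imJ ^ 2 - q.imK ^ 2,
      2 * (q.imJ * q.imK - q.re * q.imI);
    2 * (q.imI * q.imK - q.re * q.imJ), 2 * (q.imJ * q.imK + q.re * q.imI),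
      q.re ^ 2 - q.imI ^ 2 - q.imJ ^ 2 + q.imK ^ 2]
  map_one' := by
    ext i j
    fin_cases i <;> fin_cases j <;> simp
  map_mul' p q := by
    ext i j
    fin_cases i <;> fin_cases j <;>
      simp [Matrix.mul_apply, Fin.sum_univ_three] <;> ring

/-- The matrix of `x ↦ q x q̄` as a complex matrix. -/
def quaternionRotation : ℍ[ℝ] →* Matrix (Fin 3) (Fin 3) ℂ :=
  (Complex.ofRealHom.mapMatrix.toMonoidHom).comp quaternionRotationReal

theorem contDiff_quaternionBlock : ContDiff ℝ ∞ quaternionBlock := by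
  obtain ⟨h0, h1, h2, h3⟩ := contDiff_quaternion_coord
  refine contDiff_matrix.2 fun i j => ?_
  fin_cases i <;> fin_cases j
  exacts [contDiff_const, contDiff_const, contDiff_const, contDiff_const, h0.complexMk h1,
    h2.complexMk h3, contDiff_const, h2.neg.complexMk h3, h0.complexMk h1.neg]

theorem contDiff_quaternionRotation : ContDiff ℝ ∞ quaternionRotation := by
  obtain ⟨h0, h1, h2, h3⟩ := contDiff_quaternion_coord
  refine contDiff_matrix.2 fun i j => Complex.ofRealCLM.contDiff.comp ?_
  fin_cases i <;> fin_cases j <;> simp [quaternionRotationReal] <;> fun_prop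

theorem fderiv_quaternionBlock (p : ℍ[ℝ]) : fderiv ℝ quaternionBlock 1 p =
    !![0, 0, 0; 0, ⟨p.re, p.imI⟩, ⟨p.imJ, p.imK⟩; 0, ⟨-p.imJ, p.imK⟩, ⟨p.re, -p.imI⟩] := by
  refine fderiv_one_eq_of_quadratic contDiff_quaternionBlock (b := 0) fun r => ?_
  ext i j
  fin_cases i <;> fin_cases j <;> simp [quaternionBlock, Complex.ext_iff]

theorem fderiv_quaternionRotation (p : ℍ[ℝ]) : fderiv ℝ quaternionRotation 1 p =
    Complex.ofRealHom.mapMatrix !![2 * p.re, -(2 * p.imK), 2 * p.imJ;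
      2 * p.imK, 2 * p.re, -(2 * p.imI); -(2 * p.imJ), 2 * p.imI, 2 * p.re] := by
  refine fderiv_one_eq_of_quadratic contDiff_quaternionRotation
    (b := quaternionRotation p) fun r => ?_
  ext i j
  fin_cases i <;> fin_cases j <;>
    simp [quaternionRotation, quaternionRotationReal, Complex.ext_iff, -Complex.ofReal_pow] <;> ring

theorem traceTriple_quaternionBlock (p q r : ℍ[ℝ]) :
    traceTriple reTrace (fderiv ℝ quaternionBlock 1 p) (fderiv ℝ quaternionBlock 1 q)
      (fderiv ℝ quaternionBlock 1 r) = -4 * (p.imI * (q.imJ * r.imK - q.imK * r.imJ) +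
        p.imJ * (q.imK * r.imI - q.imI * r.imK) + p.imK * (q.imI * r.imJ - q.imJ * r.imI)) := by
  simp [traceTriple, reTrace_apply, fderiv_quaternionBlock, Matrix.trace_fin_three]
  ring

theorem traceTriple_quaternionRotation (p q r : ℍ[ℝ]) :
    traceTriple reTrace (fderiv ℝ quaternionRotation 1 p) (fderiv ℝ quaternionRotation 1 q)
      (fderiv ℝ quaternionRotation 1 r) = 4 * traceTriple reTrace (fderiv ℝ quaternionBlock 1 p)
        (fderiv ℝ quaternionBlock 1 q) (fderiv ℝ quaternionBlock 1 r) := by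
  rw [traceTriple_quaternionBlock]
  simp [traceTriple, reTrace_apply, fderiv_quaternionRotation, Matrix.trace_fin_three,
    Matrix.mul_apply, Fin.sum_univ_three]
  ring

end QuaternionMatrices

section QuaternionTrace

open scoped ContDiff Quaternion Matrix.Norms.L2Operator unitInterval Topology.Homotopy

/-- The third homotopy group of the units of the quaternions mapped to the reals through a
representation on `ℂ³`. -/
def quaternionTrace (φ : ℍ[ℝ] →* Matrix (Fin 3) (Fin 3) ℂ) (hφ : Continuous φ) :
    HomotopyGroup (Fin 3) ℍ[ℝ]ˣ 1 →* Multiplicative ℝ :=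
  (traceInvariant reTrace reTrace_mul_comm).comp
    (HomotopyGroup.map (Units.map φ) (Continuous.units_map φ hφ) (map_one _))

theorem quaternionTrace_mk (φ : ℍ[ℝ] →* Matrix (Fin 3) (Fin 3) ℂ) (hφ : ContDiff ℝ ∞ φ)
    (F : SmoothLoop ℍ[ℝ]) : quaternionTrace φ hφ.continuous (HomotopyGroup.mk F.toGenLoop) =
      Multiplicative.ofAdd (∫ t in Set.Icc (0 : Fin 3 → ℝ) 1,
        traceTriple reTrace (fderiv ℝ φ 1 (maurerCartan F.toFun 0 t))
        (fderiv ℝ φ 1 (maurerCartan F.toFun 1 t)) (fderiv ℝ φ 1 (maurerCartan F.toFun 2 t))) := by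
  rw [quaternionTrace, MonoidHom.comp_apply, HomotopyGroup.map_mk, SmoothLoop.map_toGenLoop φ hφ,
    traceInvariant_mk, SmoothLoop.traceIntegral_map]

theorem quaternionTrace_rotation (z : HomotopyGroup (Fin 3) ℍ[ℝ]ˣ 1) :
    quaternionTrace quaternionRotation contDiff_quaternionRotation.continuous z =
      quaternionTrace quaternionBlock contDiff_quaternionBlock.continuous z ^ 4 := by
  obtain ⟨F, rfl⟩ := SmoothLoop.exists_mk_eq z
  rw [quaternionTrace_mk _ contDiff_quaternionRotation,
    quaternionTrace_mk _ contDiff_quaternionBlock, ← ofAdd_nsmul]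
  simp only [traceTriple_quaternionRotation]
  rw [MeasureTheory.integral_const_mul]
  simp

/-- A bump function on the unit cube, in centred coordinates. -/
def cubeBump (t : Fin 3 → ℝ) : ℝ :=
  (1 - (2 * t 0 - 1) ^ 2) * (1 - (2 * t 1 - 1) ^ 2) * (1 - (2 * t 2 - 1) ^ 2)

/-- Three quarters of the differential of the bump function. -/
def cubeBumpDeriv (i : Fin 3) (t : Fin 3 → ℝ) : ℝ :=
  -4 * (2 * t i - 1) * ![(1 - (2 * t 1 - 1) ^ 2) * (1 - (2 * t 2 - 1) ^ 2),
    (1 - (2 * t 0 - 1) ^ 2) * (1 - (2 * t 2 - 1) ^ 2),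
    (1 - (2 * t 0 - 1) ^ 2) * (1 - (2 * t 1 - 1) ^ 2)] i

/-- The direction of `cubeWrap - 1`. -/
def cubeRadial (t : Fin 3 → ℝ) : ℍ[ℝ] := ⟨-2, 2 * t 0 - 1, 2 * t 1 - 1, 2 * t 2 - 1⟩

/-- The partial derivatives of `cubeRadial`. -/
def cubeFrame : Fin 3 → ℍ[ℝ] := ![⟨0, 2, 0, 0⟩, ⟨0, 0, 2, 0⟩, ⟨0, 0, 0, 2⟩]

@[simp] theorem cubeRadial_coord (t : Fin 3 → ℝ) : (cubeRadial t).re = -2 ∧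
    (cubeRadial t).imI = 2 * t 0 - 1 ∧ (cubeRadial t).imJ = 2 * t 1 - 1 ∧
    (cubeRadial t).imK = 2 * t 2 - 1 := ⟨rfl, rfl, rfl, rfl⟩

@[simp] theorem cubeFrame_coord : (∀ i, (cubeFrame i).re = 0) ∧
    (cubeFrame 0).imI = 2 ∧ (cubeFrame 0).imJ = 0 ∧ (cubeFrame 0).imK = 0 ∧
    (cubeFrame 1).imI = 0 ∧ (cubeFrame 1).imJ = 2 ∧ (cubeFrame 1).imK = 0 ∧
    (cubeFrame 2).imI = 0 ∧ (cubeFrame 2).imJ = 0 ∧ (cubeFrame 2).imK = 2 := by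
  refine ⟨fun i => ?_, rfl, rfl, rfl, rfl, rfl, rfl, rfl, rfl, rfl⟩
  fin_cases i <;> rfl

/-- An explicit map from the cube to the nonzero quaternions, of degree one up to sign. -/
def cubeWrap (t : Fin 3 → ℝ) : ℍ[ℝ] :=
  1 + cubeBump t • cubeRadial t

theorem contDiff_cubeBump : ContDiff ℝ ∞ cubeBump := by
  unfold cubeBump
  fun_prop

theorem contDiff_cubeWrap : ContDiff ℝ ∞ cubeWrap := by
  have h : ContDiff ℝ ∞ fun t => Quaternion.linearIsometryEquivTuple (cubeWrap t) := by
    refine contDiff_euclidean.2 fun i => ?_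
    have := contDiff_cubeBump
    fin_cases i <;> simp [cubeWrap] <;> fun_prop
  convert Quaternion.linearIsometryEquivTuple.symm.contDiff.comp h using 1
  ext1 t
  exact (Quaternion.linearIsometryEquivTuple.symm_apply_apply _).symm

theorem pderivAt_cubeWrap (i : Fin 3) (t : Fin 3 → ℝ) : pderivAt i cubeWrap t =
    cubeBumpDeriv i t • cubeRadial t +
      cubeBump t • cubeFrame i := by
  have h1 := hasDerivAt_pderivAt (contDiff_cubeWrap.differentiable (by simp) t) i
  refine h1.unique ?_
  have hw : HasDerivAt (fun r : ℝ => cubeBump (t + r • Pi.single i (1 : ℝ)))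
      (cubeBumpDeriv i t) 0 := by
    have hx : ∀ a : ℝ, HasDerivAt (fun r : ℝ => 1 - (2 * (a + r) - 1) ^ 2) (-4 * (2 * a - 1)) 0 := by
      intro a
      have := (((((hasDerivAt_id (0 : ℝ)).const_add a).const_mul 2).sub_const 1).pow 2).const_sub 1
      refine this.congr_deriv ?_
      simp only [id, Nat.cast_ofNat]
      ring
    have hs : ∀ r : ℝ, cubeBump (t + r • Pi.single i (1 : ℝ)) = (1 - (2 * (t i + r) - 1) ^ 2) *
        ![(1 - (2 * t 1 - 1) ^ 2) * (1 - (2 * t 2 - 1) ^ 2),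
          (1 - (2 * t 0 - 1) ^ 2) * (1 - (2 * t 2 - 1) ^ 2),
          (1 - (2 * t 0 - 1) ^ 2) * (1 - (2 * t 1 - 1) ^ 2)] i := fun r => by
      fin_cases i <;> simp [cubeBump] <;> ring
    simp only [hs]
    exact (hx (t i)).mul_const _
  have hP : HasDerivAt (fun r : ℝ => cubeRadial t + r • cubeFrame i) (cubeFrame i) 0 := by
    simpa using ((hasDerivAt_id (0 : ℝ)).smul_const (cubeFrame i)).const_add (cubeRadial t)
  have hR : ∀ r : ℝ, cubeRadial (t + r • Pi.single i (1 : ℝ)) = cubeRadial t + r • cubeFrame i :=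
    fun r => by fin_cases i <;> ext <;> simp <;> ring
  simp only [cubeWrap, hR]
  refine ((hw.fun_smul hP).const_add 1).congr_deriv ?_
  simp [add_comm]

/-- The determinant of four quaternions. -/
def quaternionDet (q a b c : ℍ[ℝ]) : ℝ :=
  q.re * (a.imI * (b.imJ * c.imK - b.imK * c.imJ) + a.imJ * (b.imK * c.imI - b.imI * c.imK) +
      a.imK * (b.imI * c.imJ - b.imJ * c.imI)) -
    q.imI * (a.re * (b.imJ * c.imK - b.imK * c.imJ) + a.imJ * (b.imK * c.re - b.re * c.imK) +
      a.imK * (b.re * c.imJ - b.imJ * c.re)) +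
    q.imJ * (a.re * (b.imI * c.imK - b.imK * c.imI) + a.imI * (b.imK * c.re - b.re * c.imK) +
      a.imK * (b.re * c.imI - b.imI * c.re)) -
    q.imK * (a.re * (b.imI * c.imJ - b.imJ * c.imI) + a.imI * (b.imJ * c.re - b.re * c.imJ) +
      a.imJ * (b.re * c.imI - b.imI * c.re))

theorem traceTriple_inv_mul {q : ℍ[ℝ]} (hq : q ≠ 0) (a b c : ℍ[ℝ]) :
    traceTriple reTrace (fderiv ℝ quaternionBlock 1 (q⁻¹ * a))
      (fderiv ℝ quaternionBlock 1 (q⁻¹ * b)) (fderiv ℝ quaternionBlock 1 (q⁻¹ * c)) =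
    -4 / Quaternion.normSq q ^ 2 * quaternionDet q a b c := by
  have hn : Quaternion.normSq q ≠ 0 := Quaternion.normSq_ne_zero.2 hq
  have h : ∀ x y z : ℍ[ℝ], (star q * x).imI * ((star q * y).imJ * (star q * z).imK -
      (star q * y).imK * (star q * z).imJ) + (star q * x).imJ * ((star q * y).imK *
      (star q * z).imI - (star q * y).imI * (star q * z).imK) + (star q * x).imK *
      ((star q * y).imI * (star q * z).imJ - (star q * y).imJ * (star q * z).imI) =
      Quaternion.normSq q * quaternionDet q x y z := fun x y z => by
    simp only [Quaternion.imI_mul, Quaternion.imJ_mul, Quaternion.imK_mul, Quaternion.re_star,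
      Quaternion.imI_star, Quaternion.imJ_star, Quaternion.imK_star, Quaternion.normSq_def',
      quaternionDet]
    ring
  have hinv : q⁻¹ = (Quaternion.normSq q)⁻¹ • star q := rfl
  rw [traceTriple_quaternionBlock, hinv]
  simp only [smul_mul_assoc, Quaternion.imI_smul, Quaternion.imJ_smul, Quaternion.imK_smul,
    smul_eq_mul]
  have h' := h a b c
  set n := Quaternion.normSq q
  field_simp
  linear_combination -h'

theorem quaternionDet_cubeWrap (t : Fin 3 → ℝ) :
    quaternionDet (cubeWrap t) (pderivAt 0 cubeWrap t) (pderivAt 1 cubeWrap t)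
      (pderivAt 2 cubeWrap t) = 8 * cubeBump t ^ 3 * (1 - 2 * cubeBump t) +
      4 * cubeBump t ^ 2 * (cubeBumpDeriv 0 t * (2 * t 0 - 1) + cubeBumpDeriv 1 t * (2 * t 1 - 1) +
        cubeBumpDeriv 2 t * (2 * t 2 - 1)) := by
  simp only [pderivAt_cubeWrap, quaternionDet, cubeWrap]
  generalize cubeBump t = w
  generalize cubeBumpDeriv 0 t = g0
  generalize cubeBumpDeriv 1 t = g1
  generalize cubeBumpDeriv 2 t = g2
  simp
  ring

theorem cubeBump_inequality {a b c : ℝ} (ha : 0 ≤ a) (hb : 0 ≤ b) (hc : 0 ≤ c) (ha' : a < 1)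
    (hb' : b < 1) (hc' : c < 1) : 0 < (1 - a) * (1 - b) * (1 - c) ∧
    (1 - a) * (1 - b) * (1 - c) * (1 - 2 * ((1 - a) * (1 - b) * (1 - c))) <
      2 * (a * ((1 - b) * (1 - c)) + b * ((1 - a) * (1 - c)) + c * ((1 - a) * (1 - b))) := by
  have hA : 0 < 1 - a := by linarith
  have hB : 0 < 1 - b := by linarith
  have hC : 0 < 1 - c := by linarith
  have hw : 0 < (1 - a) * (1 - b) * (1 - c) := by positivity
  refine ⟨hw, ?_⟩
  have h1 : 1 - (1 - a) * (1 - b) * (1 - c) ≤ a + b + c := by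
    nlinarith [mul_nonneg ha hb, mul_nonneg hb hc, mul_nonneg ha hc, mul_nonneg (mul_nonneg ha hb) hC.le]
  have h2 : (1 - a) * (1 - b) * (1 - c) * (a + b + c) ≤
      a * ((1 - b) * (1 - c)) + b * ((1 - a) * (1 - c)) + c * ((1 - a) * (1 - b)) := by
    nlinarith [mul_nonneg (mul_nonneg ha ha) (mul_pos hB hC).le,
      mul_nonneg (mul_nonneg hb hb) (mul_pos hA hC).le,
      mul_nonneg (mul_nonneg hc hc) (mul_pos hA hB).le]
  nlinarith [mul_le_mul_of_nonneg_left h1 hw.le]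

theorem cubeBump_eq_zero {t : Fin 3 → ℝ} {i : Fin 3} (h : t i = 0 ∨ t i = 1) :
    cubeBump t = 0 := by
  rcases h with h | h <;> fin_cases i <;> simp at h <;> simp [cubeBump, h] <;> norm_num

theorem cubeWrap_ne_zero (t : Fin 3 → ℝ) : cubeWrap t ≠ 0 := by
  intro h
  have h0 := congrArg QuaternionAlgebra.re h
  have h1 := congrArg QuaternionAlgebra.imI h
  have h2 := congrArg QuaternionAlgebra.imJ h
  have h3 := congrArg QuaternionAlgebra.imK h
  simp only [cubeWrap, cubeRadial_coord, Quaternion.re_add, Quaternion.imI_add, Quaternion.imJ_add,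
    Quaternion.imK_add, Quaternion.re_one, Quaternion.imI_one, Quaternion.imJ_one,
    Quaternion.imK_one, Quaternion.re_smul, Quaternion.imI_smul, Quaternion.imJ_smul,
    Quaternion.imK_smul, smul_eq_mul, zero_add, Quaternion.re_zero, Quaternion.imI_zero,
    Quaternion.imJ_zero, Quaternion.imK_zero] at h0 h1 h2 h3
  have hw : cubeBump t ≠ 0 := fun hw => by rw [hw] at h0; norm_num at h0
  have e1 := (mul_eq_zero.1 h1).resolve_left hw
  have e2 := (mul_eq_zero.1 h2).resolve_left hw
  have e3 := (mul_eq_zero.1 h3).resolve_left hw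
  rw [cubeBump, e1, e2, e3] at h0
  norm_num at h0

/-- `cubeWrap` as a smooth loop. -/
def wrapLoop : SmoothLoop ℍ[ℝ] where
  toFun := cubeWrap
  smooth := contDiff_cubeWrap
  isUnit t _ := (cubeWrap_ne_zero t).isUnit
  boundary t i h := by rw [cubeWrap, cubeBump_eq_zero h, zero_smul, add_zero]

theorem traceTriple_wrapLoop (t : Fin 3 → ℝ) :
    traceTriple reTrace (fderiv ℝ quaternionBlock 1 (maurerCartan cubeWrap 0 t))
      (fderiv ℝ quaternionBlock 1 (maurerCartan cubeWrap 1 t))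
      (fderiv ℝ quaternionBlock 1 (maurerCartan cubeWrap 2 t)) =
    32 / Quaternion.normSq (cubeWrap t) ^ 2 * cubeBump t ^ 2 *
      (2 * ((2 * t 0 - 1) ^ 2 * ((1 - (2 * t 1 - 1) ^ 2) * (1 - (2 * t 2 - 1) ^ 2)) +
        (2 * t 1 - 1) ^ 2 * ((1 - (2 * t 0 - 1) ^ 2) * (1 - (2 * t 2 - 1) ^ 2)) +
        (2 * t 2 - 1) ^ 2 * ((1 - (2 * t 0 - 1) ^ 2) * (1 - (2 * t 1 - 1) ^ 2))) -
        cubeBump t * (1 - 2 * cubeBump t)) := by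
  simp only [maurerCartan, Ring.inverse_eq_inv']
  rw [traceTriple_inv_mul (cubeWrap_ne_zero t), quaternionDet_cubeWrap]
  simp [cubeBumpDeriv]
  ring

theorem traceTriple_wrapLoop_pos {t : Fin 3 → ℝ} (ht : ∀ i, t i ∈ Set.Ioo (0 : ℝ) 1) :
    0 < traceTriple reTrace (fderiv ℝ quaternionBlock 1 (maurerCartan cubeWrap 0 t))
      (fderiv ℝ quaternionBlock 1 (maurerCartan cubeWrap 1 t))
      (fderiv ℝ quaternionBlock 1 (maurerCartan cubeWrap 2 t)) := by
  have h : ∀ i, (2 * t i - 1) ^ 2 < 1 := fun i => by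
    obtain ⟨h0, h1⟩ := ht i
    nlinarith
  obtain ⟨h1, h2⟩ := cubeBump_inequality (sq_nonneg (2 * t 0 - 1)) (sq_nonneg (2 * t 1 - 1))
    (sq_nonneg (2 * t 2 - 1)) (h 0) (h 1) (h 2)
  have hn : 0 < Quaternion.normSq (cubeWrap t) :=
    lt_of_le_of_ne Quaternion.normSq_nonneg (Quaternion.normSq_ne_zero.2 (cubeWrap_ne_zero t)).symm
  rw [traceTriple_wrapLoop]
  have h1' : 0 < cubeBump t := h1
  refine mul_pos (by positivity) ?_
  rw [cubeBump]
  linarith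

theorem quaternionTrace_wrapLoop :
    quaternionTrace quaternionBlock contDiff_quaternionBlock.continuous
      (HomotopyGroup.mk wrapLoop.toGenLoop) ≠ 1 := by
  rw [quaternionTrace_mk _ contDiff_quaternionBlock, ne_eq, ofAdd_eq_one]
  apply ne_of_gt
  have hT : ∀ i t, ContDiffAt ℝ ∞ (fun s => fderiv ℝ quaternionBlock 1
      (maurerCartan cubeWrap i s)) t := fun i t =>
    (fderiv ℝ quaternionBlock 1).contDiff.contDiffAt.comp t
      (contDiffAt_maurerCartan contDiff_cubeWrap.contDiffAt (cubeWrap_ne_zero t).isUnit i)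
  have hc : Continuous fun t => traceTriple reTrace
      (fderiv ℝ quaternionBlock 1 (maurerCartan cubeWrap 0 t))
      (fderiv ℝ quaternionBlock 1 (maurerCartan cubeWrap 1 t))
      (fderiv ℝ quaternionBlock 1 (maurerCartan cubeWrap 2 t)) :=
    continuous_iff_continuousAt.2 fun t =>
      (contDiffAt_traceTriple reTrace (hT 0 t) (hT 1 t) (hT 2 t)).continuousAt
  have hIoo : Set.univ.pi (fun _ : Fin 3 => Set.Ioo (0 : ℝ) 1) ⊆ Set.Icc (0 : Fin 3 → ℝ) 1 :=
    fun t ht => ⟨fun i => (ht i trivial).1.le, fun i => (ht i trivial).2.le⟩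
  have hae : (Set.univ.pi fun _ : Fin 3 => Set.Ioo (0 : ℝ) 1) =ᵐ[MeasureTheory.volume]
      Set.Icc (0 : Fin 3 → ℝ) 1 := MeasureTheory.Measure.univ_pi_Ioo_ae_eq_Icc
  change 0 < ∫ t in Set.Icc (0 : Fin 3 → ℝ) 1, traceTriple reTrace
      (fderiv ℝ quaternionBlock 1 (maurerCartan cubeWrap 0 t))
      (fderiv ℝ quaternionBlock 1 (maurerCartan cubeWrap 1 t))
      (fderiv ℝ quaternionBlock 1 (maurerCartan cubeWrap 2 t))
  have hi := hc.continuousOn.integrableOn_compact (μ := MeasureTheory.volume)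
    (isCompact_Icc (a := (0 : Fin 3 → ℝ)) (b := 1))
  have ho : IsOpen (Set.univ.pi fun _ : Fin 3 => Set.Ioo (0 : ℝ) 1) :=
    isOpen_set_pi Set.finite_univ fun _ _ => isOpen_Ioo
  rw [← MeasureTheory.setIntegral_congr_set hae,
    MeasureTheory.setIntegral_pos_iff_support_of_nonneg_ae]
  · refine (ho.measure_pos _ ⟨fun _ => 1 / 2, fun i _ => by norm_num⟩).trans_le
      (MeasureTheory.measure_mono fun t ht => ⟨?_, ht⟩)
    exact (traceTriple_wrapLoop_pos fun i => ht i trivial).ne'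
  · exact MeasureTheory.ae_restrict_of_forall_mem ho.measurableSet fun t ht =>
      (traceTriple_wrapLoop_pos fun i => ht i trivial).le
  · exact hi.mono_set hIoo

end QuaternionTrace

section SpecialUnitary

open scoped Quaternion unitInterval Topology.Homotopy

/-- The underlying matrix of an element of `SU(n)`. -/
def SU.toMatrix {n : ℕ} : SU n →* Matrix (Fin n) (Fin n) ℂ :=
  (Matrix.unitaryGroup (Fin n) ℂ).subtype.comp (SU n).subtype

variable {n : ℕ}

theorem SU.toMatrix_injective : Function.Injective (SU.toMatrix (n := n)) := fun _ _ h =>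
  Subtype.ext (Subtype.ext h)

theorem SU.continuous_iff {Y : Type} [TopologicalSpace Y] {f : Y → SU n} :
    Continuous f ↔ Continuous fun y => SU.toMatrix (f y) := by
  rw [Topology.IsInducing.subtypeVal.continuous_iff, Topology.IsInducing.subtypeVal.continuous_iff]
  rfl

theorem SU.continuous_toMatrix : Continuous (SU.toMatrix (n := n)) :=
  SU.continuous_iff.1 continuous_id

theorem SU.mul_star (A : SU n) : SU.toMatrix A * star (SU.toMatrix A) = 1 :=
  Unitary.coe_mul_star_self (A : Matrix.unitaryGroup (Fin n) ℂ)

theorem SU.star_mul (A : SU n) : star (SU.toMatrix A) * SU.toMatrix A = 1 :=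
  Unitary.coe_star_mul_self (A : Matrix.unitaryGroup (Fin n) ℂ)

theorem SU.toMatrix_inv (A : SU n) : SU.toMatrix A⁻¹ = star (SU.toMatrix A) := rfl

theorem SU.det (A : SU n) : (SU.toMatrix A).det = 1 := A.2

/-- Constructor for elements of `SU(n)`. -/
def SU.mk (M : Matrix (Fin n) (Fin n) ℂ) (h : M * star M = 1) (hd : M.det = 1) : SU n :=
  ⟨⟨M, Matrix.mem_unitaryGroup_iff.2 h⟩, hd⟩

@[simp] theorem SU.toMatrix_mk (M : Matrix (Fin n) (Fin n) ℂ) (h : M * star M = 1)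
    (hd : M.det = 1) : SU.toMatrix (SU.mk M h hd) = M := rfl

theorem mem_SOinSU_iff {A : SU n} :
    A ∈ SOinSU n ↔ ∃ B : Matrix (Fin n) (Fin n) ℝ, SU.toMatrix A = B.map Complex.ofReal := Iff.rfl

theorem star_mul_self_of_mem_sphere (q : Metric.sphere (0 : ℍ[ℝ]) 1) :
    (q : ℍ[ℝ]) * star (q : ℍ[ℝ]) = 1 := by
  rw [Quaternion.self_mul_star, Quaternion.normSq_eq_norm_mul_self, norm_eq_of_mem_sphere]
  simp

theorem sq_add_of_mem_sphere (q : Metric.sphere (0 : ℍ[ℝ]) 1) : (q : ℍ[ℝ]).re ^ 2 +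
    (q : ℍ[ℝ]).imI ^ 2 + (q : ℍ[ℝ]).imJ ^ 2 + (q : ℍ[ℝ]).imK ^ 2 = 1 := by
  rw [← Quaternion.normSq_def', Quaternion.normSq_eq_norm_mul_self, norm_eq_of_mem_sphere, mul_one]

/-- A `*`-representation of the quaternions as a homomorphism from the unit quaternions
to `SU(3)`. -/
def SU.ofQuaternion (φ : ℍ[ℝ] →* Matrix (Fin 3) (Fin 3) ℂ) (hs : ∀ q, star (φ q) = φ (star q))
    (hd : ∀ q : Metric.sphere (0 : ℍ[ℝ]) 1, (φ q).det = 1) : Metric.sphere (0 : ℍ[ℝ]) 1 →* SU 3 :=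
  MonoidHom.mk' (fun q => SU.mk (φ q)
    (by rw [hs, ← map_mul, star_mul_self_of_mem_sphere, map_one]) (hd q))
    fun p q => SU.toMatrix_injective (map_mul φ (p : ℍ[ℝ]) q)

/-- The inclusion of the unit quaternions as `SU(2) ⊆ SU(3)`. -/
def blockSU : Metric.sphere (0 : ℍ[ℝ]) 1 →* SU 3 :=
  SU.ofQuaternion quaternionBlock
    (fun q => by
      ext i j
      fin_cases i <;> fin_cases j <;> simp [quaternionBlock, Complex.ext_iff])
    (fun q => by
      have h := sq_add_of_mem_sphere q
      simp [quaternionBlock, Matrix.det_fin_three, Complex.ext_iff]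
      constructor
      · linear_combination h
      · ring)

/-- The rotation representation of the unit quaternions. -/
def rotationSU : Metric.sphere (0 : ℍ[ℝ]) 1 →* SU 3 :=
  SU.ofQuaternion quaternionRotation
    (fun q => by
      ext i j
      fin_cases i <;> fin_cases j <;>
        simp [quaternionRotation, quaternionRotationReal, Complex.ext_iff] <;> ring)
    (fun q => by
      have h := sq_add_of_mem_sphere q
      have h' : (quaternionRotationReal q).det = ((q : ℍ[ℝ]).re ^ 2 +
          (q : ℍ[ℝ]).imI ^ 2 + (q : ℍ[ℝ]).imJ ^ 2 + (q : ℍ[ℝ]).imK ^ 2) ^ 3 := by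
        simp [quaternionRotationReal, Matrix.det_fin_three]
        ring
      rw [h, one_pow] at h'
      have := RingHom.map_det Complex.ofRealHom (quaternionRotationReal q)
      rw [h', map_one] at this
      exact this.symm)

theorem toMatrix_blockSU (q : Metric.sphere (0 : ℍ[ℝ]) 1) :
    SU.toMatrix (blockSU q) = quaternionBlock q := rfl

theorem toMatrix_rotationSU (q : Metric.sphere (0 : ℍ[ℝ]) 1) :
    SU.toMatrix (rotationSU q) = (quaternionRotationReal q).map Complex.ofReal := rfl

theorem rotationSU_mem (q : Metric.sphere (0 : ℍ[ℝ]) 1) : rotationSU q ∈ SOinSU 3 :=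
  mem_SOinSU_iff.2 ⟨_, toMatrix_rotationSU q⟩

open scoped Matrix.Norms.L2Operator in
theorem continuous_blockSU : Continuous blockSU :=
  SU.continuous_iff.2 (contDiff_quaternionBlock.continuous.comp continuous_subtype_val)

open scoped Matrix.Norms.L2Operator in
theorem continuous_rotationSU : Continuous rotationSU :=
  SU.continuous_iff.2 (contDiff_quaternionRotation.continuous.comp continuous_subtype_val)

section

open scoped Matrix.Norms.L2Operator

/-- The elements of `SU(3)` as invertible matrices. -/
def SU.toUnits : SU 3 →* (Matrix (Fin 3) (Fin 3) ℂ)ˣ := SU.toMatrix.toHomUnits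

theorem SU.continuous_toUnits : Continuous SU.toUnits :=
  continuous_units_iff.2 SU.continuous_toMatrix

/-- The integral of the invariant three-form as a homomorphism on the third homotopy group. -/
def SU.traceHom : HomotopyGroup (Fin 3) (SU 3) 1 →* Multiplicative ℝ :=
  (traceInvariant reTrace reTrace_mul_comm).comp
    (HomotopyGroup.map SU.toUnits SU.continuous_toUnits (map_one _))

theorem continuous_unitSphereToUnits : Continuous (unitSphereToUnits ℍ[ℝ]) :=
  continuous_units_iff.2 continuous_subtype_val

theorem SU.traceHom_map {φ : ℍ[ℝ] →* Matrix (Fin 3) (Fin 3) ℂ} (hφ : Continuous φ)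
    {ψ : Metric.sphere (0 : ℍ[ℝ]) 1 →* SU 3} (hψ : Continuous ψ)
    (h : ∀ q, SU.toMatrix (ψ q) = φ q)
    (z : HomotopyGroup (Fin 3) (Metric.sphere (0 : ℍ[ℝ]) 1) 1) :
    SU.traceHom (HomotopyGroup.map ψ hψ (map_one _) z) = quaternionTrace φ hφ
      (HomotopyGroup.map (unitSphereToUnits ℍ[ℝ]) continuous_unitSphereToUnits (map_one _) z) := by
  obtain ⟨f, rfl⟩ := HomotopyGroup.mk_surjective z
  refine congrArg (fun g => traceInvariant reTrace reTrace_mul_comm (HomotopyGroup.mk g)) ?_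
  ext1 t
  exact Units.ext (h _)

theorem SU.traceHom_rotationSU (z : HomotopyGroup (Fin 3) (Metric.sphere (0 : ℍ[ℝ]) 1) 1) :
    SU.traceHom (HomotopyGroup.map rotationSU continuous_rotationSU (map_one _) z) =
      SU.traceHom (HomotopyGroup.map blockSU continuous_blockSU (map_one _) z) ^ 4 := by
  rw [SU.traceHom_map contDiff_quaternionRotation.continuous continuous_rotationSU fun _ => rfl,
    SU.traceHom_map contDiff_quaternionBlock.continuous continuous_blockSU fun _ => rfl,
    quaternionTrace_rotation]

theorem SU.exists_traceHom_ne_one : ∃ z : HomotopyGroup (Fin 3) (Metric.sphere (0 : ℍ[ℝ]) 1) 1,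
    SU.traceHom (HomotopyGroup.map blockSU continuous_blockSU (map_one _) z) ≠ 1 := by
  have hc : Continuous fun t : Fin 3 → I => cubeWrap (cubeCoe t) :=
    contDiff_cubeWrap.continuous.comp continuous_cubeCoe
  have hb : ∀ t ∈ Cube.boundary (Fin 3), cubeWrap (cubeCoe t) = 1 := fun t ht => by
    have h := congrArg Units.val (GenLoop.bdry wrapLoop.toGenLoop ht)
    exact h
  let f : Ω^ (Fin 3) (Metric.sphere (0 : ℍ[ℝ]) 1) 1 :=
    GenLoop.normalize (fun t => cubeWrap (cubeCoe t)) hc (fun t => cubeWrap_ne_zero _) hb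
  refine ⟨HomotopyGroup.mk f, ?_⟩
  rw [SU.traceHom_map contDiff_quaternionBlock.continuous continuous_blockSU fun _ => rfl,
    HomotopyGroup.map_mk]
  suffices h : HomotopyGroup.mk (GenLoop.map (unitSphereToUnits ℍ[ℝ])
      continuous_unitSphereToUnits (map_one _) f) = HomotopyGroup.mk wrapLoop.toGenLoop by
    rw [h]
    exact quaternionTrace_wrapLoop
  rw [HomotopyGroup.mk_eq_iff]
  let s : I × (Fin 3 → I) → ℝ := fun p =>
    (1 - (p.1 : ℝ)) * ‖cubeWrap (cubeCoe p.2)‖⁻¹ + p.1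
  have hs : ∀ p, 0 < s p := fun p => by
    have h1 : 0 < ‖cubeWrap (cubeCoe p.2)‖⁻¹ := inv_pos.2 (norm_pos_iff.2 (cubeWrap_ne_zero _))
    rcases p.1.2.1.eq_or_lt with h | h
    · simpa [s, ← h] using h1
    · exact add_pos_of_nonneg_of_pos (mul_nonneg (by linarith [p.1.2.2]) h1.le) h
  have hsc : Continuous s := by
    have := hc.norm.inv₀ fun t => norm_ne_zero_iff.2 (cubeWrap_ne_zero (cubeCoe t))
    exact ((continuous_const.sub (by fun_prop)).mul (this.comp continuous_snd)).add (by fun_prop)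
  refine GenLoop.homotopic_of_map (fun p => Units.mk0 (s p • cubeWrap (cubeCoe p.2))
    (smul_ne_zero (hs p).ne' (cubeWrap_ne_zero _))) (continuous_units_iff.2
    (hsc.smul (hc.comp continuous_snd))) (fun t => ?_) (fun t => ?_) (fun r t ht => ?_)
  · apply Units.ext
    simp [s, f, GenLoop.normalize, unitVector]
  · apply Units.ext
    simp [s, SmoothLoop.toGenLoop_coe, wrapLoop]
  · apply Units.ext
    simp [s, hb t ht]

end

end SpecialUnitary

section SphereAction

open scoped Quaternion unitInterval Topology.Homotopy ComplexConjugate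

theorem norm_toLp_mulVec {n : ℕ} (A : SU n) (v : EuclideanSpace ℂ (Fin n)) :
    ‖WithLp.toLp 2 (SU.toMatrix A *ᵥ v.ofLp)‖ = ‖v‖ := by
  have h : ∀ w : EuclideanSpace ℂ (Fin n), ((‖w‖ ^ 2 : ℝ) : ℂ) = star w.ofLp ⬝ᵥ w.ofLp := by
    intro w
    rw [EuclideanSpace.norm_sq_eq]
    simp [dotProduct, ← Complex.conj_mul']
  refine (sq_eq_sq₀ (norm_nonneg _) (norm_nonneg _)).1 (Complex.ofReal_injective ?_)
  rw [h, h, Matrix.star_mulVec, Matrix.dotProduct_mulVec, Matrix.vecMul_vecMul,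
    ← Matrix.star_eq_conjTranspose, SU.star_mul, Matrix.vecMul_one]

instance SU.sphereAction {n : ℕ} :
    MulAction (SU n) (Metric.sphere (0 : EuclideanSpace ℂ (Fin n)) 1) where
  smul A v := ⟨WithLp.toLp 2 (SU.toMatrix A *ᵥ v.1.ofLp), by
    rw [mem_sphere_zero_iff_norm, norm_toLp_mulVec, norm_eq_of_mem_sphere]⟩
  one_smul v := Subtype.ext (by
    change WithLp.toLp 2 (SU.toMatrix 1 *ᵥ v.1.ofLp) = _
    rw [map_one, Matrix.one_mulVec])
  mul_smul A B v := Subtype.ext (by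
    change WithLp.toLp 2 (SU.toMatrix (A * B) *ᵥ v.1.ofLp) =
      WithLp.toLp 2 (SU.toMatrix A *ᵥ (SU.toMatrix B *ᵥ v.1.ofLp))
    rw [map_mul, Matrix.mulVec_mulVec])

theorem SU.coe_smul {n : ℕ} (A : SU n) (v : Metric.sphere (0 : EuclideanSpace ℂ (Fin n)) 1) :
    ((A • v : Metric.sphere (0 : EuclideanSpace ℂ (Fin n)) 1) : EuclideanSpace ℂ (Fin n)) =
      WithLp.toLp 2 (SU.toMatrix A *ᵥ v.1.ofLp) := rfl

instance SU.continuousSMul_sphere {n : ℕ} :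
    ContinuousSMul (SU n) (Metric.sphere (0 : EuclideanSpace ℂ (Fin n)) 1) where
  continuous_smul := by
    refine Continuous.subtype_mk ((PiLp.continuous_toLp 2 _).comp ?_) _
    exact (SU.continuous_toMatrix.comp continuous_fst).matrix_mulVec
      ((PiLp.continuous_ofLp 2 _).comp (continuous_subtype_val.comp continuous_snd))

/-- The first basis vector. -/
def sphereBase : Metric.sphere (0 : EuclideanSpace ℂ (Fin 3)) 1 :=
  ⟨EuclideanSpace.single 0 1, by simp⟩

/-- A matrix with prescribed first column, unitary under suitable conditions. -/
def frameMatrix (a b c r : ℂ) : Matrix (Fin 3) (Fin 3) ℂ :=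
  !![a, -(a * conj b * r), -(conj c * r); b, (1 - b * conj b) * r, 0;
    c, -(c * conj b * r), conj a * r]

theorem frameMatrix_unitary {a b c : ℂ} {r : ℝ} (h : a * conj a + b * conj b + c * conj c = 1)
    (hr : (r : ℂ) ^ 2 * (1 - b * conj b) = 1) :
    frameMatrix a b c r * star (frameMatrix a b c r) = 1 ∧ (frameMatrix a b c r).det = 1 := by
  constructor
  · rw [mul_eq_one_comm]
    ext i j
    fin_cases i <;> fin_cases j <;>
      simp [frameMatrix, Matrix.mul_apply, Fin.sum_univ_three]
    · linear_combination h
    · linear_combination -r * conj b * h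
    · ring
    · linear_combination -r * b * h
    · linear_combination (r : ℂ) ^ 2 * b * conj b * h + hr
    · ring
    · ring
    · ring
    · linear_combination (r : ℂ) ^ 2 * h + hr
  · simp [frameMatrix, Matrix.det_fin_three]
    linear_combination (r : ℂ) ^ 2 * h + hr

theorem sum_mul_conj_of_mem_sphere (v : Metric.sphere (0 : EuclideanSpace ℂ (Fin 3)) 1) :
    v.1 0 * conj (v.1 0) + v.1 1 * conj (v.1 1) + v.1 2 * conj (v.1 2) = 1 := by
  have h := EuclideanSpace.norm_sq_eq v.1
  rw [norm_eq_of_mem_sphere, one_pow, Fin.sum_univ_three] at h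
  simp only [Complex.mul_conj']
  exact_mod_cast h.symm

theorem inv_sqrt_sq_mul {b : ℂ} (hb : ‖b‖ < 1) :
    (((Real.sqrt (1 - ‖b‖ ^ 2))⁻¹ : ℝ) : ℂ) ^ 2 * (1 - b * conj b) = 1 := by
  have h : 0 < 1 - ‖b‖ ^ 2 := by nlinarith [norm_nonneg b]
  rw [Complex.mul_conj', ← Complex.ofReal_pow, inv_pow, Real.sq_sqrt h.le]
  norm_cast
  exact inv_mul_cancel₀ h.ne'

/-- The local section of the action of `SU(3)` on the sphere. -/
def sphereSection (v : Metric.sphere (0 : EuclideanSpace ℂ (Fin 3)) 1) : SU 3 :=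
  if hb : ‖v.1 1‖ < 1 then
    SU.mk (frameMatrix (v.1 0) (v.1 1) (v.1 2) ((Real.sqrt (1 - ‖v.1 1‖ ^ 2))⁻¹ : ℝ))
      (frameMatrix_unitary (sum_mul_conj_of_mem_sphere v) (inv_sqrt_sq_mul hb)).1
      (frameMatrix_unitary (sum_mul_conj_of_mem_sphere v) (inv_sqrt_sq_mul hb)).2
  else 1

theorem toMatrix_sphereSection {v : Metric.sphere (0 : EuclideanSpace ℂ (Fin 3)) 1}
    (hb : ‖v.1 1‖ < 1) : SU.toMatrix (sphereSection v) =
      frameMatrix (v.1 0) (v.1 1) (v.1 2) ((Real.sqrt (1 - ‖v.1 1‖ ^ 2))⁻¹ : ℝ) := by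
  rw [sphereSection, dif_pos hb, SU.toMatrix_mk]

theorem norm_lt_one_of_dist_lt {v : Metric.sphere (0 : EuclideanSpace ℂ (Fin 3)) 1}
    (h : dist sphereBase v < 1) : ‖v.1 1‖ < 1 := by
  refine lt_of_le_of_lt ?_ h
  rw [dist_comm, Subtype.dist_eq, dist_eq_norm]
  have := PiLp.norm_apply_le (v.1 - sphereBase.1) 1
  simpa [sphereBase] using this

/-- The action of `SU(3)` on the sphere has local sections. -/
def sphereLocalSection : LocalSection (SU 3) (Metric.sphere (0 : EuclideanSpace ℂ (Fin 3)) 1)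
    sphereBase where
  d := dist
  continuous_d := continuous_dist
  d_self := dist_self
  d_smul A x y := by
    rw [Subtype.dist_eq, Subtype.dist_eq, dist_eq_norm, dist_eq_norm, SU.coe_smul, SU.coe_smul,
      ← WithLp.toLp_sub, ← Matrix.mulVec_sub]
    exact norm_toLp_mulVec A (x.1 - y.1)
  ε := 1
  ε_pos := one_pos
  sec := sphereSection
  continuousOn_sec := by
    rw [continuousOn_iff_continuous_domRestrict, SU.continuous_iff]
    have hb := fun v : {x | dist sphereBase x < 1} => norm_lt_one_of_dist_lt v.2
    simp only [Set.domRestrict_apply, fun v => toMatrix_sphereSection (hb v)]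
    have hc : ∀ i, Continuous fun v : {x | dist sphereBase x < 1} => v.1.1 i := fun i =>
      (PiLp.continuous_apply 2 _ i).comp (continuous_subtype_val.comp continuous_subtype_val)
    have hr : Continuous fun v : {x | dist sphereBase x < 1} =>
        (((Real.sqrt (1 - ‖v.1.1 1‖ ^ 2))⁻¹ : ℝ) : ℂ) := by
      refine Complex.continuous_ofReal.comp (Continuous.inv₀ ?_ fun v => ?_)
      · exact (continuous_const.sub ((hc 1).norm.pow 2)).sqrt
      · have := hb v
        exact (Real.sqrt_pos.2 (by nlinarith [norm_nonneg (v.1.1 1)])).ne'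
    have h0 := hc 0
    have h1 := hc 1
    have h2 := hc 2
    have hs : ∀ i, Continuous fun v : {x | dist sphereBase x < 1} => conj (v.1.1 i) := fun i =>
      Complex.continuous_conj.comp (hc i)
    refine continuous_matrix fun i j => ?_
    fin_cases i <;> fin_cases j
    exacts [h0, ((h0.mul (hs 1)).mul hr).neg, ((hs 2).mul hr).neg, h1,
      (continuous_const.sub (h1.mul (hs 1))).mul hr, continuous_const, h2,
      ((h2.mul (hs 1)).mul hr).neg, (hs 0).mul hr]
  sec_smul v hv := by
    apply Subtype.ext
    rw [SU.coe_smul, toMatrix_sphereSection (norm_lt_one_of_dist_lt hv)]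
    ext i
    fin_cases i <;> simp [sphereBase, frameMatrix]
  sec_base := by
    apply SU.toMatrix_injective
    rw [toMatrix_sphereSection (by simp [sphereBase]), map_one]
    ext i j
    fin_cases i <;> fin_cases j <;> simp [sphereBase, frameMatrix]

theorem SU.star_eq_adjugate {n : ℕ} (A : SU n) : star (SU.toMatrix A) = adjugate (SU.toMatrix A) := by
  have h := Matrix.mul_adjugate (SU.toMatrix A)
  rw [SU.det, one_smul] at h
  rw [← mul_one (star _), ← h, ← mul_assoc, SU.star_mul, one_mul]

theorem stabilizer_form (A : MulAction.stabilizer (SU 3) sphereBase) :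
    SU.toMatrix A.1 = !![1, 0, 0; 0, SU.toMatrix A.1 1 1, SU.toMatrix A.1 1 2;
      0, -conj (SU.toMatrix A.1 1 2), conj (SU.toMatrix A.1 1 1)] := by
  have h := congrArg (fun v => v.1.ofLp) A.2
  simp only [SU.coe_smul] at h
  have h0 : ∀ i, SU.toMatrix A.1 i 0 = if i = 0 then 1 else 0 := fun i => by
    simpa [sphereBase] using congrFun h i
  have hs := SU.star_eq_adjugate A.1
  have e : ∀ i j, conj (SU.toMatrix A.1 j i) = adjugate (SU.toMatrix A.1) i j := fun i j => by
    rw [← hs]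
    rfl
  have h00 : SU.toMatrix A.1 0 0 = 1 := h0 0
  have h10 : SU.toMatrix A.1 1 0 = 0 := h0 1
  have h20 : SU.toMatrix A.1 2 0 = 0 := h0 2
  have e10 := e 1 0
  have e20 := e 2 0
  have e11 := e 1 1
  have e21 := e 2 1
  simp [Matrix.adjugate_fin_three, h00, h10, h20] at e10 e20 e11 e21
  clear hs e h h0
  ext i j
  fin_cases i <;> fin_cases j <;> simp [*]

/-- The quaternion `z + w j`. -/
def entryQuaternion (z w : ℂ) : ℍ[ℝ] := ⟨z.re, z.im, w.re, w.im⟩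

/-- The unit quaternion corresponding to an element of the stabilizer. -/
def stabilizerQuaternion (A : MulAction.stabilizer (SU 3) sphereBase) :
    Metric.sphere (0 : ℍ[ℝ]) 1 :=
  ⟨entryQuaternion (SU.toMatrix A.1 1 1) (SU.toMatrix A.1 1 2), by
    rw [mem_sphere_zero_iff_norm, ← sq_eq_sq₀ (norm_nonneg _) zero_le_one, sq,
      ← Quaternion.normSq_eq_norm_mul_self, Quaternion.normSq_def']
    have h := congrArg Complex.re (congrFun (congrFun (SU.mul_star A.1) 1) 1)
    rw [stabilizer_form] at h
    simp [Matrix.mul_apply, Fin.sum_univ_three] at h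
    simp only [entryQuaternion]
    linear_combination h⟩

theorem continuous_stabilizerQuaternion : Continuous stabilizerQuaternion := by
  have h : ∀ i j, Continuous fun A : MulAction.stabilizer (SU 3) sphereBase =>
      SU.toMatrix A.1 i j := fun i j =>
    (SU.continuous_toMatrix.comp continuous_subtype_val).matrix_elem i j
  have h' : Continuous fun A => Quaternion.linearIsometryEquivTuple (stabilizerQuaternion A).1 := by
    refine (PiLp.continuous_toLp 2 _).comp (continuous_pi fun i => ?_)
    fin_cases i
    exacts [Complex.continuous_re.comp (h 1 1), Complex.continuous_im.comp (h 1 1),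
      Complex.continuous_re.comp (h 1 2), Complex.continuous_im.comp (h 1 2)]
  exact continuous_induced_rng.2
    (Quaternion.linearIsometryEquivTuple.toHomeomorph.isInducing.continuous_iff.2 h')

theorem blockSU_stabilizerQuaternion (A : MulAction.stabilizer (SU 3) sphereBase) :
    blockSU (stabilizerQuaternion A) = A.1 := by
  apply SU.toMatrix_injective
  rw [stabilizer_form A]
  ext i j
  fin_cases i <;> fin_cases j <;>
    simp [toMatrix_blockSU, quaternionBlock, stabilizerQuaternion, entryQuaternion, Complex.ext_iff]

theorem blockSU_map_surjective : Function.Surjective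
    (HomotopyGroup.map (N := Fin 3) blockSU continuous_blockSU (map_one _)) := by
  refine HomotopyGroup.map_surjective_of _ _ fun f => ?_
  have hE : Module.finrank ℝ (EuclideanSpace ℂ (Fin 3)) = 6 := by
    rw [← Module.finrank_mul_finrank ℝ ℂ]
    simp
  obtain ⟨h, hh⟩ := sphereLocalSection.exists_stabilizer_loop f
    (GenLoop.homotopic_const_of_card_lt (by rw [hE]; simp) _)
  have h1 : stabilizerQuaternion 1 = 1 := by
    apply Subtype.ext
    ext <;> simp [stabilizerQuaternion, entryQuaternion]
  refine ⟨GenLoop.map stabilizerQuaternion continuous_stabilizerQuaternion h1 h, ?_⟩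
  have h2 : GenLoop.map blockSU continuous_blockSU (map_one _)
      (GenLoop.map stabilizerQuaternion continuous_stabilizerQuaternion h1 h) =
      GenLoop.map Subtype.val continuous_subtype_val rfl h := by
    ext1 t
    exact blockSU_stabilizerQuaternion _
  rw [h2]
  exact hh

end SphereAction

section RotationAction

open scoped Quaternion unitInterval Topology.Homotopy

namespace SOinSU

/-- The real matrix underlying an element of `SO(n)`. -/
def toReal {n : ℕ} (A : SOinSU n) : Matrix (Fin n) (Fin n) ℝ := (SU.toMatrix A.1).map Complex.re

variable {n : ℕ}

theorem toMatrix_eq (A : SOinSU n) : SU.toMatrix A.1 = (toReal A).map Complex.ofReal := by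
  obtain ⟨B, hB⟩ := mem_SOinSU_iff.1 A.2
  ext i j
  simp [toReal, hB]

theorem map_ofReal_injective : Function.Injective
    fun M : Matrix (Fin n) (Fin n) ℝ => M.map Complex.ofReal :=
  Matrix.map_injective Complex.ofReal_injective

theorem toReal_injective : Function.Injective (toReal (n := n)) := fun A B h =>
  Subtype.ext (SU.toMatrix_injective (by rw [toMatrix_eq, toMatrix_eq, h]))

theorem toReal_mul (A B : SOinSU n) : toReal (A * B) = toReal A * toReal B := by
  apply map_ofReal_injective
  change (toReal (A * B)).map _ = Complex.ofRealHom.mapMatrix (toReal A * toReal B)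
  rw [← toMatrix_eq, map_mul, Subgroup.coe_mul, map_mul, toMatrix_eq A, toMatrix_eq B]
  rfl

theorem toReal_one : toReal (1 : SOinSU n) = 1 := by
  apply map_ofReal_injective
  change (toReal 1).map _ = Complex.ofRealHom.mapMatrix 1
  rw [← toMatrix_eq, map_one, Subgroup.coe_one, map_one]

theorem toReal_inv (A : SOinSU n) : toReal A⁻¹ = (toReal A)ᵀ := by
  ext i j
  simp [toReal, SU.toMatrix_inv, Matrix.star_apply]

theorem toReal_mul_transpose (A : SOinSU n) : toReal A * (toReal A)ᵀ = 1 := by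
  rw [← toReal_inv, ← toReal_mul, mul_inv_cancel, toReal_one]

theorem transpose_mul_toReal (A : SOinSU n) : (toReal A)ᵀ * toReal A = 1 := by
  rw [← toReal_inv, ← toReal_mul, inv_mul_cancel, toReal_one]

theorem det_toReal (A : SOinSU n) : (toReal A).det = 1 := by
  have h := RingHom.map_det Complex.ofRealHom (toReal A)
  have h' := SU.det A.1
  rw [toMatrix_eq] at h'
  exact Complex.ofReal_injective (h.trans h')

theorem transpose_toReal (A : SOinSU n) : (toReal A)ᵀ = adjugate (toReal A) := by
  have h := Matrix.mul_adjugate (toReal A)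
  rw [det_toReal, one_smul] at h
  rw [← mul_one (toReal A)ᵀ, ← h, ← mul_assoc, transpose_mul_toReal, one_mul]

theorem continuous_toReal : Continuous (toReal (n := n)) :=
  (SU.continuous_toMatrix.comp continuous_subtype_val).matrix_map Complex.continuous_re

end SOinSU

/-- The quaternion `4 (q.re) q` where `q` is the unit quaternion of a rotation matrix. -/
def axisQuaternion (R : Matrix (Fin 3) (Fin 3) ℝ) : ℍ[ℝ] :=
  ⟨1 + R.trace, R 2 1 - R 1 2, R 0 2 - R 2 0, R 1 0 - R 0 1⟩

theorem quaternionRotationReal_axisQuaternion {R : Matrix (Fin 3) (Fin 3) ℝ} (h1 : R * Rᵀ = 1)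
    (h2 : Rᵀ * R = 1) (h3 : Rᵀ = adjugate R) :
    quaternionRotationReal (axisQuaternion R) = (4 * (1 + R.trace)) • R ∧
      Quaternion.normSq (axisQuaternion R) = 4 * (1 + R.trace) := by
  have e1 : ∀ i j, (R * Rᵀ) i j = (1 : Matrix (Fin 3) (Fin 3) ℝ) i j := fun i j => by rw [h1]
  have e2 : ∀ i j, (Rᵀ * R) i j = (1 : Matrix (Fin 3) (Fin 3) ℝ) i j := fun i j => by rw [h2]
  have e3 : ∀ i j, R j i = adjugate R i j := fun i j => by rw [← h3]; rfl
  simp only [Fin.forall_fin_succ, Matrix.mul_apply, Fin.sum_univ_three, Matrix.transpose_apply,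
    Matrix.one_apply, Matrix.adjugate_fin_three] at e1 e2 e3
  simp at e1 e2 e3
  obtain ⟨⟨a1, a2, a3⟩, ⟨a4, a5, a6⟩, a7, a8, a9⟩ := e1
  obtain ⟨⟨b1, b2, b3⟩, ⟨b4, b5, b6⟩, b7, b8, b9⟩ := e2
  obtain ⟨⟨c1, c2, c3⟩, ⟨c4, c5, c6⟩, c7, c8, c9⟩ := e3
  constructor
  · ext i j
    fin_cases i <;> fin_cases j <;>
      simp [quaternionRotationReal, axisQuaternion, Matrix.trace_fin_three] <;> linarith
  · rw [Quaternion.normSq_def']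
    simp only [axisQuaternion, Matrix.trace_fin_three]
    linarith

/-- The double covering of `SO(3)` by the unit quaternions. -/
def rotationSO : Metric.sphere (0 : ℍ[ℝ]) 1 →* SOinSU 3 :=
  rotationSU.codRestrict (SOinSU 3) rotationSU_mem

theorem continuous_rotationSO : Continuous rotationSO :=
  continuous_rotationSU.subtype_mk _

theorem toReal_rotationSO (q : Metric.sphere (0 : ℍ[ℝ]) 1) :
    SOinSU.toReal (rotationSO q) = quaternionRotationReal q := rfl

instance rotationAction : MulAction (Metric.sphere (0 : ℍ[ℝ]) 1) (SOinSU 3) :=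
  MulAction.compHom (SOinSU 3) rotationSO

theorem sphere_smul_def (q : Metric.sphere (0 : ℍ[ℝ]) 1) (A : SOinSU 3) :
    q • A = rotationSO q * A := rfl

instance continuousSMul_rotationAction :
    ContinuousSMul (Metric.sphere (0 : ℍ[ℝ]) 1) (SOinSU 3) where
  continuous_smul := (continuous_rotationSO.comp continuous_fst).mul continuous_snd

theorem continuous_axisQuaternion : Continuous axisQuaternion := by
  have hc : ∀ i j, Continuous fun R : Matrix (Fin 3) (Fin 3) ℝ => R i j :=
    continuous_id.matrix_elem
  refine Quaternion.linearIsometryEquivTuple.toHomeomorph.isInducing.continuous_iff.2 ?_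
  refine (PiLp.continuous_toLp 2 _).comp (continuous_pi fun i => ?_)
  fin_cases i
  exacts [continuous_const.add continuous_id.matrix_trace, (hc 2 1).sub (hc 1 2),
    (hc 0 2).sub (hc 2 0), (hc 1 0).sub (hc 0 1)]

theorem axisQuaternion_ne_zero {A : SOinSU 3} (h : 0 < 1 + (SOinSU.toReal A).trace) :
    axisQuaternion (SOinSU.toReal A) ≠ 0 := by
  intro h0
  have := congrArg QuaternionAlgebra.re h0
  exact h.ne' this

/-- A unit quaternion representing a rotation which is not a half-turn. -/
def rotationSection (A : SOinSU 3) : Metric.sphere (0 : ℍ[ℝ]) 1 :=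
  if h : 0 < 1 + (SOinSU.toReal A).trace then
    unitVector (axisQuaternion (SOinSU.toReal A)) (axisQuaternion_ne_zero h)
  else 1

theorem continuousOn_rotationSection :
    ContinuousOn rotationSection {A | 0 < 1 + (SOinSU.toReal A).trace} := by
  rw [continuousOn_iff_continuous_domRestrict]
  refine (continuous_unitVector (P := fun A : {A : SOinSU 3 | 0 < 1 + (SOinSU.toReal A).trace} =>
    axisQuaternion (SOinSU.toReal A.1)) (continuous_axisQuaternion.comp
      (SOinSU.continuous_toReal.comp continuous_subtype_val))
    fun A => axisQuaternion_ne_zero A.2).congr fun A => ?_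
  rw [Set.domRestrict_apply, rotationSection, dif_pos A.2.out]

/-- The action of the unit quaternions on `SO(3)` has local sections. -/
def rotationLocalSection : LocalSection (Metric.sphere (0 : ℍ[ℝ]) 1) (SOinSU 3) 1 where
  d A B := 3 - ((SOinSU.toReal A)ᵀ * SOinSU.toReal B).trace
  continuous_d := continuous_const.sub
    (((SOinSU.continuous_toReal.comp continuous_fst).matrix_transpose.mul
      (SOinSU.continuous_toReal.comp continuous_snd)).matrix_trace)
  d_self A := by
    rw [SOinSU.transpose_mul_toReal, Matrix.trace_one]
    simp
  d_smul q A B := by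
    rw [sphere_smul_def, sphere_smul_def, SOinSU.toReal_mul, SOinSU.toReal_mul,
      Matrix.transpose_mul, Matrix.mul_assoc, ← Matrix.mul_assoc _ (SOinSU.toReal (rotationSO q)),
      SOinSU.transpose_mul_toReal, one_mul]
  ε := 4
  ε_pos := four_pos
  sec := rotationSection
  continuousOn_sec := by
    refine continuousOn_rotationSection.mono fun A hA => ?_
    have h : 3 - ((SOinSU.toReal (1 : SOinSU 3))ᵀ * SOinSU.toReal A).trace < 4 := hA
    rw [SOinSU.toReal_one, Matrix.transpose_one, one_mul] at h
    change 0 < 1 + (SOinSU.toReal A).trace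
    linarith
  sec_smul A hA := by
    have h : 0 < 1 + (SOinSU.toReal A).trace := by
      simp only [SOinSU.toReal_one, Matrix.transpose_one, one_mul] at hA
      linarith
    obtain ⟨h1, h2⟩ := quaternionRotationReal_axisQuaternion (SOinSU.toReal_mul_transpose A)
      (SOinSU.transpose_mul_toReal A) (SOinSU.transpose_toReal A)
    rw [sphere_smul_def, mul_one]
    apply SOinSU.toReal_injective
    rw [rotationSection, dif_pos h, toReal_rotationSO]
    have h3 : ∀ (r : ℝ) (q : ℍ[ℝ]), quaternionRotationReal (r • q) =
        r ^ 2 • quaternionRotationReal q := fun r q => by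
      ext i j
      fin_cases i <;> fin_cases j <;> simp [quaternionRotationReal] <;> ring
    rw [unitVector, h3, h1, inv_pow, sq, ← Quaternion.normSq_eq_norm_mul_self, h2, smul_smul,
      inv_mul_cancel₀ (mul_pos four_pos h).ne', one_smul]
  sec_base := by
    have h : axisQuaternion (SOinSU.toReal (1 : SOinSU 3)) = (4 : ℝ) • (1 : ℍ[ℝ]) := by
      rw [SOinSU.toReal_one]
      ext
      · simp [axisQuaternion, Matrix.trace_one]
        norm_num
      all_goals simp [axisQuaternion]
    have h' : 0 < 1 + (SOinSU.toReal (1 : SOinSU 3)).trace := by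
      rw [SOinSU.toReal_one, Matrix.trace_one]
      norm_num
    rw [rotationSection, dif_pos h']
    apply Subtype.ext
    simp only [unitVector, h, norm_smul, smul_smul]
    norm_num

theorem sq_re_of_rotation_eq_one {q : Metric.sphere (0 : ℍ[ℝ]) 1} (h : rotationSO q = 1) :
    (q : ℍ[ℝ]).re ^ 2 = 1 := by
  have h1 := congrArg Matrix.trace (congrArg SOinSU.toReal h)
  rw [SOinSU.toReal_one, Matrix.trace_one, toReal_rotationSO, Matrix.trace_fin_three] at h1
  simp [quaternionRotationReal] at h1
  linarith [sq_add_of_mem_sphere q]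

theorem eq_one_of_re_eq_one {q : Metric.sphere (0 : ℍ[ℝ]) 1} (h : (q : ℍ[ℝ]).re = 1) : q = 1 := by
  have h1 := sq_add_of_mem_sphere q
  have hI := sq_nonneg (q : ℍ[ℝ]).imI
  have hJ := sq_nonneg (q : ℍ[ℝ]).imJ
  have hK := sq_nonneg (q : ℍ[ℝ]).imK
  rw [h] at h1
  apply Subtype.ext
  ext
  · exact h
  · exact pow_eq_zero_iff two_ne_zero |>.1 (by linarith)
  · exact pow_eq_zero_iff two_ne_zero |>.1 (by linarith)
  · exact pow_eq_zero_iff two_ne_zero |>.1 (by linarith)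

theorem rotation_stabilizer_loop {n : ℕ}
    (f : Ω^ (Fin (n + 1)) (MulAction.stabilizer (Metric.sphere (0 : ℍ[ℝ]) 1) (1 : SOinSU 3)) 1) :
    f = GenLoop.const := by
  have hs : ∀ t, (f t).1.1.re ^ 2 = 1 := fun t => sq_re_of_rotation_eq_one (by
    have := (f t).2
    rwa [MulAction.mem_stabilizer_iff, sphere_smul_def, mul_one] at this)
  have hc : Continuous fun t => (f t).1.1.re := Quaternion.continuous_re.comp
    (continuous_subtype_val.comp (continuous_subtype_val.comp (GenLoop.cont f)))
  ext1 t
  apply Subtype.ext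
  refine eq_one_of_re_eq_one ?_
  have h0 : (f 0).1.1.re = 1 := by
    rw [GenLoop.bdry f ⟨0, Or.inl rfl⟩]
    rfl
  exact isPreconnected_univ.eq_of_sq_eq hc.continuousOn continuousOn_const
    (fun t _ => by simpa using hs t) (fun _ => one_ne_zero) (Set.mem_univ 0) h0 (Set.mem_univ t)

theorem rotationSO_map_surjective (n : ℕ) : Function.Surjective (HomotopyGroup.map
    (N := Fin (n + 2)) rotationSO continuous_rotationSO (map_one _)) := by
  have h := rotationLocalSection.map_orbit_surjective (n := n + 1) fun h => by
    rw [rotation_stabilizer_loop h]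
  intro z
  obtain ⟨w, hw⟩ := h z
  refine ⟨w, ?_⟩
  obtain ⟨f, rfl⟩ := HomotopyGroup.mk_surjective w
  rw [← hw]
  refine congrArg HomotopyGroup.mk ?_
  ext1 t
  exact (mul_one _).symm

theorem homotopic_const_SO (f : Ω^ (Fin 2) (SOinSU 3) 1) : GenLoop.Homotopic f GenLoop.const := by
  obtain ⟨w, hw⟩ := rotationSO_map_surjective 0 (HomotopyGroup.mk f)
  obtain ⟨g, rfl⟩ := HomotopyGroup.mk_surjective w
  have hg : GenLoop.Homotopic g GenLoop.const :=
    GenLoop.homotopic_const_of_card_lt (by rw [Quaternion.finrank_eq_four]; simp) _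
  have h := GenLoop.Homotopic.map continuous_rotationSO (map_one _) hg
  rw [HomotopyGroup.map_mk, HomotopyGroup.mk_eq_iff] at hw
  refine hw.symm.trans (h.trans ?_)
  have : GenLoop.map rotationSO continuous_rotationSO (map_one _) (GenLoop.const (N := Fin 2)) =
      GenLoop.const := by
    ext1 t
    exact map_one rotationSO
  rw [this]

end RotationAction

section QuotientSection

open scoped unitInterval Topology.Homotopy

/-- The oriented orthonormal frame with first and last vectors in the directions of `a` and `c`. -/
def orthoFrame (a c : Fin 3 → ℝ) : Matrix (Fin 3) (Fin 3) ℝ :=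
  Matrix.of ![(Real.sqrt (a ⬝ᵥ a))⁻¹ • a,
    ((Real.sqrt (c ⬝ᵥ c))⁻¹ * (Real.sqrt (a ⬝ᵥ a))⁻¹) • (c ⨯₃ a), (Real.sqrt (c ⬝ᵥ c))⁻¹ • c]

theorem orthoFrame_orthogonal {a c : Fin 3 → ℝ} (ha : 0 < a ⬝ᵥ a) (hc : 0 < c ⬝ᵥ c)
    (h : a ⬝ᵥ c = 0) :
    orthoFrame a c * (orthoFrame a c)ᵀ = 1 ∧ (orthoFrame a c).det = 1 := by
  have h1 : (Real.sqrt (a ⬝ᵥ a))⁻¹ ^ 2 * (a ⬝ᵥ a) = 1 := by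
    rw [inv_pow, Real.sq_sqrt ha.le, inv_mul_cancel₀ ha.ne']
  have h2 : (Real.sqrt (c ⬝ᵥ c))⁻¹ ^ 2 * (c ⬝ᵥ c) = 1 := by
    rw [inv_pow, Real.sq_sqrt hc.le, inv_mul_cancel₀ hc.ne']
  unfold orthoFrame
  generalize (Real.sqrt (a ⬝ᵥ a))⁻¹ = r at h1 ⊢
  generalize (Real.sqrt (c ⬝ᵥ c))⁻¹ = s at h2 ⊢
  simp only [dotProduct, Fin.sum_univ_three] at h1 h2 h
  have h3 : (r * s) ^ 2 * (a 0 * a 0 + a 1 * a 1 + a 2 * a 2) *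
      (c 0 * c 0 + c 1 * c 1 + c 2 * c 2) = 1 := by
    linear_combination (s ^ 2 * (c 0 * c 0 + c 1 * c 1 + c 2 * c 2)) * h1 + h2
  constructor
  · ext i j
    fin_cases i <;> fin_cases j <;>
      simp [Matrix.mul_apply, Fin.sum_univ_three, cross_apply]
    · linear_combination h1
    · ring
    · linear_combination r * s * h
    · ring
    · linear_combination h3 - (r * s) ^ 2 * (a 0 * c 0 + a 1 * c 1 + a 2 * c 2) * h
    · ring
    · linear_combination r * s * h
    · ring
    · linear_combination h2
  · simp [Matrix.det_fin_three, cross_apply]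
    linear_combination h3 - (r * s) ^ 2 * (a 0 * c 0 + a 1 * c 1 + a 2 * c 2) * h

theorem cross_vecMul {h : Matrix (Fin 3) (Fin 3) ℝ} (hh : hᵀ = adjugate h) (a b : Fin 3 → ℝ) :
    (a ᵥ* h) ⨯₃ (b ᵥ* h) = (a ⨯₃ b) ᵥ* h := by
  have : (a ᵥ* h) ⨯₃ (b ᵥ* h) = (a ⨯₃ b) ᵥ* (adjugate h)ᵀ := by
    ext i
    fin_cases i <;> simp [cross_apply, Matrix.vecMul, dotProduct, Fin.sum_univ_three,
      Matrix.adjugate_fin_three] <;> ring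
  rw [this, ← hh, Matrix.transpose_transpose]

theorem dotProduct_vecMul_self {n : ℕ} {h : Matrix (Fin n) (Fin n) ℝ} (hh : h * hᵀ = 1)
    (a : Fin n → ℝ) : (a ᵥ* h) ⬝ᵥ (a ᵥ* h) = a ⬝ᵥ a := by
  rw [← Matrix.dotProduct_mulVec, ← Matrix.vecMul_transpose, Matrix.vecMul_vecMul, hh,
    Matrix.vecMul_one]

theorem orthoFrame_vecMul {h : Matrix (Fin 3) (Fin 3) ℝ} (h1 : h * hᵀ = 1) (h2 : hᵀ = adjugate h)
    (a c : Fin 3 → ℝ) : orthoFrame (a ᵥ* h) (c ᵥ* h) = orthoFrame a c * h := by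
  unfold orthoFrame
  rw [dotProduct_vecMul_self h1, dotProduct_vecMul_self h1, cross_vecMul h2]
  funext i
  rw [Matrix.mul_apply_eq_vecMul]
  fin_cases i
  exacts [(Matrix.smul_vecMul (Real.sqrt (a ⬝ᵥ a))⁻¹ a h).symm, (Matrix.smul_vecMul ((Real.sqrt (c ⬝ᵥ c))⁻¹ * (Real.sqrt (a ⬝ᵥ a))⁻¹) (c ⨯₃ a) h).symm,
    (Matrix.smul_vecMul (Real.sqrt (c ⬝ᵥ c))⁻¹ c h).symm]

theorem continuousAt_orthoFrame {X : Type} [TopologicalSpace X] {a c : X → Fin 3 → ℝ} {x : X}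
    (ha : ContinuousAt a x) (hc : ContinuousAt c x) (h1 : 0 < a x ⬝ᵥ a x) (h2 : 0 < c x ⬝ᵥ c x) :
    ContinuousAt (fun y => orthoFrame (a y) (c y)) x := by
  have h : ∀ {u : X → Fin 3 → ℝ}, ContinuousAt u x → 0 < u x ⬝ᵥ u x →
      ContinuousAt (fun y => (Real.sqrt (u y ⬝ᵥ u y))⁻¹) x := fun {u} hu hu0 => by
    refine ContinuousAt.inv₀ (Real.continuous_sqrt.continuousAt.comp ?_) (Real.sqrt_pos.2 hu0).ne'
    exact (continuous_id.dotProduct continuous_id).continuousAt.comp hu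
  have hx : Continuous fun p : (Fin 3 → ℝ) × (Fin 3 → ℝ) => p.1 ⨯₃ p.2 := by
    simp only [cross_apply]
    fun_prop
  refine continuousAt_pi.2 fun i => ?_
  fin_cases i
  exacts [(h ha h1).smul ha, ((h hc h2).mul (h ha h1)).smul
    (hx.continuousAt.comp (hc.prodMk ha)), (h hc h2).smul hc]

/-- A real special orthogonal matrix as an element of `SO(n)`. -/
def SOinSU.ofReal {n : ℕ} (R : Matrix (Fin n) (Fin n) ℝ) (h : R * Rᵀ = 1) (hd : R.det = 1) :
    SOinSU n :=
  ⟨SU.mk (R.map Complex.ofReal) (by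
      have := congrArg Complex.ofRealHom.mapMatrix h
      rw [map_mul, map_one] at this
      rw [← this]
      congr 1
      ext i j
      simp [Matrix.star_apply])
    (by
      have := RingHom.map_det Complex.ofRealHom R
      rw [hd, map_one] at this
      exact this.symm), mem_SOinSU_iff.2 ⟨R, rfl⟩⟩

theorem SOinSU.toReal_ofReal {n : ℕ} {R : Matrix (Fin n) (Fin n) ℝ} (h : R * Rᵀ = 1)
    (hd : R.det = 1) : SOinSU.toReal (SOinSU.ofReal R h hd) = R := by
  ext i j
  exact Complex.ofReal_re _

/-- The real part of an element of `SU(n)`. -/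
def SU.rePart {n : ℕ} (A : SU n) : Matrix (Fin n) (Fin n) ℝ := (SU.toMatrix A).map Complex.re

theorem SU.continuous_rePart {n : ℕ} : Continuous (SU.rePart (n := n)) :=
  SU.continuous_toMatrix.matrix_map Complex.continuous_re

theorem SU.rePart_mul {n : ℕ} (A : SU n) (h : SOinSU n) :
    SU.rePart (A * h.1) = SU.rePart A * SOinSU.toReal h := by
  ext i j
  simp [SU.rePart, SOinSU.toMatrix_eq h, Matrix.mul_apply]

/-- The vector product of the first two rows of the real part. -/
def rowCross (A : SU 3) : Fin 3 → ℝ := SU.rePart A 0 ⨯₃ SU.rePart A 1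

theorem rowCross_mul (A : SU 3) (h : SOinSU 3) : rowCross (A * h.1) =
    rowCross A ᵥ* SOinSU.toReal h := by
  rw [rowCross, SU.rePart_mul, Matrix.mul_apply_eq_vecMul, Matrix.mul_apply_eq_vecMul,
    cross_vecMul (SOinSU.transpose_toReal h), rowCross]

theorem continuous_rowCross : Continuous rowCross := by
  have h : ∀ i, Continuous fun A : SU 3 => SU.rePart A i := fun i =>
    (continuous_apply i).comp SU.continuous_rePart
  have hx : Continuous fun p : (Fin 3 → ℝ) × (Fin 3 → ℝ) => p.1 ⨯₃ p.2 := by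
    simp only [cross_apply]
    fun_prop
  exact hx.comp ((h 0).prodMk (h 1))

/-- The elements of `SU(3)` whose real part has independent first rows. -/
def rowRegular : Set (SU 3) := {A | 0 < rowCross A ⬝ᵥ rowCross A}

theorem isOpen_rowRegular : IsOpen rowRegular :=
  isOpen_lt continuous_const (continuous_rowCross.dotProduct continuous_rowCross)

theorem dotProduct_self_pos {n : ℕ} {v : Fin n → ℝ} (hv : v ≠ 0) : 0 < v ⬝ᵥ v := by
  have := dotProduct_star_self_pos_iff.2 hv
  rwa [star_trivial] at this

theorem row_pos {A : SU 3} (h : A ∈ rowRegular) : 0 < SU.rePart A 0 ⬝ᵥ SU.rePart A 0 := by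
  refine dotProduct_self_pos fun h0 => ?_
  have h' : rowCross A = 0 := by rw [rowCross, h0, map_zero, LinearMap.zero_apply]
  have h'' := h.out
  rw [h', dotProduct_zero] at h''
  exact lt_irrefl _ h''

theorem rowFrame_orthogonal {A : SU 3} (h : A ∈ rowRegular) :
    orthoFrame (SU.rePart A 0) (rowCross A) * (orthoFrame (SU.rePart A 0) (rowCross A))ᵀ = 1 ∧
      (orthoFrame (SU.rePart A 0) (rowCross A)).det = 1 :=
  orthoFrame_orthogonal (row_pos h) h (dot_self_cross _ _)

open Classical in
/-- The Gram-Schmidt frame of the rows of the real part. -/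
def rowFrame (A : SU 3) : SOinSU 3 :=
  if h : A ∈ rowRegular then
    SOinSU.ofReal (orthoFrame (SU.rePart A 0) (rowCross A)) (rowFrame_orthogonal h).1
      (rowFrame_orthogonal h).2
  else 1

theorem toReal_rowFrame {A : SU 3} (h : A ∈ rowRegular) :
    SOinSU.toReal (rowFrame A) = orthoFrame (SU.rePart A 0) (rowCross A) := by
  rw [rowFrame, dif_pos h, SOinSU.toReal_ofReal]

theorem mul_mem_rowRegular {A : SU 3} (hA : A ∈ rowRegular) (h : SOinSU 3) :
    A * h.1 ∈ rowRegular := by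
  have : 0 < rowCross (A * h.1) ⬝ᵥ rowCross (A * h.1) := by
    rw [rowCross_mul, dotProduct_vecMul_self (SOinSU.toReal_mul_transpose h)]
    exact hA
  exact this

theorem rowFrame_mul {A : SU 3} (hA : A ∈ rowRegular) (h : SOinSU 3) :
    rowFrame (A * h.1) = rowFrame A * h := by
  apply SOinSU.toReal_injective
  rw [SOinSU.toReal_mul, toReal_rowFrame hA, toReal_rowFrame (mul_mem_rowRegular hA h),
    SU.rePart_mul, rowCross_mul, Matrix.mul_apply_eq_vecMul,
    orthoFrame_vecMul (SOinSU.toReal_mul_transpose h) (SOinSU.transpose_toReal h)]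

theorem continuousAt_rowFrame {A : SU 3} (hA : A ∈ rowRegular) : ContinuousAt rowFrame A := by
  refine Topology.IsInducing.subtypeVal.continuousAt_iff.2
    (Topology.IsInducing.subtypeVal.continuousAt_iff.2
      (Topology.IsInducing.subtypeVal.continuousAt_iff.2 ?_))
  have h1 : ContinuousAt (fun B => orthoFrame (SU.rePart B 0) (rowCross B)) A :=
    continuousAt_orthoFrame ((continuous_apply 0).comp SU.continuous_rePart).continuousAt
      continuous_rowCross.continuousAt (row_pos hA) hA
  have h2 : Continuous fun R : Matrix (Fin 3) (Fin 3) ℝ => R.map Complex.ofReal :=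
    continuous_id.matrix_map Complex.continuous_ofReal
  refine (h2.continuousAt.comp h1).congr ?_
  filter_upwards [isOpen_rowRegular.mem_nhds hA] with B hB
  change _ = SU.toMatrix (rowFrame B).1
  rw [SOinSU.toMatrix_eq, toReal_rowFrame hB]
  rfl

/-- The entrywise sum of squares of the imaginary part is at least one if the real part has
a nontrivial left kernel. -/
theorem one_le_sum_im_sq (A : SU 3) {v : Fin 3 → ℝ} (hv : v ≠ 0) (h : v ᵥ* SU.rePart A = 0) :
    1 ≤ ∑ j, ∑ i, (SU.toMatrix A i j).im ^ 2 := by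
  let K : Matrix (Fin 3) (Fin 3) ℝ := (SU.toMatrix A).map Complex.im
  have hK : SU.rePart A * (SU.rePart A)ᵀ + K * Kᵀ = 1 := by
    ext i j
    have := congrArg Complex.re (congrFun (congrFun (SU.mul_star A) i) j)
    simp only [Matrix.mul_apply, Matrix.star_apply, Complex.re_sum, Complex.mul_re,
      Complex.star_def, Complex.conj_re, Complex.conj_im, mul_neg, sub_neg_eq_add,
      Matrix.one_apply, apply_ite Complex.re, Complex.one_re, Complex.zero_re] at this
    simpa only [Matrix.add_apply, Matrix.mul_apply, ← Finset.sum_add_distrib, K, SU.rePart,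
      Matrix.map_apply, Matrix.transpose_apply, Matrix.one_apply] using this
  have hvK : (v ᵥ* K) ⬝ᵥ (v ᵥ* K) = v ⬝ᵥ v := by
    rw [← Matrix.dotProduct_mulVec, ← Matrix.vecMul_transpose, Matrix.vecMul_vecMul]
    have := congrArg (fun M => v ᵥ* M) hK
    simp only [Matrix.vecMul_add, ← Matrix.vecMul_vecMul, h, Matrix.zero_vecMul, zero_add,
      Matrix.vecMul_one] at this
    rw [← Matrix.vecMul_vecMul, this]
  have hle : (v ᵥ* K) ⬝ᵥ (v ᵥ* K) ≤ (v ⬝ᵥ v) * ∑ j, ∑ i, K i j ^ 2 := by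
    rw [Finset.mul_sum]
    refine Finset.sum_le_sum fun j _ => ?_
    have := Finset.sum_mul_sq_le_sq_mul_sq Finset.univ v fun i => K i j
    simp only [Matrix.vecMul, dotProduct, ← sq] at this ⊢
    exact this
  rw [hvK] at hle
  exact le_of_mul_le_mul_left (by rwa [mul_one]) (dotProduct_self_pos hv)

theorem mem_rowRegular {A : SU 3} (h : 1 < (SU.toMatrix A * (SU.toMatrix A)ᵀ).trace.re) :
    A ∈ rowRegular := by
  by_contra hA
  have hc : rowCross A = 0 := by
    by_contra hc
    exact hA (dotProduct_self_pos hc)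
  have hv : ∃ v : Fin 3 → ℝ, v ≠ 0 ∧ v ᵥ* SU.rePart A = 0 := by
    by_cases h0 : SU.rePart A 0 = 0
    · refine ⟨Pi.single 0 1, by simp, ?_⟩
      rw [Matrix.single_one_vecMul]
      exact h0
    · refine ⟨![-(SU.rePart A 0 ⬝ᵥ SU.rePart A 1), SU.rePart A 0 ⬝ᵥ SU.rePart A 0, 0],
        fun hv => (dotProduct_self_pos h0).ne' (congrFun hv 1), ?_⟩
      have c0 := congrFun hc 0
      have c1 := congrFun hc 1
      have c2 := congrFun hc 2
      simp [rowCross, cross_apply] at c0 c1 c2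
      ext j
      fin_cases j <;> simp [Matrix.vecMul, dotProduct, Fin.sum_univ_three]
      · linear_combination SU.rePart A 0 2 * c1 - SU.rePart A 0 1 * c2
      · linear_combination SU.rePart A 0 0 * c2 - SU.rePart A 0 2 * c0
      · linear_combination SU.rePart A 0 1 * c0 - SU.rePart A 0 0 * c1
  obtain ⟨v, hv0, hv⟩ := hv
  have h1 := one_le_sum_im_sq A hv0 hv
  have h2 := congrArg (fun M => Complex.re (Matrix.trace M)) (SU.mul_star A)
  simp [Matrix.trace_fin_three, Matrix.mul_apply, Fin.sum_univ_three] at h h2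
  simp only [Fin.sum_univ_three] at h1
  linarith

end QuotientSection

section QuotientFibration

open scoped unitInterval Topology.Homotopy Quaternion

/-- The symmetric unitary matrix `A Aᵀ`. -/
def SU.gram {n : ℕ} (A : SU n) : Matrix (Fin n) (Fin n) ℂ := SU.toMatrix A * (SU.toMatrix A)ᵀ

theorem SU.gram_mul_SO {n : ℕ} (A : SU n) (h : SOinSU n) : SU.gram (A * h.1) = SU.gram A := by
  have hh : SU.toMatrix h.1 * (SU.toMatrix h.1)ᵀ = 1 := by
    rw [SOinSU.toMatrix_eq]
    have := congrArg Complex.ofRealHom.mapMatrix (SOinSU.toReal_mul_transpose h)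
    rwa [map_mul, map_one] at this
  rw [SU.gram, map_mul, Matrix.transpose_mul, Matrix.mul_assoc, ← Matrix.mul_assoc _ _ᵀ, hh,
    one_mul, SU.gram]

theorem SU.continuous_gram {n : ℕ} : Continuous (SU.gram (n := n)) :=
  SU.continuous_toMatrix.mul SU.continuous_toMatrix.matrix_transpose

theorem SU.transpose_mul_star_transpose {n : ℕ} (A : SU n) :
    (SU.toMatrix A)ᵀ * star (SU.toMatrix A)ᵀ = 1 := by
  have h : star (SU.toMatrix A)ᵀ = (star (SU.toMatrix A))ᵀ := rfl
  rw [h, ← Matrix.transpose_mul, SU.star_mul, Matrix.transpose_one]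

theorem SU.star_transpose_mul_transpose {n : ℕ} (A : SU n) :
    star (SU.toMatrix A)ᵀ * (SU.toMatrix A)ᵀ = 1 := by
  have h : star (SU.toMatrix A)ᵀ = (star (SU.toMatrix A))ᵀ := rfl
  rw [h, ← Matrix.transpose_mul, SU.mul_star, Matrix.transpose_one]

theorem SU.star_gram_mul_gram {n : ℕ} (A : SU n) : star (SU.gram A) * SU.gram A = 1 := by
  rw [SU.gram, StarMul.star_mul, Matrix.mul_assoc, ← Matrix.mul_assoc (star _) _ _ᵀ, SU.star_mul,
    one_mul, SU.star_transpose_mul_transpose]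

/-- The invariant of cosets given by `A Aᵀ`. -/
def cosetGram (x : SU 3 ⧸ SOinSU 3) : Matrix (Fin 3) (Fin 3) ℂ := SU.gram x.out

theorem cosetGram_mk (A : SU 3) : cosetGram (QuotientGroup.mk A) = SU.gram A := by
  obtain ⟨h, hh⟩ := QuotientGroup.mk_out_eq_mul (SOinSU 3) A
  rw [cosetGram, hh, SU.gram_mul_SO]

theorem continuous_cosetGram : Continuous cosetGram := by
  rw [(QuotientGroup.isOpenQuotientMap_mk (N := SOinSU 3)).isQuotientMap.continuous_iff]
  exact SU.continuous_gram.congr fun A => (cosetGram_mk A).symm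

theorem cosetGram_smul (A : SU 3) (x : SU 3 ⧸ SOinSU 3) : cosetGram (A • x) =
    SU.toMatrix A * cosetGram x * (SU.toMatrix A)ᵀ := by
  obtain ⟨B, rfl⟩ := QuotientGroup.mk_surjective x
  rw [MulAction.Quotient.smul_mk, cosetGram_mk, cosetGram_mk, smul_eq_mul, SU.gram, SU.gram,
    map_mul, Matrix.transpose_mul]
  simp only [Matrix.mul_assoc]

/-- The local section of the quotient map, defined where the real part is nondegenerate. -/
def cosetSection (x : SU 3 ⧸ SOinSU 3) : SU 3 := x.out * (rowFrame x.out)⁻¹.1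

theorem cosetSection_mk {A : SU 3} (hA : A ∈ rowRegular) :
    cosetSection (QuotientGroup.mk A) = A * (rowFrame A)⁻¹.1 := by
  obtain ⟨h, hh⟩ := QuotientGroup.mk_out_eq_mul (SOinSU 3) A
  rw [cosetSection, hh, rowFrame_mul hA, _root_.mul_inv_rev, Subgroup.coe_mul, mul_assoc,
    ← mul_assoc h.1, ← Subgroup.coe_mul, mul_inv_cancel, Subgroup.coe_one, one_mul]

theorem continuousAt_cosetSection {A : SU 3} (hA : A ∈ rowRegular) :
    ContinuousAt cosetSection (QuotientGroup.mk A) := by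
  rw [← (QuotientGroup.isOpenQuotientMap_mk (N := SOinSU 3)).continuousAt_comp_iff]
  have h : ContinuousAt (fun B => B * (rowFrame B)⁻¹.1) A :=
    continuousAt_id.mul (continuous_subtype_val.continuousAt.comp (continuousAt_rowFrame hA).inv)
  refine h.congr ?_
  filter_upwards [isOpen_rowRegular.mem_nhds hA] with B hB
  exact (cosetSection_mk hB).symm

theorem rowFrame_one : rowFrame 1 = 1 := by
  have h1 : SU.rePart (1 : SU 3) = 1 := by
    ext i j
    simp [SU.rePart, Matrix.one_apply, apply_ite Complex.re]
  have h2 : rowCross 1 = ![0, 0, 1] := by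
    rw [rowCross, h1]
    ext i
    fin_cases i <;> simp [cross_apply]
  have h : (1 : SU 3) ∈ rowRegular := by
    have : 0 < rowCross 1 ⬝ᵥ rowCross 1 := by simp [h2, dotProduct, Fin.sum_univ_three]
    exact this
  apply SOinSU.toReal_injective
  rw [toReal_rowFrame h, SOinSU.toReal_one, h2, h1]
  ext i j
  fin_cases i <;> fin_cases j <;>
    simp [orthoFrame, cross_apply, dotProduct, Fin.sum_univ_three]

theorem cosetSection_smul (x : SU 3 ⧸ SOinSU 3) :
    cosetSection x • (QuotientGroup.mk 1 : SU 3 ⧸ SOinSU 3) = x := by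
  rw [MulAction.Quotient.smul_mk, smul_eq_mul, mul_one, cosetSection,
    QuotientGroup.mk_mul_of_mem _ (rowFrame x.out)⁻¹.2]
  exact Quotient.out_eq x

/-- The quotient map `SU(3) → SU(3)/SO(3)` has local sections. -/
def cosetLocalSection : LocalSection (SU 3) (SU 3 ⧸ SOinSU 3) (QuotientGroup.mk 1) where
  d x y := 3 - (star (cosetGram x) * cosetGram y).trace.re
  continuous_d := continuous_const.sub (Complex.continuous_re.comp
    (((continuous_cosetGram.comp continuous_fst).star.mul
      (continuous_cosetGram.comp continuous_snd)).matrix_trace))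
  d_self x := by
    rw [cosetGram, SU.star_gram_mul_gram, Matrix.trace_one]
    simp
  d_smul A x y := by
    have h : star (cosetGram (A • x)) * cosetGram (A • y) = star (SU.toMatrix A)ᵀ *
        (star (cosetGram x) * cosetGram y * (SU.toMatrix A)ᵀ) := by
      rw [cosetGram_smul, cosetGram_smul, StarMul.star_mul, StarMul.star_mul]
      simp only [Matrix.mul_assoc]
      rw [← Matrix.mul_assoc (star (SU.toMatrix A)) (SU.toMatrix A), SU.star_mul, one_mul]
    rw [h, Matrix.trace_mul_comm, Matrix.mul_assoc, SU.transpose_mul_star_transpose, mul_one]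
  ε := 2
  ε_pos := two_pos
  sec := cosetSection
  continuousOn_sec x hx := by
    obtain ⟨A, rfl⟩ := QuotientGroup.mk_surjective x
    have hd : 3 - (star (cosetGram (QuotientGroup.mk 1)) *
      cosetGram (QuotientGroup.mk A)).trace.re < 2 := hx
    refine (continuousAt_cosetSection (mem_rowRegular ?_)).continuousWithinAt
    rw [cosetGram_mk, cosetGram_mk, SU.gram, map_one, Matrix.transpose_one, one_mul, star_one,
      one_mul, SU.gram] at hd
    linarith
  sec_smul x _ := cosetSection_smul x
  sec_base := by
    have h : (1 : SU 3) ∈ rowRegular := mem_rowRegular (by simp)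
    rw [cosetSection_mk h, rowFrame_one, inv_one, Subgroup.coe_one, mul_one]

theorem SU.stabilizer_mk_one : MulAction.stabilizer (SU 3)
    (QuotientGroup.mk 1 : SU 3 ⧸ SOinSU 3) = SOinSU 3 :=
  MulAction.stabilizer_quotient (SOinSU 3)

/-- The quotient map on third homotopy groups. -/
def cosetHom : HomotopyGroup (Fin 3) (SU 3) 1 →*
    HomotopyGroup (Fin 3) (SU 3 ⧸ SOinSU 3) (QuotientGroup.mk 1) :=
  HomotopyGroup.map (fun A => A • (QuotientGroup.mk 1 : SU 3 ⧸ SOinSU 3))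
    (continuous_orbitMap _) (one_smul _ _)

theorem cosetHom_surjective : Function.Surjective cosetHom := by
  refine cosetLocalSection.map_orbit_surjective (n := 2) ?_
  rw [SU.stabilizer_mk_one]
  exact homotopic_const_SO

theorem cosetHom_eq_one_iff (z : HomotopyGroup (Fin 3) (SU 3) 1) : cosetHom z = 1 ↔
    ∃ w, HomotopyGroup.map (N := Fin 3) rotationSU continuous_rotationSU (map_one _) w = z := by
  constructor
  · obtain ⟨f, rfl⟩ := HomotopyGroup.mk_surjective z
    intro h
    have h' := cosetLocalSection.exists_stabilizer_loop f (HomotopyGroup.mk_eq_iff.1 h)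
    rw [SU.stabilizer_mk_one] at h'
    obtain ⟨g, hg⟩ := h'
    obtain ⟨w, hw⟩ := rotationSO_map_surjective 1 (HomotopyGroup.mk g)
    refine ⟨w, ?_⟩
    rw [← HomotopyGroup.mk_eq_iff.2 hg, ← HomotopyGroup.map_mk, ← hw]
    obtain ⟨k, rfl⟩ := HomotopyGroup.mk_surjective w
    rfl
  · rintro ⟨w, rfl⟩
    obtain ⟨k, rfl⟩ := HomotopyGroup.mk_surjective w
    refine congrArg HomotopyGroup.mk ?_
    ext1 t
    refine (MulAction.Quotient.smul_mk _ _ _).trans ?_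
    rw [smul_eq_mul, mul_one]
    exact QuotientGroup.eq.2 (by simpa using rotationSU_mem (k t))

end QuotientFibration

section Assembly

/-- If a cyclic group `K` maps to `G` by two homomorphisms `ι`, `α`, the first surjective, which
are related by a real-valued character of infinite order as multiplication by `m`, then the
cokernel of `α` is cyclic of order `m`. -/
theorem nonempty_mulEquiv_zmod {K G P : Type} [Group K] [Group G] [Group P] [IsCyclic K]
    (ι α : K →* G) (N : G →* Multiplicative ℝ) (p : G →* P) {m : ℕ}
    (hι : Function.Surjective ι) (hp : Function.Surjective p)
    (hα : ∀ x, N (α x) = N (ι x) ^ m) (hN : ∃ x, N (ι x) ≠ 1)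
    (hker : ∀ g, p g = 1 ↔ ∃ x, α x = g) : Nonempty (P ≃* Multiplicative (ZMod m)) := by
  obtain ⟨k, hk⟩ := IsCyclic.exists_generator (α := K)
  have hgen : ∀ g : G, ∃ i : ℤ, ι k ^ i = g := fun g => by
    obtain ⟨x, rfl⟩ := hι g
    obtain ⟨i, rfl⟩ := Subgroup.mem_zpowers_iff.1 (hk x)
    exact ⟨i, (map_zpow ι k i).symm⟩
  have hNk : N (ι k) ≠ 1 := fun h => by
    obtain ⟨x, hx⟩ := hN
    obtain ⟨i, rfl⟩ := Subgroup.mem_zpowers_iff.1 (hk x)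
    rw [map_zpow, map_zpow, h, _root_.one_zpow] at hx
    exact hx rfl
  have hinj : ∀ i j : ℤ, N (ι k) ^ i = N (ι k) ^ j → i = j := fun i j h => by
    have h' : (i : ℝ) * (N (ι k)).toAdd = j * (N (ι k)).toAdd := by
      simpa using congrArg Multiplicative.toAdd h
    exact_mod_cast mul_right_cancel₀ (fun h0 => hNk h0) h'
  have hαk : α k = ι k ^ (m : ℤ) := by
    obtain ⟨i, hi⟩ := hgen (α k)
    have := hα k
    rw [← hi, map_zpow, ← zpow_natCast] at this
    rw [← hi, hinj _ _ this]
  have hone : ∀ i : ℤ, p (ι k) ^ i = 1 ↔ (m : ℤ) ∣ i := fun i => by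
    rw [← map_zpow, hker]
    constructor
    · rintro ⟨x, hx⟩
      obtain ⟨j, rfl⟩ := Subgroup.mem_zpowers_iff.1 (hk x)
      rw [map_zpow, hαk, ← _root_.zpow_mul] at hx
      have := congrArg N hx
      rw [map_zpow, map_zpow] at this
      exact ⟨j, (hinj _ _ this).symm⟩
    · rintro ⟨j, rfl⟩
      exact ⟨k ^ j, by rw [map_zpow, hαk, ← _root_.zpow_mul]⟩
  have hgenP : ∀ x : P, x ∈ Subgroup.zpowers (p (ι k)) := fun x => by
    obtain ⟨g, rfl⟩ := hp x
    obtain ⟨i, rfl⟩ := hgen g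
    exact ⟨i, (map_zpow p _ i).symm⟩
  have : IsCyclic P := ⟨_, hgenP⟩
  have hcard : Nat.card P = m := by
    rw [← orderOf_eq_card_of_forall_mem_zpowers hgenP]
    refine Nat.dvd_antisymm ?_ ?_
    · exact orderOf_dvd_of_pow_eq_one (by rw [← zpow_natCast, hone])
    · have := (hone (orderOf (p (ι k)))).1 (by rw [zpow_natCast, pow_orderOf_eq_one])
      exact_mod_cast this
  subst hcard
  exact ⟨(zmodCyclicMulEquiv this).symm⟩

end Assembly

/-- **Instantons in Partially Broken Gauge Groups**: `π₃(SU(3)/SO(3)) ≅ ℤ/4ℤ`. -/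
theorem pi3_SU3_quotient_SO3 :
    Nonempty ((π_ 3 ((↥(SU 3)) ⧸ SOinSU 3) (QuotientGroup.mk 1)) ≃* Multiplicative (ZMod 4)) := by
  have := isCyclic_homotopyGroup_sphere 2 (E := Quaternion ℝ) Quaternion.finrank_eq_four 1
  exact nonempty_mulEquiv_zmod
    (HomotopyGroup.map (N := Fin 3) blockSU continuous_blockSU (map_one _))
    (HomotopyGroup.map (N := Fin 3) rotationSU continuous_rotationSU (map_one _))
    SU.traceHom cosetHom blockSU_map_surjective cosetHom_surjective
    SU.traceHom_rotationSU SU.exists_traceHom_ne_one cosetHom_eq_one_iff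

end
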